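/- For every pair of even integers m, n ≥ 0 with 2 ≤ m + n ≤ 10 there exist real symmetric 4×4 matrices Q₀,Q₁,Q₂,Q₃ such that the associated determinantal quartic X ⊂ ℂP³ is transversal, its spectrahedral region R ⊂ ℝP³ is nonempty, X has exactly m + n real nodes, exactly m of these real nodes lie (as points of ℝP³) in the closure of R, and exactly n of them do not lie in the closure of R. -/

import Mathlib

open Matrix
open scoped LinearAlgebra.Projectivization

noncomputable section

/-- The topology on real projective 3-space, as a quotient of `(Fin 4 → ℝ) ∖ {0}`. -/
instance : TopologicalSpace (ℙ ℝ (Fin 4 → ℝ)) :=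
  inferInstanceAs (TopologicalSpace (Quotient (projectivizationSetoid ℝ (Fin 4 → ℝ))))

namespace DetQuartic

/-- The complex matrix `Q(x) = x₀Q₀ + x₁Q₁ + x₂Q₂ + x₃Q₃` of the pencil, for `x ∈ ℂ⁴`. -/
def Qc (Q : Fin 4 → Matrix (Fin 4) (Fin 4) ℝ) (x : Fin 4 → ℂ) : Matrix (Fin 4) (Fin 4) ℂ :=
  ∑ i, x i • (Q i).map (fun a => (a : ℂ))

/-- The real matrix `Q(x)` for `x ∈ ℝ⁴`. -/
def Qr (Q : Fin 4 → Matrix (Fin 4) (Fin 4) ℝ) (x : Fin 4 → ℝ) : Matrix (Fin 4) (Fin 4) ℝ :=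
  ∑ i, x i • Q i

/-- `f(x) = det Q(x)`, a homogeneous quartic polynomial function on `ℂ⁴`. -/
def detQ (Q : Fin 4 → Matrix (Fin 4) (Fin 4) ℝ) (x : Fin 4 → ℂ) : ℂ := (Qc Q x).det

/-- All four partial derivatives of `f` vanish at `x`. -/
def gradVanishes (Q : Fin 4 → Matrix (Fin 4) (Fin 4) ℝ) (x : Fin 4 → ℂ) : Prop :=
  ∀ i, fderiv ℂ (detQ Q) x (Pi.single i 1) = 0

/-- The Hessian matrix of `f` at `x`. -/
def hessian (Q : Fin 4 → Matrix (Fin 4) (Fin 4) ℝ) (x : Fin 4 → ℂ) :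
    Matrix (Fin 4) (Fin 4) ℂ :=
  Matrix.of fun i j =>
    fderiv ℂ (fun y => fderiv ℂ (detQ Q) y (Pi.single j 1)) x (Pi.single i 1)

/-- `x` is a representative of a node: a singular point where the Hessian has rank `3`. -/
def IsNodeRep (Q : Fin 4 → Matrix (Fin 4) (Fin 4) ℝ) (x : Fin 4 → ℂ) : Prop :=
  gradVanishes Q x ∧ (hessian Q x).rank = 3

/-- The set of singular points of the determinantal quartic `X ⊆ ℂP³`. -/
def singPoints (Q : Fin 4 → Matrix (Fin 4) (Fin 4) ℝ) : Set (ℙ ℂ (Fin 4 → ℂ)) :=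
  {p | ∃ x, ∃ hx : x ≠ 0, p = Projectivization.mk ℂ x hx ∧ gradVanishes Q x}

/-- `X` is transversal: exactly ten singular points, all of which are nodes. -/
def Transversal (Q : Fin 4 → Matrix (Fin 4) (Fin 4) ℝ) : Prop :=
  (singPoints Q).Finite ∧ (singPoints Q).ncard = 10 ∧
    ∀ x : Fin 4 → ℂ, x ≠ 0 → gradVanishes Q x → (hessian Q x).rank = 3

/-- The complexification of a real vector. -/
def toC (x : Fin 4 → ℝ) : Fin 4 → ℂ := fun i => (x i : ℂ)

/-- The spectrahedral region `R ⊆ ℝP³`: classes of points where `Q(x)` is positive or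
negative definite. -/
def spectra (Q : Fin 4 → Matrix (Fin 4) (Fin 4) ℝ) : Set (ℙ ℝ (Fin 4 → ℝ)) :=
  {p | ∃ x, ∃ hx : x ≠ 0, p = Projectivization.mk ℝ x hx ∧
    ((Qr Q x).PosDef ∨ (-(Qr Q x)).PosDef)}

/-- The real nodes of `X`, regarded as points of `ℝP³`. -/
def realNodes (Q : Fin 4 → Matrix (Fin 4) (Fin 4) ℝ) : Set (ℙ ℝ (Fin 4 → ℝ)) :=
  {p | ∃ x, ∃ hx : x ≠ 0, p = Projectivization.mk ℝ x hx ∧ IsNodeRep Q (toC x)}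


/-! ### General lemmas -/

lemma fderiv_eval (p : MvPolynomial (Fin 4) ℂ) (x : Fin 4 → ℂ) (i : Fin 4) :
    DifferentiableAt ℂ (fun y => MvPolynomial.eval y p) x ∧
    fderiv ℂ (fun y => MvPolynomial.eval y p) x (Pi.single i 1) =
      MvPolynomial.eval x (MvPolynomial.pderiv i p) := by
  induction p using MvPolynomial.induction_on with
  | C a => simp
  | add p q hp hq =>
    simp only [map_add]
    refine ⟨hp.1.add hq.1, ?_⟩
    rw [fderiv_fun_add hp.1 hq.1]
    simp [hp.2, hq.2]
  | mul_X p n hp =>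
    have hX : DifferentiableAt ℂ (fun y : Fin 4 → ℂ => y n) x := differentiableAt_apply n x
    simp only [map_mul, MvPolynomial.eval_X]
    refine ⟨hp.1.mul hX, ?_⟩
    rw [fderiv_fun_mul hp.1 hX]
    have h2 : fderiv ℂ (fun y : Fin 4 → ℂ => y n) x = ContinuousLinearMap.proj n :=
      (ContinuousLinearMap.proj (R := ℂ) (φ := fun _ : Fin 4 => ℂ) n).fderiv
    simp only [h2, MvPolynomial.pderiv_mul, map_add, map_mul, MvPolynomial.eval_X,
      _root_.add_apply, _root_.smul_apply, hp.2, smul_eq_mul,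
      ContinuousLinearMap.proj_apply, MvPolynomial.pderiv_X]
    by_cases h : n = i
    · subst h; simp; ring
    · have h' : i ≠ n := fun e => h e.symm
      simp [Pi.single_apply, h]; ring

lemma rank_eq_three (H : Matrix (Fin 4) (Fin 4) ℂ) (x : Fin 4 → ℂ) (hx : x ≠ 0)
    (h0 : H *ᵥ x = 0) (e : Fin 3 → Fin 4) (hd : (H.submatrix e e).det ≠ 0) : H.rank = 3 := by
  have h1 : 3 ≤ H.rank := by
    have := Matrix.rank_submatrix_le H e e
    rw [Matrix.rank_of_det_ne_zero hd] at this
    simpa using this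
  have h2 : H.rank < 4 := by
    have hk := LinearMap.finrank_range_add_finrank_ker H.mulVecLin
    have hpos : 0 < Module.finrank ℂ (LinearMap.ker H.mulVecLin) := by
      rw [Module.finrank_pos_iff_exists_ne_zero]
      refine ⟨⟨x, by simpa using h0⟩, ?_⟩
      intro h; exact hx (congrArg Subtype.val h)
    simp at hk
    unfold Matrix.rank
    omega
  omega

lemma adj_zero (A : Matrix (Fin 4) (Fin 4) ℂ) (hs : A.IsSymm)
    (Qs : Fin 4 → Matrix (Fin 4) (Fin 4) ℂ) (hdet : A.det = 0)
    (htr : ∀ l, (A.adjugate * Qs l).trace = 0)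
    (hbp : ∀ v : Fin 4 → ℂ, (∀ l, v ⬝ᵥ (Qs l *ᵥ v) = 0) → v = 0) : A.adjugate = 0 := by
  by_contra hN
  have hAN : A * A.adjugate = 0 := by rw [Matrix.mul_adjugate, hdet, zero_smul]
  have hNs : A.adjugate.IsSymm := by
    unfold Matrix.IsSymm; rw [Matrix.adjugate_transpose, hs.eq]
  obtain ⟨i, j, hij⟩ : ∃ i j, A.adjugate i j ≠ 0 := by
    by_contra h; push Not at h; exact hN (by ext i j; simpa using h i j)
  have hr : 3 ≤ A.rank := by
    have h1 := hij
    rw [Matrix.adjugate_fin_succ_eq_det_submatrix] at h1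
    have h2 := right_ne_zero_of_mul h1
    have := Matrix.rank_submatrix_le A j.succAbove i.succAbove
    rw [Matrix.rank_of_det_ne_zero h2] at this
    simpa using this
  have hk := LinearMap.finrank_range_add_finrank_ker A.mulVecLin
  have hk1 : Module.finrank ℂ (LinearMap.ker A.mulVecLin) ≤ 1 := by
    unfold Matrix.rank at hr
    simp at hk
    omega
  obtain ⟨v, hv⟩ := finrank_le_one_iff.mp hk1
  have hcol : ∀ b, ∃ c : ℂ, ∀ a, A.adjugate a b = c * v.1 a := by
    intro b
    have hm : A *ᵥ (fun a => A.adjugate a b) = 0 := by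
      ext a
      have := congrFun (congrFun hAN a) b
      simpa [Matrix.mul_apply, Matrix.mulVec, dotProduct] using this
    obtain ⟨c, hc⟩ := hv ⟨fun a => A.adjugate a b, by simpa using hm⟩
    refine ⟨c, fun a => ?_⟩
    have := congrFun (congrArg Subtype.val hc) a
    simpa using this.symm
  choose w hw using hcol
  have hvi : v.1 i ≠ 0 := by
    intro h; apply hij; rw [hw, h, mul_zero]
  have hsym : ∀ a b, w b * v.1 a = w a * v.1 b := by
    intro a b
    rw [← hw, ← hw]; exact (hNs.apply a b).symm
  have hwv : ∀ b, w b = (w i / v.1 i) * v.1 b := by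
    intro b
    have := hsym i b
    field_simp
    linear_combination this
  have hκ : w i / v.1 i ≠ 0 := by
    intro h
    apply hij; rw [hw, hwv, h]; ring
  have hv0 : v.1 = 0 := by
    apply hbp
    intro l
    have h1 := htr l
    have h2 : (A.adjugate * Qs l).trace = (w i / v.1 i) * (v.1 ⬝ᵥ (Qs l *ᵥ v.1)) := by
      simp only [Matrix.trace, Matrix.diag, Matrix.mul_apply, dotProduct, Matrix.mulVec,
        Finset.mul_sum]
      rw [Finset.sum_comm]
      refine Finset.sum_congr rfl fun a _ => Finset.sum_congr rfl fun b _ => ?_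
      rw [hw, hwv]; ring
    rw [h2] at h1
    exact (mul_eq_zero.mp h1).resolve_left hκ
  exact hvi (by rw [hv0]; rfl)

/-! ### Closure of the spectrahedral region -/

lemma mk_continuous : Continuous (fun v : {v : Fin 4 → ℝ // v ≠ 0} =>
    Projectivization.mk ℝ v.1 v.2) := by
  exact continuous_quotient_mk'

lemma Qr_add (Q : Fin 4 → Matrix (Fin 4) (Fin 4) ℝ) (x y : Fin 4 → ℝ) :
    Qr Q (x + y) = Qr Q x + Qr Q y := by
  simp [Qr, add_smul, Finset.sum_add_distrib]

lemma Qr_smul (Q : Fin 4 → Matrix (Fin 4) (Fin 4) ℝ) (a : ℝ) (x : Fin 4 → ℝ) :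
    Qr Q (a • x) = a • Qr Q x := by
  simp [Qr, Finset.smul_sum, smul_smul]

lemma mem_closure_aux (Q : Fin 4 → Matrix (Fin 4) (Fin 4) ℝ) (e x : Fin 4 → ℝ)
    (he : (Qr Q e).PosDef) (hx : x ≠ 0) (hp : (Qr Q x).PosSemidef) :
    Projectivization.mk ℝ x hx ∈ closure (spectra Q) := by
  have hpd : ∀ t : ℝ, 0 < t → (Qr Q (x + t • e)).PosDef := by
    intro t ht
    rw [Qr_add, Qr_smul]
    exact Matrix.PosDef.posSemidef_add hp (he.smul ht)
  have hcont : Filter.Tendsto (fun t : ℝ => x + t • e) (nhdsWithin 0 (Set.Ioi 0)) (nhds x) := by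
    have : Continuous (fun t : ℝ => x + t • e) := by fun_prop
    have h := this.tendsto 0
    simp only [zero_smul, add_zero] at h
    exact h.mono_left nhdsWithin_le_nhds
  rw [mem_closure_iff]
  intro U hU hxU
  have hV : IsOpen ((fun v : {v : Fin 4 → ℝ // v ≠ 0} => Projectivization.mk ℝ v.1 v.2) ⁻¹' U) :=
    hU.preimage mk_continuous
  have hV2 := (isOpen_ne (x := (0 : Fin 4 → ℝ))).isOpenMap_subtype_val _ hV
  have hmem : x ∈ Subtype.val ''
      ((fun v : {v : Fin 4 → ℝ // v ≠ 0} => Projectivization.mk ℝ v.1 v.2) ⁻¹' U) :=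
    ⟨⟨x, hx⟩, hxU, rfl⟩
  have hev := hcont.eventually (hV2.mem_nhds hmem)
  obtain ⟨t, ⟨⟨y, hy0⟩, hyU, hy⟩, ht⟩ := (hev.and self_mem_nhdsWithin).exists
  have hy' : y = x + t • e := hy
  subst hy'
  exact ⟨_, hyU, _, hy0, rfl, Or.inl (hpd t ht)⟩

lemma mem_closure_of_psd (Q : Fin 4 → Matrix (Fin 4) (Fin 4) ℝ) (e x : Fin 4 → ℝ)
    (he : (Qr Q e).PosDef) (hx : x ≠ 0) (hp : (Qr Q x).PosSemidef ∨ (-(Qr Q x)).PosSemidef) :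
    Projectivization.mk ℝ x hx ∈ closure (spectra Q) := by
  rcases hp with hp | hp
  · exact mem_closure_aux Q e x he hx hp
  · have hx' : -x ≠ 0 := neg_ne_zero.mpr hx
    have h1 : Projectivization.mk ℝ x hx = Projectivization.mk ℝ (-x) hx' := by
      rw [Projectivization.mk_eq_mk_iff']
      exact ⟨-1, by simp⟩
    rw [h1]
    apply mem_closure_aux Q e _ he hx'
    have : -x = (-1 : ℝ) • x := by simp
    rw [this, Qr_smul]
    simpa using hp

lemma posDef_minor (A : Matrix (Fin 4) (Fin 4) ℝ) (h : A.PosDef) (i j : Fin 4) (hij : i ≠ j) :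
    0 < A i i * A j j - A i j * A i j := by
  have hinj : Function.Injective ![i, j] := by
    intro a b
    fin_cases a <;> fin_cases b <;> simp [hij, hij.symm]
  have h2 := (h.submatrix hinj).det_pos
  have h3 : A j i = A i j := by
    have := h.isHermitian.apply i j
    simpa using this
  rw [Matrix.det_fin_two] at h2
  simp [h3] at h2
  linarith

lemma not_mem_closure (Q : Fin 4 → Matrix (Fin 4) (Fin 4) ℝ) (x : Fin 4 → ℝ) (hx : x ≠ 0)
    (i j : Fin 4) (hij : i ≠ j)
    (hneg : Qr Q x i i * Qr Q x j j - Qr Q x i j * Qr Q x i j < 0) :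
    Projectivization.mk ℝ x hx ∉ closure (spectra Q) := by
  intro hcl
  let g : (Fin 4 → ℝ) → ℝ := fun y => Qr Q y i i * Qr Q y j j - Qr Q y i j * Qr Q y i j
  have hg : Continuous g := by
    have hQ : ∀ a b, Continuous (fun y : Fin 4 → ℝ => Qr Q y a b) := by
      intro a b
      simp only [Qr, Matrix.sum_apply, Matrix.smul_apply]
      fun_prop
    exact ((hQ i i).mul (hQ j j)).sub ((hQ i j).mul (hQ i j))
  have hsm : ∀ (a : ℝ) y, g (a • y) = a ^ 2 * g y := by
    intro a y
    simp only [g, Qr_smul, Matrix.smul_apply, smul_eq_mul]; ring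
  let U : Set (ℙ ℝ (Fin 4 → ℝ)) :=
    {p | ∃ y, ∃ hy : y ≠ 0, p = Projectivization.mk ℝ y hy ∧ g y < 0}
  have hU : IsOpen U := by
    have hpre : IsOpen ((fun v : {v : Fin 4 → ℝ // v ≠ 0} => Projectivization.mk ℝ v.1 v.2) ⁻¹' U) := by
      have : ((fun v : {v : Fin 4 → ℝ // v ≠ 0} => Projectivization.mk ℝ v.1 v.2) ⁻¹' U)
          = {v | g v.1 < 0} := by
        ext ⟨v, hv⟩
        constructor
        · rintro ⟨y, hy, h, hgy⟩
          obtain ⟨a, ha⟩ := (Projectivization.mk_eq_mk_iff' ℝ _ _ _ _).mp h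
          have ha0 : a ≠ 0 := by
            rintro rfl; apply hv; simpa using ha.symm
          change g v < 0
          have ha' : a • y = v := ha
          rw [← ha', hsm]
          exact mul_neg_of_pos_of_neg (by positivity) hgy
        · intro h
          exact ⟨v, hv, rfl, h⟩
      rw [this]
      exact isOpen_lt (hg.comp continuous_subtype_val) continuous_const
    exact hpre
  obtain ⟨p, ⟨y, hy, rfl, hgy⟩, ⟨z, hz, hzy, hpd⟩⟩ :=
    mem_closure_iff.mp hcl U hU ⟨x, hx, rfl, hneg⟩
  obtain ⟨a, ha⟩ := (Projectivization.mk_eq_mk_iff' ℝ _ _ _ _).mp hzy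
  have h1 : 0 < g z := by
    rcases hpd with h | h
    · exact posDef_minor _ h i j hij
    · have := posDef_minor _ h i j hij
      simp only [Matrix.neg_apply] at this
      simp only [g]; linarith
  rw [← ha, hsm] at hgy
  nlinarith [sq_nonneg a]


/-! ### Counting nodes -/

/-- The node `P + c D`. -/
def nd (P D : Fin 5 → Fin 4 → ℝ) (k : Fin 5) (c : ℂ) : Fin 4 → ℂ :=
  fun i => (P k i : ℂ) + c * (D k i : ℂ)

/-- A complete description of the singular points by five conjugate pairs. -/
structure NodeData (Q : Fin 4 → Matrix (Fin 4) (Fin 4) ℝ) (P D : Fin 5 → Fin 4 → ℝ)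
    (r : Fin 5 → ℝ) (S T : Finset (Fin 5)) : Prop where
  sing : ∀ x : Fin 4 → ℂ, x ≠ 0 → gradVanishes Q x →
    ∃ (k : Fin 5) (c a : ℂ), c ^ 2 = (r k : ℂ) ∧ x = a • nd P D k c
  scaleg : ∀ (a : ℂ) x, gradVanishes Q x → gradVanishes Q (a • x)
  scale : ∀ (a : ℂ) x, hessian Q (a • x) = a ^ 2 • hessian Q x
  grad : ∀ (k : Fin 5) (c : ℂ), c ^ 2 = (r k : ℂ) → gradVanishes Q (nd P D k c)
  rank : ∀ (k : Fin 5) (c : ℂ), c ^ 2 = (r k : ℂ) → (hessian Q (nd P D k c)).rank = 3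
  inj : ∀ (k k' : Fin 5) (c c' a : ℂ), c ^ 2 = (r k : ℂ) → c' ^ 2 = (r k' : ℂ) →
    nd P D k c = a • nd P D k' c' → k = k' ∧ c = c'
  rne : ∀ k, r k ≠ 0
  pos : ∀ k, 0 < r k ↔ k ∈ S ∪ T
  disj : Disjoint S T
  inS : ∀ k ∈ S, ∀ c : ℝ, c ^ 2 = r k → ∀ h : P k + c • D k ≠ 0,
    Projectivization.mk ℝ (P k + c • D k) h ∈ closure (spectra Q)
  inT : ∀ k ∈ T, ∀ c : ℝ, c ^ 2 = r k → ∀ h : P k + c • D k ≠ 0,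
    Projectivization.mk ℝ (P k + c • D k) h ∉ closure (spectra Q)

/-- Total version of `Projectivization.mk`. -/
def pm (v : Fin 4 → ℝ) : ℙ ℝ (Fin 4 → ℝ) :=
  open Classical in
  if h : v ≠ 0 then Projectivization.mk ℝ v h else Projectivization.mk ℝ (Pi.single 0 1) (by simp)

lemma pm_eq (v : Fin 4 → ℝ) (h : v ≠ 0) : pm v = Projectivization.mk ℝ v h := by
  simp [pm, h]

/-- A sign. -/
def sg (b : Bool) : ℝ := if b then 1 else -1

lemma sg_sq (b : Bool) : sg b ^ 2 = 1 := by cases b <;> simp [sg]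

lemma sg_inj {b b' : Bool} (h : sg b = sg b') : b = b' := by
  cases b <;> cases b' <;> simp [sg] at h ⊢ <;> norm_num at h

lemma rank_smul_sq (H : Matrix (Fin 4) (Fin 4) ℂ) (a : ℂ) (ha : a ≠ 0) :
    (a ^ 2 • H).rank = H.rank := by
  apply le_antisymm
  · have : a ^ 2 • H = (a ^ 2 • (1 : Matrix (Fin 4) (Fin 4) ℂ)) * H := by simp
    rw [this]; exact Matrix.rank_mul_le_right _ _
  · have : H = ((a ^ 2)⁻¹ • (1 : Matrix (Fin 4) (Fin 4) ℂ)) * (a ^ 2 • H) := by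
      have h2 : a ^ 2 ≠ 0 := pow_ne_zero 2 ha
      simp [smul_smul, h2]
    conv_lhs => rw [this]
    exact Matrix.rank_mul_le_right _ _

lemma toC_nd (P D : Fin 5 → Fin 4 → ℝ) (k : Fin 5) (c : ℝ) :
    toC (P k + c • D k) = nd P D k c := by
  ext i; simp [toC, nd]

section counting

variable {Q : Fin 4 → Matrix (Fin 4) (Fin 4) ℝ} {P D : Fin 5 → Fin 4 → ℝ}
    {r : Fin 5 → ℝ} {S T : Finset (Fin 5)}

lemma NodeData.nd_ne (h : NodeData Q P D r S T) (k c) (hc : c ^ 2 = (r k : ℂ)) :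
    nd P D k c ≠ 0 := by
  intro h0
  have h1 : nd P D k c = (0 : ℂ) • nd P D k (-c) := by rw [h0]; simp
  have h2 := (h.inj k k c (-c) 0 hc (by rw [neg_sq]; exact hc) h1).2
  have h3 : c = 0 := by
    have : (2 : ℂ) * c = 0 := by linear_combination h2
    simpa using this
  apply h.rne k
  rw [h3] at hc
  have : (r k : ℂ) = 0 := by rw [← hc]; ring
  exact_mod_cast this

lemma NodeData.transversal (h : NodeData Q P D r S T) : Transversal Q := by
  have hroot : ∀ k, ∃ s : ℂ, s ^ 2 = (r k : ℂ) := fun k =>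
    IsAlgClosed.exists_pow_nat_eq _ (by norm_num)
  choose s hs using hroot
  have hs' : ∀ p : Fin 5 × Bool, ((sg p.2 : ℂ) * s p.1) ^ 2 = (r p.1 : ℂ) := by
    intro p
    rw [mul_pow, hs]
    have : (sg p.2 : ℂ) ^ 2 = 1 := by exact_mod_cast congrArg (fun t : ℝ => (t : ℂ)) (sg_sq p.2)
    rw [this, one_mul]
  have hsne : ∀ k, s k ≠ 0 := by
    intro k h0
    apply h.rne k
    have := hs k
    rw [h0] at this
    have h2 : (r k : ℂ) = 0 := by rw [← this]; ring
    exact_mod_cast h2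
  let φ : Fin 5 × Bool → ℙ ℂ (Fin 4 → ℂ) := fun p =>
    Projectivization.mk ℂ (nd P D p.1 (sg p.2 * s p.1)) (h.nd_ne _ _ (hs' p))
  have hφ : Function.Injective φ := by
    rintro ⟨k, b⟩ ⟨k', b'⟩ he
    obtain ⟨a, ha⟩ := (Projectivization.mk_eq_mk_iff' ℂ _ _ _ _).mp he
    obtain ⟨h1, h2⟩ := h.inj _ _ _ _ a (hs' (k, b)) (hs' (k', b')) ha.symm
    simp only at h1
    subst h1
    have h3 := mul_right_cancel₀ (hsne k) h2
    have h4 : sg b = sg b' := by exact_mod_cast h3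
    rw [sg_inj h4]
  have hrange : singPoints Q = Set.range φ := by
    ext p
    constructor
    · rintro ⟨x, hx, rfl, hg⟩
      obtain ⟨k, c, a, hc, hxa⟩ := h.sing x hx hg
      have hcs : c = s k ∨ c = - s k := sq_eq_sq_iff_eq_or_eq_neg.mp (by rw [hc, hs])
      rcases hcs with hcs | hcs
      · refine ⟨(k, true), ?_⟩
        simp only [φ]
        rw [eq_comm, Projectivization.mk_eq_mk_iff']
        refine ⟨a, ?_⟩
        rw [hxa, hcs]; simp [sg]
      · refine ⟨(k, false), ?_⟩
        simp only [φ]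
        rw [eq_comm, Projectivization.mk_eq_mk_iff']
        refine ⟨a, ?_⟩
        rw [hxa, hcs]; simp [sg]
    · rintro ⟨p, rfl⟩
      exact ⟨_, h.nd_ne _ _ (hs' p), rfl, h.grad _ _ (hs' p)⟩
  refine ⟨?_, ?_, ?_⟩
  · rw [hrange]; exact Set.finite_range φ
  · rw [hrange, ← Set.image_univ, Set.ncard_image_of_injective _ hφ, Set.ncard_univ]
    simp
  · intro x hx hg
    obtain ⟨k, c, a, hc, hxa⟩ := h.sing x hx hg
    have ha : a ≠ 0 := by
      rintro rfl; apply hx; rw [hxa]; simp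
    rw [hxa, h.scale, rank_smul_sq _ _ ha]
    exact h.rank k c hc

lemma NodeData.real_aux (h : NodeData Q P D r S T) (x : Fin 4 → ℝ) (hx : x ≠ 0)
    (hg : gradVanishes Q (toC x)) :
    ∃ (k : Fin 5) (b : Bool) (a : ℝ), k ∈ S ∪ T ∧ x = a • (P k + (sg b * Real.sqrt (r k)) • D k) := by
  have hx' : toC x ≠ 0 := by
    intro h0; apply hx; ext i
    have := congrFun h0 i
    simpa [toC] using this
  obtain ⟨k, c, a, hc, hxa⟩ := h.sing _ hx' hg
  have ha : a ≠ 0 := by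
    rintro rfl; apply hx'; rw [hxa]; simp
  -- the parameter is real
  have hcc : c = (starRingEnd ℂ) c := by
    have hc2 : ((starRingEnd ℂ) c) ^ 2 = (r k : ℂ) := by
      rw [← map_pow, hc, Complex.conj_ofReal]
    refine (h.inj k k c _ (a⁻¹ * (starRingEnd ℂ) a) hc hc2 ?_).2
    ext i
    have h1 := congrFun hxa i
    have h2 := congrArg (starRingEnd ℂ) h1
    simp only [toC, nd, Pi.smul_apply, smul_eq_mul, map_mul, map_add, Complex.conj_ofReal] at h1 h2 ⊢
    rw [h1] at h2
    field_simp
    linear_combination h2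
  obtain ⟨d, hd⟩ : ∃ d : ℝ, c = d := ⟨c.re, (Complex.conj_eq_iff_re.mp hcc.symm).symm⟩
  subst hd
  have hd2 : d ^ 2 = r k := by exact_mod_cast hc
  have hpos : 0 < r k := lt_of_le_of_ne (by rw [← hd2]; positivity) (h.rne k).symm
  have hb : ∃ b, d = sg b * Real.sqrt (r k) := by
    have h1 : d ^ 2 = Real.sqrt (r k) ^ 2 := by rw [hd2, Real.sq_sqrt hpos.le]
    rcases sq_eq_sq_iff_eq_or_eq_neg.mp h1 with h2 | h2
    · exact ⟨true, by simp [sg, h2]⟩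
    · exact ⟨false, by simp [sg, h2]⟩
  obtain ⟨b, hb⟩ := hb
  have hy : P k + d • D k ≠ 0 := by
    intro h0
    apply h.nd_ne k d hc
    rw [← toC_nd, h0]; ext i; simp [toC]
  obtain ⟨i, hi⟩ : ∃ i, (P k + d • D k) i ≠ 0 := by
    by_contra hcon; push Not at hcon; exact hy (funext hcon)
  rw [← toC_nd] at hxa
  have har : a = ((x i / (P k + d • D k) i : ℝ) : ℂ) := by
    have h1 := congrFun hxa i
    have hi' : (((P k + d • D k) i : ℝ) : ℂ) ≠ 0 := by exact_mod_cast hi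
    rw [Complex.ofReal_div, eq_div_iff hi']
    exact h1.symm
  refine ⟨k, b, x i / (P k + d • D k) i, (h.pos k).mp hpos, ?_⟩
  rw [← hb]
  ext j
  have h1 := congrFun hxa j
  rw [har] at h1
  simp only [toC, Pi.smul_apply, smul_eq_mul] at h1 ⊢
  exact_mod_cast h1

lemma NodeData.counts (h : NodeData Q P D r S T) :
    (realNodes Q).ncard = 2 * S.card + 2 * T.card ∧
    (realNodes Q ∩ closure (spectra Q)).ncard = 2 * S.card ∧
    (realNodes Q \ closure (spectra Q)).ncard = 2 * T.card := by
  let v : Fin 5 × Bool → Fin 4 → ℝ := fun p => P p.1 + (sg p.2 * Real.sqrt (r p.1)) • D p.1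
  have hsq : ∀ k ∈ S ∪ T, ∀ b, (sg b * Real.sqrt (r k)) ^ 2 = r k := by
    intro k hk b
    rw [mul_pow, sg_sq, Real.sq_sqrt ((h.pos k).mpr hk).le, one_mul]
  have hsqC : ∀ k ∈ S ∪ T, ∀ b, (((sg b * Real.sqrt (r k) : ℝ)) : ℂ) ^ 2 = (r k : ℂ) := by
    intro k hk b; exact_mod_cast congrArg (fun t : ℝ => (t : ℂ)) (hsq k hk b)
  have hv : ∀ k ∈ S ∪ T, ∀ b, v (k, b) ≠ 0 := by
    intro k hk b h0
    apply h.nd_ne k _ (hsqC k hk b)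
    rw [← toC_nd]
    have : P k + (sg b * Real.sqrt (r k)) • D k = 0 := h0
    rw [this]; ext i; simp [toC]
  let ψ : Fin 5 × Bool → ℙ ℝ (Fin 4 → ℝ) := fun p => pm (v p)
  have hinj : Set.InjOn ψ {p | p.1 ∈ S ∪ T} := by
    rintro ⟨k, b⟩ hk ⟨k', b'⟩ hk' he
    simp only [Set.mem_ofPred_eq] at hk hk'
    simp only [ψ] at he
    rw [pm_eq _ (hv k hk b), pm_eq _ (hv k' hk' b')] at he
    obtain ⟨a, ha⟩ := (Projectivization.mk_eq_mk_iff' ℝ _ _ _ _).mp he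
    have h1 : nd P D k ((sg b * Real.sqrt (r k) : ℝ) : ℂ) =
        (a : ℂ) • nd P D k' ((sg b' * Real.sqrt (r k') : ℝ) : ℂ) := by
      rw [← toC_nd, ← toC_nd]
      ext i
      have := congrFun ha i
      simp only [v, Pi.smul_apply, smul_eq_mul] at this
      simp only [toC, Pi.smul_apply, smul_eq_mul]
      rw [← this]; push_cast; ring
    obtain ⟨h2, h3⟩ := h.inj _ _ _ _ _ (hsqC k hk b) (hsqC k' hk' b') h1
    subst h2
    have h4 : sg b * Real.sqrt (r k) = sg b' * Real.sqrt (r k) := by exact_mod_cast h3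
    have h5 := mul_right_cancel₀ (Real.sqrt_pos.mpr ((h.pos k).mpr hk)).ne' h4
    rw [sg_inj h5]
  have hreal : realNodes Q = ψ '' {p | p.1 ∈ S ∪ T} := by
    ext p
    constructor
    · rintro ⟨x, hx, rfl, hg⟩
      obtain ⟨k, b, a, hk, hxa⟩ := h.real_aux x hx hg.1
      refine ⟨(k, b), hk, ?_⟩
      simp only [ψ]
      rw [pm_eq _ (hv k hk b), eq_comm, Projectivization.mk_eq_mk_iff']
      exact ⟨a, hxa.symm⟩
    · rintro ⟨⟨k, b⟩, hk, rfl⟩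
      refine ⟨v (k, b), hv k hk b, pm_eq _ _, ?_⟩
      have h1 : toC (v (k, b)) = nd P D k ((sg b * Real.sqrt (r k) : ℝ) : ℂ) := toC_nd P D k _
      rw [h1]
      exact ⟨h.grad _ _ (hsqC k hk b), h.rank _ _ (hsqC k hk b)⟩
  have hST : ∀ k, k ∈ S → k ∈ T → False := fun k h1 h2 =>
    (Finset.disjoint_left.mp h.disj) h1 h2
  have hS : ∀ k ∈ S, ∀ b, ψ (k, b) ∈ closure (spectra Q) := by
    intro k hk b
    have hk' : k ∈ S ∪ T := Finset.mem_union_left _ hk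
    simp only [ψ]
    rw [pm_eq _ (hv k hk' b)]
    exact h.inS k hk _ (hsq k hk' b) _
  have hT : ∀ k ∈ T, ∀ b, ψ (k, b) ∉ closure (spectra Q) := by
    intro k hk b
    have hk' : k ∈ S ∪ T := Finset.mem_union_right _ hk
    simp only [ψ]
    rw [pm_eq _ (hv k hk' b)]
    exact h.inT k hk _ (hsq k hk' b) _
  have hcard : ∀ U : Finset (Fin 5), U ⊆ S ∪ T →
      (ψ '' {p | p.1 ∈ U}).ncard = 2 * U.card := by
    intro U hU
    have hU2 : {p : Fin 5 × Bool | p.1 ∈ U} ⊆ {p | p.1 ∈ S ∪ T} := fun p hp => hU hp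
    rw [Set.InjOn.ncard_image (hinj.mono hU2)]
    have : {p : Fin 5 × Bool | p.1 ∈ U} = ↑(U ×ˢ (Finset.univ : Finset Bool)) := by
      ext p; simp
    rw [this, Set.ncard_coe_finset, Finset.card_product]
    simp [mul_comm]
  have h1 : realNodes Q ∩ closure (spectra Q) = ψ '' {p | p.1 ∈ S} := by
    rw [hreal]; ext p; constructor
    · rintro ⟨⟨⟨k, b⟩, hk, rfl⟩, hcl⟩
      rcases Finset.mem_union.mp hk with hk | hk
      · exact ⟨(k, b), hk, rfl⟩
      · exact absurd hcl (hT k hk b)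
    · rintro ⟨⟨k, b⟩, hk, rfl⟩
      exact ⟨⟨(k, b), Finset.mem_union_left _ hk, rfl⟩, hS k hk b⟩
  have h2 : realNodes Q \ closure (spectra Q) = ψ '' {p | p.1 ∈ T} := by
    rw [hreal]; ext p; constructor
    · rintro ⟨⟨⟨k, b⟩, hk, rfl⟩, hcl⟩
      rcases Finset.mem_union.mp hk with hk | hk
      · exact absurd (hS k hk b) hcl
      · exact ⟨(k, b), hk, rfl⟩
    · rintro ⟨⟨k, b⟩, hk, rfl⟩
      exact ⟨⟨(k, b), Finset.mem_union_right _ hk, rfl⟩, hT k hk b⟩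
  refine ⟨?_, ?_, ?_⟩
  · rw [hreal, hcard _ (Finset.Subset.refl _), Finset.card_union_of_disjoint h.disj]; ring
  · rw [h1, hcard _ Finset.subset_union_left]
  · rw [h2, hcard _ Finset.subset_union_right]

lemma NodeData.final (h : NodeData Q P D r S T) (hsym : ∀ i, (Q i).IsSymm)
    (e : Fin 4 → ℝ) (he : (Qr Q e).PosDef) (he0 : e ≠ 0)
    (m n : ℕ) (hm : 2 * S.card = m) (hn : 2 * T.card = n) :
    ∃ Q : Fin 4 → Matrix (Fin 4) (Fin 4) ℝ,
      (∀ i, (Q i).IsSymm) ∧ Transversal Q ∧ (spectra Q).Nonempty ∧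
      (realNodes Q).ncard = m + n ∧
      (realNodes Q ∩ closure (spectra Q)).ncard = m ∧
      (realNodes Q \ closure (spectra Q)).ncard = n := by
  subst hm hn
  exact ⟨Q, hsym, h.transversal, ⟨_, e, he0, rfl, Or.inl he⟩, h.counts⟩

end counting


/-! ### Derivatives of the determinant through polynomials -/

lemma calc_derivs (Q : Fin 4 → Matrix (Fin 4) (Fin 4) ℝ) (f : MvPolynomial (Fin 4) ℂ)
    (hf : ∀ x, detQ Q x = MvPolynomial.eval x f) (g : Fin 4 → MvPolynomial (Fin 4) ℂ)
    (hg : ∀ i, MvPolynomial.pderiv i f = g i) (h : Fin 4 → Fin 4 → MvPolynomial (Fin 4) ℂ)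
    (hh : ∀ i j, MvPolynomial.pderiv i (g j) = h i j) (x : Fin 4 → ℂ) :
    (gradVanishes Q x ↔ ∀ i, MvPolynomial.eval x (g i) = 0) ∧
      hessian Q x = Matrix.of fun i j => MvPolynomial.eval x (h i j) := by
  have h1 : detQ Q = fun x => MvPolynomial.eval x f := funext hf
  have h2 : ∀ (y : Fin 4 → ℂ) i, fderiv ℂ (detQ Q) y (Pi.single i 1) =
      MvPolynomial.eval y (g i) := by
    intro y i
    rw [h1, (fderiv_eval f y i).2, hg]
  constructor
  · simp only [gradVanishes, h2]
  · ext i j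
    simp only [hessian, Matrix.of_apply, h2]
    rw [(fderiv_eval (g j) x i).2, hh]

/-! ### The first family -/

/-- Parameters of the first family. -/
structure Par (R : Type) where
  (p q r s a1 a2 a3 a4 b1 b2 b3 b4 : R)

namespace Par

/-- Change of coefficients. -/
def map {R S : Type} (φ : R → S) (d : Par R) : Par S :=
  ⟨φ d.p, φ d.q, φ d.r, φ d.s, φ d.a1, φ d.a2, φ d.a3, φ d.a4, φ d.b1, φ d.b2, φ d.b3, φ d.b4⟩

section defs
variable {R : Type} [CommRing R] (d : Par R)

/-- off-diagonal form -/
def m1 (u v : R) : R := d.a1 * u + d.b1 * v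
/-- off-diagonal form -/
def m2 (u v : R) : R := d.a2 * u + d.b2 * v
/-- off-diagonal form -/
def m3 (u v : R) : R := d.a3 * u + d.b3 * v
/-- off-diagonal form -/
def m4 (u v : R) : R := d.a4 * u + d.b4 * v
/-- diagonal form -/
def l1 (u v : R) : R := d.p * u + d.q * v
/-- diagonal form -/
def l2 (u v : R) : R := d.r * u + d.s * v
/-- the off-diagonal determinant -/
def dl (u v : R) : R := d.m1 u v * d.m4 u v - d.m2 u v * d.m3 u v

/-- the determinant -/
def f (x : Fin 4 → R) : R :=
  x 0 * x 1 * d.l1 (x 0) (x 1) * d.l2 (x 0) (x 1)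
  - x 1 * d.l2 (x 0) (x 1) * d.m1 (x 2) (x 3) ^ 2 - x 1 * d.l1 (x 0) (x 1) * d.m2 (x 2) (x 3) ^ 2
  - x 0 * d.l2 (x 0) (x 1) * d.m3 (x 2) (x 3) ^ 2 - x 0 * d.l1 (x 0) (x 1) * d.m4 (x 2) (x 3) ^ 2
  + d.dl (x 2) (x 3) ^ 2

def mat (x : Fin 4 → R) : Matrix (Fin 4) (Fin 4) R :=
  !![x 0, d.m1 (x 2) (x 3), d.m2 (x 2) (x 3), 0;
     d.m1 (x 2) (x 3), d.l1 (x 0) (x 1), 0, d.m3 (x 2) (x 3);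
     d.m2 (x 2) (x 3), 0, d.l2 (x 0) (x 1), d.m4 (x 2) (x 3);
     0, d.m3 (x 2) (x 3), d.m4 (x 2) (x 3), x 1]

/-- the gradient; `A`, `B` are the diagonal variables, `L`, `M` the diagonal forms and
`n1`, ..., `n4` the off-diagonal forms. -/
def gg (A B L M n1 n2 n3 n4 : R) : Fin 4 → R :=
  ![B * L * M + A * B * (d.p * M + d.r * L) - B * d.r * n1 ^ 2 - B * d.p * n2 ^ 2
      - (M + A * d.r) * n3 ^ 2 - (L + A * d.p) * n4 ^ 2,
    A * L * M + A * B * (d.q * M + d.s * L) - (M + B * d.s) * n1 ^ 2 - (L + B * d.q) * n2 ^ 2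
      - A * d.s * n3 ^ 2 - A * d.q * n4 ^ 2,
    -2 * B * M * d.a1 * n1 - 2 * B * L * d.a2 * n2 - 2 * A * M * d.a3 * n3 - 2 * A * L * d.a4 * n4
      + 2 * (n1 * n4 - n2 * n3) * (d.a1 * n4 + d.a4 * n1 - d.a2 * n3 - d.a3 * n2),
    -2 * B * M * d.b1 * n1 - 2 * B * L * d.b2 * n2 - 2 * A * M * d.b3 * n3 - 2 * A * L * d.b4 * n4
      + 2 * (n1 * n4 - n2 * n3) * (d.b1 * n4 + d.b4 * n1 - d.b2 * n3 - d.b3 * n2)]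

/-- Hessian entry -/
def h00 (A B L M n3 n4 : R) : R :=
  2 * B * (d.p * M + d.r * L) + 2 * A * B * d.p * d.r - 2 * d.r * n3 ^ 2 - 2 * d.p * n4 ^ 2
/-- Hessian entry -/
def h11 (A B L M n1 n2 : R) : R :=
  2 * A * (d.q * M + d.s * L) + 2 * A * B * d.q * d.s - 2 * d.s * n1 ^ 2 - 2 * d.q * n2 ^ 2
/-- Hessian entry -/
def h01 (A B L M n1 n2 n3 n4 : R) : R :=
  L * M + B * (d.q * M + d.s * L) + A * (d.p * M + d.r * L) + A * B * (d.p * d.s + d.q * d.r)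
    - d.r * n1 ^ 2 - d.p * n2 ^ 2 - d.s * n3 ^ 2 - d.q * n4 ^ 2
/-- Hessian entry -/
def h0 (a1 a2 a3 a4 A B L M n1 n2 n3 n4 : R) : R :=
  -2 * B * d.r * a1 * n1 - 2 * B * d.p * a2 * n2 - 2 * (M + A * d.r) * a3 * n3
    - 2 * (L + A * d.p) * a4 * n4
/-- Hessian entry -/
def h1 (a1 a2 a3 a4 A B L M n1 n2 n3 n4 : R) : R :=
  -2 * (M + B * d.s) * a1 * n1 - 2 * (L + B * d.q) * a2 * n2 - 2 * A * d.s * a3 * n3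
    - 2 * A * d.q * a4 * n4
/-- Hessian entry -/
def hab (a1 a2 a3 a4 b1 b2 b3 b4 A B L M n1 n2 n3 n4 : R) : R :=
  -2 * (B * M * a1 * b1 + B * L * a2 * b2 + A * M * a3 * b3 + A * L * a4 * b4)
    + 2 * (a1 * n4 + a4 * n1 - a2 * n3 - a3 * n2) * (b1 * n4 + b4 * n1 - b2 * n3 - b3 * n2)
    + 2 * (n1 * n4 - n2 * n3) * (a1 * b4 + b1 * a4 - a2 * b3 - a3 * b2)

def hh (A B L M n1 n2 n3 n4 : R) : Matrix (Fin 4) (Fin 4) R :=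
  let ka := d.h0 d.a1 d.a2 d.a3 d.a4 A B L M n1 n2 n3 n4
  let kb := d.h0 d.b1 d.b2 d.b3 d.b4 A B L M n1 n2 n3 n4
  let la := d.h1 d.a1 d.a2 d.a3 d.a4 A B L M n1 n2 n3 n4
  let lb := d.h1 d.b1 d.b2 d.b3 d.b4 A B L M n1 n2 n3 n4
  let e := hab d.a1 d.a2 d.a3 d.a4 d.b1 d.b2 d.b3 d.b4 A B L M n1 n2 n3 n4
  !![d.h00 A B L M n3 n4, d.h01 A B L M n1 n2 n3 n4, ka, kb;
     d.h01 A B L M n1 n2 n3 n4, d.h11 A B L M n1 n2, la, lb;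
     ka, la, hab d.a1 d.a2 d.a3 d.a4 d.a1 d.a2 d.a3 d.a4 A B L M n1 n2 n3 n4, e;
     kb, lb, e, hab d.b1 d.b2 d.b3 d.b4 d.b1 d.b2 d.b3 d.b4 A B L M n1 n2 n3 n4]

/-- the gradient at a point -/
def g (x : Fin 4 → R) : Fin 4 → R :=
  d.gg (x 0) (x 1) (d.l1 (x 0) (x 1)) (d.l2 (x 0) (x 1)) (d.m1 (x 2) (x 3)) (d.m2 (x 2) (x 3))
    (d.m3 (x 2) (x 3)) (d.m4 (x 2) (x 3))

/-- the Hessian at a point -/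
def h (x : Fin 4 → R) : Matrix (Fin 4) (Fin 4) R :=
  d.hh (x 0) (x 1) (d.l1 (x 0) (x 1)) (d.l2 (x 0) (x 1)) (d.m1 (x 2) (x 3)) (d.m2 (x 2) (x 3))
    (d.m3 (x 2) (x 3)) (d.m4 (x 2) (x 3))

lemma det_mat (x : Fin 4 → R) : (d.mat x).det = d.f x := by
  simp [mat, Matrix.det_succ_row_zero, Fin.sum_univ_succ, Fin.succAbove, f, dl]
  ring

lemma euler_f (x : Fin 4 → R) : ∑ i, d.g x i * x i = 4 * d.f x := by
  simp [Fin.sum_univ_succ, g, gg, f, dl, l1, l2, m1, m2, m3, m4]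
  ring

lemma euler_h (x : Fin 4 → R) : d.h x *ᵥ x = 3 • d.g x := by
  ext i
  fin_cases i <;>
  simp [Matrix.mulVec, dotProduct, Fin.sum_univ_succ, h, hh, h00, h01, h11, h0, h1, hab,
    g, gg, l1, l2, m1, m2, m3, m4] <;> ring

set_option maxHeartbeats 2000000 in
lemma h_smul (a : R) (x : Fin 4 → R) : d.h (a • x) = a ^ 2 • d.h x := by
  ext i j
  fin_cases i <;> fin_cases j <;>
  simp [h, hh, h00, h01, h11, h0, h1, hab, l1, l2, m1, m2, m3, m4] <;> ring

set_option maxHeartbeats 2000000 in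
lemma g_smul (a : R) (x : Fin 4 → R) : d.g (a • x) = a ^ 3 • d.g x := by
  ext i
  fin_cases i <;>
  simp [g, gg, l1, l2, m1, m2, m3, m4] <;> ring

end defs

open MvPolynomial in
lemma pderiv_f (d : Par ℂ) (i : Fin 4) : pderiv i ((d.map C).f X) = (d.map C).g X i := by
  fin_cases i <;>
  simp [f, g, gg, dl, l1, l2, m1, m2, m3, m4, map, pderiv_X, Derivation.leibniz_pow] <;>
  ring

set_option maxHeartbeats 4000000 in
open MvPolynomial in
lemma pderiv_g (d : Par ℂ) (i j : Fin 4) : pderiv i ((d.map C).g X j) = (d.map C).h X i j := by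
  have two : ∀ i, pderiv i (2 : MvPolynomial (Fin 4) ℂ) = 0 := by
    intro i
    have : (2 : MvPolynomial (Fin 4) ℂ) = C 2 := (map_ofNat C 2).symm
    rw [this, pderiv_C]
  fin_cases i <;> fin_cases j <;>
  simp [two, g, gg, l1, l2, m1, m2, m3, m4, map, pderiv_X,
    Derivation.leibniz_pow, h, hh, h00, h01, h11, h0, h1, hab] <;>
  ring

end Par


namespace Par

/-- The pencil of the first family. -/
def Q (d : Par ℝ) : Fin 4 → Matrix (Fin 4) (Fin 4) ℝ := fun l => d.mat (Pi.single l 1)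

lemma Q_symm (d : Par ℝ) (l : Fin 4) : (d.Q l).IsSymm := by
  ext i j
  fin_cases i <;> fin_cases j <;> simp [Q, mat]

lemma Qr_Q (d : Par ℝ) (x : Fin 4 → ℝ) : Qr d.Q x = d.mat x := by
  ext i j
  simp only [Qr, Q, Fin.sum_univ_four, Matrix.add_apply, Matrix.smul_apply, smul_eq_mul]
  fin_cases i <;> fin_cases j <;> simp [mat, m1, m2, m3, m4, l1, l2] <;> ring

/-- complexified parameters -/
abbrev toC (d : Par ℝ) : Par ℂ := d.map (fun t : ℝ => (t : ℂ))

lemma Qc_Q (d : Par ℝ) (x : Fin 4 → ℂ) : Qc d.Q x = d.toC.mat x := by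
  ext i j
  simp only [Qc, Q, Fin.sum_univ_four, Matrix.add_apply, Matrix.smul_apply, smul_eq_mul,
    Matrix.map_apply]
  fin_cases i <;> fin_cases j <;> simp [mat, m1, m2, m3, m4, l1, l2, map, toC] <;> ring

lemma eval_f (d : Par ℂ) (x : Fin 4 → ℂ) :
    MvPolynomial.eval x ((d.map MvPolynomial.C).f MvPolynomial.X) = d.f x := by
  simp [f, dl, l1, l2, m1, m2, m3, m4, map]

lemma eval_g (d : Par ℂ) (x : Fin 4 → ℂ) (i : Fin 4) :
    MvPolynomial.eval x ((d.map MvPolynomial.C).g MvPolynomial.X i) = d.g x i := by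
  fin_cases i <;> simp [g, gg, l1, l2, m1, m2, m3, m4, map]

set_option maxHeartbeats 2000000 in
lemma eval_h (d : Par ℂ) (x : Fin 4 → ℂ) (i j : Fin 4) :
    MvPolynomial.eval x ((d.map MvPolynomial.C).h MvPolynomial.X i j) = d.h x i j := by
  fin_cases i <;> fin_cases j <;>
    simp [h, hh, h00, h01, h11, h0, h1, hab, l1, l2, m1, m2, m3, m4, map]

lemma derivs (d : Par ℝ) (x : Fin 4 → ℂ) :
    (gradVanishes d.Q x ↔ d.toC.g x = 0) ∧ hessian d.Q x = d.toC.h x := by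
  obtain ⟨h1, h2⟩ := calc_derivs d.Q ((d.toC.map MvPolynomial.C).f MvPolynomial.X)
    (fun y => by rw [eval_f, ← det_mat, ← Qc_Q]; rfl) _ (pderiv_f d.toC) _ (pderiv_g d.toC) x
  constructor
  · rw [h1]
    simp only [eval_g]
    exact ⟨fun h => funext h, fun h i => congrFun h i⟩
  · rw [h2]
    ext i j
    simp only [Matrix.of_apply, eval_h]

section alg
variable {F : Type} [Field F] (d : Par F)

/-- The explicit cofactors of the matrix. -/
def cof (x : Fin 4 → F) : Fin 10 → F :=
  let A := x 0; let B := x 1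
  let L := d.l1 (x 0) (x 1); let M := d.l2 (x 0) (x 1)
  let n1 := d.m1 (x 2) (x 3); let n2 := d.m2 (x 2) (x 3)
  let n3 := d.m3 (x 2) (x 3); let n4 := d.m4 (x 2) (x 3)
  ![A * n3 * n4 + B * n1 * n2, L * n2 * n4 + M * n1 * n3,
    A * B * L - B * n1 ^ 2 - A * n3 ^ 2, A * B * M - B * n2 ^ 2 - A * n4 ^ 2,
    L * M * A - M * n1 ^ 2 - L * n2 ^ 2, L * M * B - M * n3 ^ 2 - L * n4 ^ 2,
    A * L * n4 - n1 * (n1 * n4 - n2 * n3), A * M * n3 + n2 * (n1 * n4 - n2 * n3),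
    B * L * n2 + n3 * (n1 * n4 - n2 * n3), B * M * n1 - n4 * (n1 * n4 - n2 * n3)]

lemma adj_eq (x : Fin 4 → F) : (d.mat x).adjugate =
    !![d.cof x 5, - d.cof x 9, - d.cof x 8, d.cof x 1;
       - d.cof x 9, d.cof x 3, d.cof x 0, - d.cof x 7;
       - d.cof x 8, d.cof x 0, d.cof x 2, - d.cof x 6;
       d.cof x 1, - d.cof x 7, - d.cof x 6, d.cof x 4] := by
  ext i j
  rw [Matrix.adjugate_fin_succ_eq_det_submatrix, Matrix.det_fin_three]
  fin_cases i <;> fin_cases j <;>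
    simp [mat, cof, Fin.succAbove] <;> ring

lemma trace_adj (x : Fin 4 → F) (l : Fin 4) :
    ((d.mat x).adjugate * d.mat (Pi.single l 1)).trace = d.g x l := by
  rw [adj_eq]
  simp only [Matrix.trace, Matrix.diag, Matrix.mul_apply, Fin.sum_univ_four]
  fin_cases l <;> simp [mat, cof, g, gg, m1, m2, m3, m4, l1, l2] <;> ring

end alg
end Par


namespace Par
section alg2
variable {F : Type} [CommRing F] (d : Par F)

/-- value of the first diagonal entry (up to the common factor) at a node -/
def nA (U V : F) : F := d.m1 U V * d.m2 U V
/-- value of the last diagonal entry (up to the common factor) at a node -/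
def nB (U V : F) : F := - (d.m3 U V * d.m4 U V)
/-- value of the second diagonal entry (up to the common factor) at a node -/
def nL (U V : F) : F := d.l1 (d.nA U V) (d.nB U V)
/-- value of the third diagonal entry (up to the common factor) at a node -/
def nM (U V : F) : F := d.l2 (d.nA U V) (d.nB U V)
/-- square of the parameter at a node -/
def nr (U V : F) : F := d.dl U V * d.m2 U V * d.m4 U V * d.nL U V
/-- the quartic form whose roots give the nodes -/
def quar (U V : F) : F := d.nL U V * d.m2 U V * d.m4 U V + d.nM U V * d.m1 U V * d.m3 U V
/-- leading coefficient of `dl` -/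
def del1 : F := d.a1 * d.a4 - d.a2 * d.a3
/-- trailing coefficient of `dl` -/
def del2 : F := d.b1 * d.b4 - d.b2 * d.b3
/-- the mixed coefficient of `dl` vanishes -/
def rel : Prop := d.a1 * d.b4 + d.b1 * d.a4 = d.a2 * d.b3 + d.b2 * d.a3

/-- a node of the main type -/
def node (U V c : F) : Fin 4 → F :=
  ![d.dl U V * d.nA U V, d.dl U V * d.nB U V, c * U, c * V]
/-- a node of the special type -/
def nodeC (c : F) : Fin 4 → F := ![0, 0, c, d.del1]

/-- Genericity conditions. -/
structure Gen (d : Par F) : Prop where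
  rel : d.rel
  d1 : d.del1 ≠ 0
  d2 : d.del2 ≠ 0
  i13 : d.a1 * d.b3 - d.a3 * d.b1 ≠ 0
  i14 : d.a1 * d.b4 - d.a4 * d.b1 ≠ 0
  i23 : d.a2 * d.b3 - d.a3 * d.b2 ≠ 0
  i24 : d.a2 * d.b4 - d.a4 * d.b2 ≠ 0
  p0 : d.p ≠ 0
  q0 : d.q ≠ 0
  r0 : d.r ≠ 0
  s0 : d.s ≠ 0
  ps : d.p * d.s - d.q * d.r ≠ 0

/-- Conditions at a node. -/
structure NGen (d : Par F) (U V : F) : Prop where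
  quar : d.quar U V = 0
  m1 : d.m1 U V ≠ 0
  m2 : d.m2 U V ≠ 0
  m3 : d.m3 U V ≠ 0
  m4 : d.m4 U V ≠ 0
  nL : d.nL U V ≠ 0
  dl : d.dl U V ≠ 0

end alg2

section alg2b
variable {F : Type} [Field F] (d : Par F)

lemma lin2 {a b a' b' u v : F} (h : a * b' - a' * b ≠ 0) (h1 : a * u + b * v = 0)
    (h2 : a' * u + b' * v = 0) : u = 0 ∧ v = 0 := by
  constructor
  · have : (a * b' - a' * b) * u = 0 := by linear_combination b' * h1 - b * h2
    exact (mul_eq_zero.mp this).resolve_left h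
  · have : (a * b' - a' * b) * v = 0 := by linear_combination a * h2 - a' * h1
    exact (mul_eq_zero.mp this).resolve_left h

lemma dl_eq (hrel : d.rel) (u v : F) : d.dl u v = d.del1 * u ^ 2 + d.del2 * v ^ 2 := by
  unfold rel at hrel
  simp only [dl, m1, m2, m3, m4, del1, del2]
  linear_combination u * v * hrel

lemma m1_smul (t u v : F) : d.m1 (t * u) (t * v) = t * d.m1 u v := by simp only [m1]; ring
lemma m2_smul (t u v : F) : d.m2 (t * u) (t * v) = t * d.m2 u v := by simp only [m2]; ring
lemma m3_smul (t u v : F) : d.m3 (t * u) (t * v) = t * d.m3 u v := by simp only [m3]; ring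
lemma m4_smul (t u v : F) : d.m4 (t * u) (t * v) = t * d.m4 u v := by simp only [m4]; ring
lemma l1_smul (t u v : F) : d.l1 (t * u) (t * v) = t * d.l1 u v := by simp only [l1]; ring
lemma l2_smul (t u v : F) : d.l2 (t * u) (t * v) = t * d.l2 u v := by simp only [l2]; ring
lemma dl_smul (t u v : F) : d.dl (t * u) (t * v) = t ^ 2 * d.dl u v := by
  simp only [dl, m1_smul, m2_smul, m3_smul, m4_smul]; ring

lemma sing_alg (hd : d.Gen) (U V : Fin 4 → F) (hn : ∀ k, d.NGen (U k) (V k))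
    (K : F) (hK : K ≠ 0)
    (hF : ∀ u v, d.quar u v = K * ((V 0 * u - U 0 * v) * (V 1 * u - U 1 * v) *
      (V 2 * u - U 2 * v) * (V 3 * u - U 3 * v)))
    (x : Fin 4 → F) (hx : x ≠ 0) (hc : d.cof x = 0) :
    (∃ (k : Fin 4) (c a : F), c ^ 2 = d.nr (U k) (V k) ∧ x = a • d.node (U k) (V k) c) ∨
    (∃ (c a : F), c ^ 2 = - (d.del1 * d.del2) ∧ x = a • d.nodeC c) := by
  have e1 := congrFun hc 0
  have e2 := congrFun hc 1
  have e3 := congrFun hc 2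
  have e4 := congrFun hc 3
  have e6 := congrFun hc 5
  have e5 := congrFun hc 4
  have e7 := congrFun hc 6
  have e8 := congrFun hc 7
  have e9 := congrFun hc 8
  have e10 := congrFun hc 9
  simp [cof] at e1 e2 e3 e4 e5 e6 e7 e8 e9 e10
  by_cases h0 : x 0 = 0 ∧ x 1 = 0
  · right
    obtain ⟨hx0, hx1⟩ := h0
    have hdl : d.dl (x 2) (x 3) = 0 := by
      by_contra hne
      have hne' : d.m1 (x 2) (x 3) * d.m4 (x 2) (x 3) - d.m2 (x 2) (x 3) * d.m3 (x 2) (x 3) ≠ 0 :=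
        hne
      simp only [hx0, hx1, zero_mul, zero_sub, zero_add, neg_eq_zero, mul_eq_zero, hne',
        or_false] at e7 e9
      obtain ⟨h2, h3⟩ := lin2 hd.i13 e7 e9
      apply hx
      ext i; fin_cases i <;> simp [hx0, hx1, h2, h3]
    rw [dl_eq d hd.rel] at hdl
    have hx3 : x 3 ≠ 0 := by
      intro h3
      rw [h3] at hdl
      have h2 : x 2 = 0 := by
        have : d.del1 * x 2 ^ 2 = 0 := by linear_combination hdl
        simpa [hd.d1] using this
      apply hx
      ext i; fin_cases i <;> simp [hx0, hx1, h2, h3]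
    have hd1 := hd.d1
    refine ⟨d.del1 * x 2 / x 3, x 3 / d.del1, ?_, ?_⟩
    · field_simp
      linear_combination hdl
    · ext i
      fin_cases i
      · simp [nodeC, hx0]
      · simp [nodeC, hx1]
      · simp [nodeC]; field_simp
      · simp [nodeC]; field_simp
  · left
    have hmm : ¬ (d.m1 (x 2) (x 3) * d.m2 (x 2) (x 3) = 0 ∧
        d.m3 (x 2) (x 3) * d.m4 (x 2) (x 3) = 0) := by
      rintro ⟨h12, h34⟩
      have h23 : x 2 = 0 ∧ x 3 = 0 := by
        rcases mul_eq_zero.mp h12 with h | h <;> rcases mul_eq_zero.mp h34 with h' | h'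
        · exact lin2 hd.i13 h h'
        · exact lin2 hd.i14 h h'
        · exact lin2 hd.i23 h h'
        · exact lin2 hd.i24 h h'
      simp [h23.1, h23.2, m1, m2, m3, m4] at e3 e4 e5 e6
      by_cases hx0 : x 0 = 0
      · have hx1 : x 1 ≠ 0 := fun h => h0 ⟨hx0, h⟩
        simp [hx0, hx1, l1, l2, hd.q0, hd.s0] at e6
      · by_cases hx1 : x 1 = 0
        · simp [hx0, hx1, l1, l2, hd.p0, hd.r0] at e5
        · simp [hx0, hx1] at e3 e4
          have hps : d.p * d.s - d.r * d.q ≠ 0 := by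
            have := hd.ps; rwa [mul_comm d.q] at this
          exact hx0 (lin2 hps e3 e4).1
    obtain ⟨ρ, hρ0, hρ1⟩ : ∃ ρ, x 0 = ρ * (d.m1 (x 2) (x 3) * d.m2 (x 2) (x 3)) ∧
        x 1 = ρ * (-(d.m3 (x 2) (x 3) * d.m4 (x 2) (x 3))) := by
      by_cases h12 : d.m1 (x 2) (x 3) * d.m2 (x 2) (x 3) = 0
      · have h34 : d.m3 (x 2) (x 3) * d.m4 (x 2) (x 3) ≠ 0 := fun h => hmm ⟨h12, h⟩
        refine ⟨- x 1 / (d.m3 (x 2) (x 3) * d.m4 (x 2) (x 3)), ?_, ?_⟩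
        · rw [h12, mul_zero]
          have : x 0 * (d.m3 (x 2) (x 3) * d.m4 (x 2) (x 3)) = 0 := by
            linear_combination e1 - x 1 * h12
          exact (mul_eq_zero.mp this).resolve_right h34
        · generalize d.m3 (x 2) (x 3) * d.m4 (x 2) (x 3) = t at h34
          field_simp
      · refine ⟨x 0 / (d.m1 (x 2) (x 3) * d.m2 (x 2) (x 3)), ?_, ?_⟩
        · rw [div_mul_cancel₀ _ h12]
        · rw [div_mul_eq_mul_div, eq_div_iff h12]
          linear_combination e1
    have hρ : ρ ≠ 0 := by
      rintro rfl; apply h0; simp [hρ0, hρ1]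
    have hl1 : d.l1 (x 0) (x 1) = ρ * d.nL (x 2) (x 3) := by
      rw [hρ0, hρ1, l1_smul]; rfl
    have hl2 : d.l2 (x 0) (x 1) = ρ * d.nM (x 2) (x 3) := by
      rw [hρ0, hρ1, l2_smul]; rfl
    have hq : d.quar (x 2) (x 3) = 0 := by
      have : ρ * d.quar (x 2) (x 3) = 0 := by
        rw [hl1, hl2] at e2
        simp only [quar]; linear_combination e2
      exact (mul_eq_zero.mp this).resolve_left hρ
    have hk : ∃ k, V k * x 2 - U k * x 3 = 0 := by
      rw [hF] at hq
      simp only [mul_eq_zero, hK, false_or] at hq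
      rcases hq with ((h | h) | h) | h
      · exact ⟨0, h⟩
      · exact ⟨1, h⟩
      · exact ⟨2, h⟩
      · exact ⟨3, h⟩
    obtain ⟨k, hk⟩ := hk
    have hnk := hn k
    obtain ⟨μ, hμ2, hμ3⟩ : ∃ μ, x 2 = μ * U k ∧ x 3 = μ * V k := by
      by_cases hU : U k = 0
      · have hV : V k ≠ 0 := by
          intro hV; apply hnk.m1; simp [Par.m1, hU, hV]
        refine ⟨x 3 / V k, ?_, ?_⟩
        · field_simp; linear_combination hk
        · field_simp
      · refine ⟨x 2 / U k, ?_, ?_⟩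
        · field_simp
        · field_simp; linear_combination -hk
    have hμ : μ ≠ 0 := by
      rintro rfl; apply hmm; simp [hμ2, hμ3, m1, m3]
    have hdl0 := hnk.dl
    have key : ρ ^ 2 * μ ^ 2 * (d.m2 (U k) (V k) * d.m4 (U k) (V k) * d.nL (U k) (V k))
        = d.dl (U k) (V k) := by
      have h7 := e7
      rw [hl1, hρ0, hμ2, hμ3] at h7
      simp only [nL, nA, nB, m1_smul, m2_smul, m3_smul, m4_smul] at h7
      have h1 : μ ^ 3 * d.m1 (U k) (V k) ≠ 0 := mul_ne_zero (pow_ne_zero 3 hμ) hnk.m1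
      apply mul_left_cancel₀ h1
      simp only [nL, nA, nB, l1, dl] at h7 ⊢
      linear_combination h7
    refine ⟨k, d.dl (U k) (V k) / (ρ * μ), ρ * μ ^ 2 / d.dl (U k) (V k), ?_, ?_⟩
    · simp only [nr]
      generalize d.dl (U k) (V k) = δ at *
      field_simp
      linear_combination -key
    · have hx0' : x 0 = ρ * μ ^ 2 * d.nA (U k) (V k) := by
        rw [hρ0, hμ2, hμ3, m1_smul, m2_smul]; simp only [nA]; ring
      have hx1' : x 1 = ρ * μ ^ 2 * d.nB (U k) (V k) := by
        rw [hρ1, hμ2, hμ3, m3_smul, m4_smul]; simp only [nB]; ring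
      ext i
      fin_cases i
      · simp [node]; rw [hx0']; field_simp
      · simp [node]; rw [hx1']; field_simp
      · simp [node]; rw [hμ2]; field_simp
      · simp [node]; rw [hμ3]; field_simp

end alg2b
end Par


namespace Par
section alg3
variable {F : Type} [Field F] (d : Par F)

lemma tau {U V : F} (hn : d.NGen U V) : ∃ τ, d.nL U V = d.m1 U V * d.m3 U V * τ ∧
    d.nM U V = - (d.m2 U V * d.m4 U V * τ) := by
  have h1 := hn.m1
  have h3 := hn.m3
  have hq := hn.quar
  refine ⟨d.nL U V / (d.m1 U V * d.m3 U V), ?_, ?_⟩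
  · field_simp
  · simp only [quar] at hq
    field_simp
    linear_combination hq

lemma node_entries (U V c : F) :
    d.l1 (d.node U V c 0) (d.node U V c 1) = d.dl U V * d.nL U V ∧
    d.l2 (d.node U V c 0) (d.node U V c 1) = d.dl U V * d.nM U V ∧
    d.m1 (d.node U V c 2) (d.node U V c 3) = c * d.m1 U V ∧
    d.m2 (d.node U V c 2) (d.node U V c 3) = c * d.m2 U V ∧
    d.m3 (d.node U V c 2) (d.node U V c 3) = c * d.m3 U V ∧
    d.m4 (d.node U V c 2) (d.node U V c 3) = c * d.m4 U V := by
  refine ⟨?_, ?_, ?_, ?_, ?_, ?_⟩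
  · exact l1_smul d _ _ _
  · exact l2_smul d _ _ _
  · exact m1_smul d _ _ _
  · exact m2_smul d _ _ _
  · exact m3_smul d _ _ _
  · exact m4_smul d _ _ _

lemma g_node {U V c : F} (hn : d.NGen U V) (hc : c ^ 2 = d.nr U V) : d.g (d.node U V c) = 0 := by
  obtain ⟨e1, e2, e3, e4, e5, e6⟩ := d.node_entries U V c
  obtain ⟨τ, t1, t2⟩ := d.tau hn
  have hdl : d.dl U V = d.m1 U V * d.m4 U V - d.m2 U V * d.m3 U V := rfl
  have hA : d.node U V c 0 = d.dl U V * (d.m1 U V * d.m2 U V) := rfl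
  have hB : d.node U V c 1 = d.dl U V * -(d.m3 U V * d.m4 U V) := rfl
  simp only [nr, t1] at hc
  unfold g
  rw [e1, e2, e3, e4, e5, e6, hA, hB, t1, t2]
  rw [hdl] at hc ⊢
  generalize d.m1 U V = n1 at *
  generalize d.m2 U V = n2 at *
  generalize d.m3 U V = n3 at *
  generalize d.m4 U V = n4 at *
  ext i
  fin_cases i
  · simp [gg]
    have : c ^ 2 = (n1 * n4 - n2 * n3) * n2 * n4 * (n1 * n3 * τ) := hc
    simp only [mul_pow, this]
    ring
  · simp [gg]
    have : c ^ 2 = (n1 * n4 - n2 * n3) * n2 * n4 * (n1 * n3 * τ) := hc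
    simp only [mul_pow, this]
    ring
  · simp [gg]
    linear_combination 2 * c * (n1 * n4 - n2 * n3) *
      (d.a1 * n4 + d.a4 * n1 - d.a2 * n3 - d.a3 * n2) * hc
  · simp [gg]
    linear_combination 2 * c * (n1 * n4 - n2 * n3) *
      (d.b1 * n4 + d.b4 * n1 - d.b2 * n3 - d.b3 * n2) * hc

lemma dl_C (hrel : d.rel) {c : F} (hc : c ^ 2 = - (d.del1 * d.del2)) : d.dl c d.del1 = 0 := by
  rw [dl_eq d hrel, hc]; ring

lemma g_nodeC (hrel : d.rel) {c : F} (hc : c ^ 2 = - (d.del1 * d.del2)) :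
    d.g (d.nodeC c) = 0 := by
  have h0 := d.dl_C hrel hc
  simp only [dl] at h0
  ext i
  fin_cases i <;> simp [g, gg, nodeC, l1, l2]
  · left; right; exact h0
  · left; right; exact h0

/-- Hessian minor at a node -/
def hmin {R : Type} [CommRing R] (d : Par R) (x0 x1 L M n1 n2 n3 n4 rr : R) : R :=
  let H00 := d.h00 x0 x1 L M 0 0 + rr * d.h00 0 0 0 0 n3 n4
  let H11 := d.h11 x0 x1 L M 0 0 + rr * d.h11 0 0 0 0 n1 n2
  let H01 := d.h01 x0 x1 L M 0 0 0 0 + rr * d.h01 0 0 0 0 n1 n2 n3 n4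
  let H22 := hab d.a1 d.a2 d.a3 d.a4 d.a1 d.a2 d.a3 d.a4 x0 x1 L M 0 0 0 0
    + rr * hab d.a1 d.a2 d.a3 d.a4 d.a1 d.a2 d.a3 d.a4 0 0 0 0 n1 n2 n3 n4
  let k := d.h0 d.a1 d.a2 d.a3 d.a4 x0 x1 L M n1 n2 n3 n4
  let l := d.h1 d.a1 d.a2 d.a3 d.a4 x0 x1 L M n1 n2 n3 n4
  H00 * (H11 * H22 - rr * l * l) - H01 * (H01 * H22 - rr * k * l) + rr * k * (H01 * l - H11 * k)

lemma det_hh (x0 x1 L M n1 n2 n3 n4 c rr : F) (hc : c ^ 2 = rr) :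
    ((d.hh x0 x1 L M (c * n1) (c * n2) (c * n3) (c * n4)).submatrix ![0, 1, 2] ![0, 1, 2]).det =
    d.hmin x0 x1 L M n1 n2 n3 n4 rr := by
  subst hc
  have e1 : d.h00 x0 x1 L M (c * n3) (c * n4) =
    d.h00 x0 x1 L M 0 0 + c ^ 2 * d.h00 0 0 0 0 n3 n4 := by simp only [h00]; ring
  have e2 : d.h11 x0 x1 L M (c * n1) (c * n2) =
    d.h11 x0 x1 L M 0 0 + c ^ 2 * d.h11 0 0 0 0 n1 n2 := by simp only [h11]; ring
  have e3 : d.h01 x0 x1 L M (c * n1) (c * n2) (c * n3) (c * n4) =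
    d.h01 x0 x1 L M 0 0 0 0 + c ^ 2 * d.h01 0 0 0 0 n1 n2 n3 n4 := by simp only [h01]; ring
  have e4 : hab d.a1 d.a2 d.a3 d.a4 d.a1 d.a2 d.a3 d.a4 x0 x1 L M
      (c * n1) (c * n2) (c * n3) (c * n4) =
    hab d.a1 d.a2 d.a3 d.a4 d.a1 d.a2 d.a3 d.a4 x0 x1 L M 0 0 0 0
    + c ^ 2 * hab d.a1 d.a2 d.a3 d.a4 d.a1 d.a2 d.a3 d.a4 0 0 0 0 n1 n2 n3 n4 := by
    simp only [hab]; ring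
  have e5 : d.h0 d.a1 d.a2 d.a3 d.a4 x0 x1 L M (c * n1) (c * n2) (c * n3) (c * n4) =
    c * d.h0 d.a1 d.a2 d.a3 d.a4 x0 x1 L M n1 n2 n3 n4 := by simp only [h0]; ring
  have e6 : d.h1 d.a1 d.a2 d.a3 d.a4 x0 x1 L M (c * n1) (c * n2) (c * n3) (c * n4) =
    c * d.h1 d.a1 d.a2 d.a3 d.a4 x0 x1 L M n1 n2 n3 n4 := by simp only [h1]; ring
  rw [Matrix.det_fin_three]
  simp [hh, e1, e2, e3, e4, e5, e6, hmin]
  ring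

/-- Hessian minor at a node -/
def nmin {R : Type} [CommRing R] (d : Par R) (D A B L M n1 n2 n3 n4 : R) : R :=
  d.hmin (D * A) (D * B) (D * L) (D * M) n1 n2 n3 n4 (D * n2 * n4 * L)

lemma det_node {U V c : F} (hc : c ^ 2 = d.nr U V) :
    ((d.h (d.node U V c)).submatrix ![0, 1, 2] ![0, 1, 2]).det =
    d.nmin (d.dl U V) (d.nA U V) (d.nB U V) (d.nL U V) (d.nM U V) (d.m1 U V) (d.m2 U V)
      (d.m3 U V) (d.m4 U V) := by
  obtain ⟨e1, e2, e3, e4, e5, e6⟩ := d.node_entries U V c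
  unfold h
  rw [e1, e2, e3, e4, e5, e6]
  exact d.det_hh _ _ _ _ _ _ _ _ _ _ hc

end alg3

section special
variable {R : Type} [CommRing R] (d : Par R)

/-- constant coefficient of a square at the special node -/
def sq0 (a b δ rc : R) : R := a ^ 2 * rc + b ^ 2 * δ ^ 2
/-- linear coefficient of a square at the special node -/
def sq1 (a b δ : R) : R := 2 * a * b * δ

/-- constant coefficient of the minor at the special node -/
def alC (δ rc : R) : R :=
  let X0 := d.r * sq0 d.a3 d.b3 δ rc + d.p * sq0 d.a4 d.b4 δ rc
  let X1 := d.r * sq1 d.a3 d.b3 δ + d.p * sq1 d.a4 d.b4 δ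
  let Y0 := d.s * sq0 d.a1 d.b1 δ rc + d.q * sq0 d.a2 d.b2 δ rc
  let Y1 := d.s * sq1 d.a1 d.b1 δ + d.q * sq1 d.a2 d.b2 δ
  let Z0 := d.r * sq0 d.a1 d.b1 δ rc + d.p * sq0 d.a2 d.b2 δ rc + d.s * sq0 d.a3 d.b3 δ rc
    + d.q * sq0 d.a4 d.b4 δ rc
  let Z1 := d.r * sq1 d.a1 d.b1 δ + d.p * sq1 d.a2 d.b2 δ + d.s * sq1 d.a3 d.b3 δ
    + d.q * sq1 d.a4 d.b4 δ
  4 * (X0 * Y0 + X1 * Y1 * rc) - (Z0 * Z0 + Z1 * Z1 * rc)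

/-- linear coefficient of the minor at the special node -/
def beC (δ rc : R) : R :=
  let X0 := d.r * sq0 d.a3 d.b3 δ rc + d.p * sq0 d.a4 d.b4 δ rc
  let X1 := d.r * sq1 d.a3 d.b3 δ + d.p * sq1 d.a4 d.b4 δ
  let Y0 := d.s * sq0 d.a1 d.b1 δ rc + d.q * sq0 d.a2 d.b2 δ rc
  let Y1 := d.s * sq1 d.a1 d.b1 δ + d.q * sq1 d.a2 d.b2 δ
  let Z0 := d.r * sq0 d.a1 d.b1 δ rc + d.p * sq0 d.a2 d.b2 δ rc + d.s * sq0 d.a3 d.b3 δ rc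
    + d.q * sq0 d.a4 d.b4 δ rc
  let Z1 := d.r * sq1 d.a1 d.b1 δ + d.p * sq1 d.a2 d.b2 δ + d.s * sq1 d.a3 d.b3 δ
    + d.q * sq1 d.a4 d.b4 δ
  4 * (X0 * Y1 + X1 * Y0) - 2 * Z0 * Z1

end special

section alg4
variable {F : Type} [Field F] (d : Par F)

lemma det_nodeC (hrel : d.rel) {c : F} (hc : c ^ 2 = - (d.del1 * d.del2)) :
    ((d.h (d.nodeC c)).submatrix ![0, 1, 2] ![0, 1, 2]).det =
    (8 * d.del1 ^ 2 * c ^ 2) * (d.alC d.del1 (c ^ 2) + d.beC d.del1 (c ^ 2) * c) := by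
  have h0 := d.dl_C hrel hc
  clear hc
  simp only [dl] at h0
  have e4 : hab d.a1 d.a2 d.a3 d.a4 d.a1 d.a2 d.a3 d.a4 0 0 0 0
      (d.m1 c d.del1) (d.m2 c d.del1) (d.m3 c d.del1) (d.m4 c d.del1) = 8 * d.del1 ^ 2 * c ^ 2 := by
    have e : d.a1 * d.m4 c d.del1 + d.a4 * d.m1 c d.del1 - d.a2 * d.m3 c d.del1
        - d.a3 * d.m2 c d.del1 = 2 * d.del1 * c := by
      unfold rel at hrel
      have hδ : d.del1 = d.a1 * d.a4 - d.a2 * d.a3 := rfl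
      simp only [m1, m2, m3, m4]
      linear_combination d.del1 * hrel - 2 * c * hδ
    simp only [hab, e, h0]; ring
  have e5 : d.h0 d.a1 d.a2 d.a3 d.a4 0 0 0 0 (d.m1 c d.del1) (d.m2 c d.del1)
      (d.m3 c d.del1) (d.m4 c d.del1) = 0 := by simp only [Par.h0]; ring
  have e6 : d.h1 d.a1 d.a2 d.a3 d.a4 0 0 0 0 (d.m1 c d.del1) (d.m2 c d.del1)
      (d.m3 c d.del1) (d.m4 c d.del1) = 0 := by simp only [Par.h1]; ring
  have el1 : d.l1 0 0 = 0 := by simp [l1]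
  have el2 : d.l2 0 0 = 0 := by simp [l2]
  rw [Matrix.det_fin_three]
  simp [h, hh, nodeC, el1, el2, e4, e5, e6]
  have e7 : d.h00 0 0 0 0 (d.m3 c d.del1) (d.m4 c d.del1) *
      d.h11 0 0 0 0 (d.m1 c d.del1) (d.m2 c d.del1) -
      d.h01 0 0 0 0 (d.m1 c d.del1) (d.m2 c d.del1) (d.m3 c d.del1) (d.m4 c d.del1) ^ 2 =
      d.alC d.del1 (c ^ 2) + d.beC d.del1 (c ^ 2) * c := by
    generalize d.del1 = δ
    simp only [h00, h11, h01, m1, m2, m3, m4, alC, beC, sq0, sq1]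
    ring
  linear_combination (8 * d.del1 ^ 2 * c ^ 2) * e7

/-- The base locus is empty. -/
lemma base (hps : d.p * d.s - d.q * d.r ≠ 0) (S0 S1 S2 S3 T0 T1 R : F) (hR : R ≠ 0)
    (hq : d.a1 * d.b3 - d.a3 * d.b1 ≠ 0) (hp : d.p ≠ 0)
    (hB : ∀ w1 w2 : F,
      (S0 * w2 ^ 3 + S1 * w1 * w2 ^ 2 + S2 * w1 ^ 2 * w2 + S3 * w1 ^ 3) *
        ((d.a1 * w1 + d.a2 * w2) * (d.b3 * w1 + d.b4 * w2)
          - (d.a3 * w1 + d.a4 * w2) * (d.b1 * w1 + d.b2 * w2)) +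
      (T0 * w2 + T1 * w1) * ((d.p * w1 ^ 2 + d.r * w2 ^ 2) * (d.a1 * w1 + d.a2 * w2) ^ 2
        - (d.q * w1 ^ 2 + d.s * w2 ^ 2) * (d.a3 * w1 + d.a4 * w2) ^ 2) = R * w2 ^ 5)
    (v : Fin 4 → F) (h0 : v 0 ^ 2 + d.p * v 1 ^ 2 + d.r * v 2 ^ 2 = 0)
    (h1 : v 3 ^ 2 + d.q * v 1 ^ 2 + d.s * v 2 ^ 2 = 0)
    (h2 : d.a1 * v 0 * v 1 + d.a2 * v 0 * v 2 + d.a3 * v 3 * v 1 + d.a4 * v 3 * v 2 = 0)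
    (h3 : d.b1 * v 0 * v 1 + d.b2 * v 0 * v 2 + d.b3 * v 3 * v 1 + d.b4 * v 3 * v 2 = 0) :
    v = 0 := by
  have hw : v 1 = 0 ∧ v 2 = 0 := by
    by_cases hv : v 0 = 0 ∧ v 3 = 0
    · rw [hv.1] at h0
      rw [hv.2] at h1
      have e2 : (d.p * d.s - d.q * d.r) * v 2 ^ 2 = 0 := by
        linear_combination d.p * h1 - d.q * h0
      have e2' : v 2 = 0 := by simpa [hps] using e2
      rw [e2'] at h0
      have e1 : d.p * v 1 ^ 2 = 0 := by linear_combination h0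
      exact ⟨by simpa [hp] using e1, e2'⟩
    · have hD : (d.a1 * v 1 + d.a2 * v 2) * (d.b3 * v 1 + d.b4 * v 2)
          - (d.a3 * v 1 + d.a4 * v 2) * (d.b1 * v 1 + d.b2 * v 2) = 0 := by
        by_contra hne
        apply hv
        constructor
        · have : ((d.a1 * v 1 + d.a2 * v 2) * (d.b3 * v 1 + d.b4 * v 2)
            - (d.a3 * v 1 + d.a4 * v 2) * (d.b1 * v 1 + d.b2 * v 2)) * v 0 = 0 := by
            linear_combination (d.b3 * v 1 + d.b4 * v 2) * h2 - (d.a3 * v 1 + d.a4 * v 2) * h3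
          exact (mul_eq_zero.mp this).resolve_left hne
        · have : ((d.a1 * v 1 + d.a2 * v 2) * (d.b3 * v 1 + d.b4 * v 2)
            - (d.a3 * v 1 + d.a4 * v 2) * (d.b1 * v 1 + d.b2 * v 2)) * v 3 = 0 := by
            linear_combination (d.a1 * v 1 + d.a2 * v 2) * h3 - (d.b1 * v 1 + d.b2 * v 2) * h2
          exact (mul_eq_zero.mp this).resolve_left hne
      have hKq : (d.p * v 1 ^ 2 + d.r * v 2 ^ 2) * (d.a1 * v 1 + d.a2 * v 2) ^ 2
        - (d.q * v 1 ^ 2 + d.s * v 2 ^ 2) * (d.a3 * v 1 + d.a4 * v 2) ^ 2 = 0 := by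
        linear_combination (d.a1 * v 1 + d.a2 * v 2) ^ 2 * h0 - (d.a3 * v 1 + d.a4 * v 2) ^ 2 * h1
          + (v 3 * (d.a3 * v 1 + d.a4 * v 2) - v 0 * (d.a1 * v 1 + d.a2 * v 2)) * h2
      have hb := hB (v 1) (v 2)
      rw [hD, hKq, mul_zero, mul_zero, add_zero] at hb
      have e2 : v 2 = 0 := by simpa [hR] using hb.symm
      rw [e2] at hD
      have e1 : (d.a1 * d.b3 - d.a3 * d.b1) * v 1 ^ 2 = 0 := by linear_combination hD
      exact ⟨by simpa [hq] using e1, e2⟩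
  rw [hw.1, hw.2] at h0 h1
  have e0 : v 0 = 0 := by
    have : v 0 ^ 2 = 0 := by linear_combination h0
    simpa using this
  have e3 : v 3 = 0 := by
    have : v 3 ^ 2 = 0 := by linear_combination h1
    simpa using this
  ext i; fin_cases i <;> simp [e0, e3, hw.1, hw.2]

end alg4
end Par


namespace Par

section maps
variable {R S : Type} [CommRing R] [CommRing S] (φ : R →+* S) (d : Par R)

lemma map_m1 (u v : R) : (d.map φ).m1 (φ u) (φ v) = φ (d.m1 u v) := by simp [m1, map]
lemma map_m2 (u v : R) : (d.map φ).m2 (φ u) (φ v) = φ (d.m2 u v) := by simp [m2, map]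
lemma map_m3 (u v : R) : (d.map φ).m3 (φ u) (φ v) = φ (d.m3 u v) := by simp [m3, map]
lemma map_m4 (u v : R) : (d.map φ).m4 (φ u) (φ v) = φ (d.m4 u v) := by simp [m4, map]
lemma map_l1 (u v : R) : (d.map φ).l1 (φ u) (φ v) = φ (d.l1 u v) := by simp [l1, map]
lemma map_l2 (u v : R) : (d.map φ).l2 (φ u) (φ v) = φ (d.l2 u v) := by simp [l2, map]
lemma map_dl (u v : R) : (d.map φ).dl (φ u) (φ v) = φ (d.dl u v) := by
  simp only [dl, map_m1, map_m2, map_m3, map_m4, map_mul, map_sub]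
lemma map_nA (u v : R) : (d.map φ).nA (φ u) (φ v) = φ (d.nA u v) := by
  simp only [nA, map_m1, map_m2, map_mul]
lemma map_nB (u v : R) : (d.map φ).nB (φ u) (φ v) = φ (d.nB u v) := by
  simp only [nB, map_m3, map_m4, map_mul, map_neg]
lemma map_nL (u v : R) : (d.map φ).nL (φ u) (φ v) = φ (d.nL u v) := by
  simp only [nL, map_nA, map_nB, map_l1]
lemma map_nM (u v : R) : (d.map φ).nM (φ u) (φ v) = φ (d.nM u v) := by
  simp only [nM, map_nA, map_nB, map_l2]
lemma map_nr (u v : R) : (d.map φ).nr (φ u) (φ v) = φ (d.nr u v) := by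
  simp only [nr, map_nL, map_m2, map_m4, map_dl, map_mul]
lemma map_quar (u v : R) : (d.map φ).quar (φ u) (φ v) = φ (d.quar u v) := by
  simp only [quar, map_nL, map_nM, map_m1, map_m3, map_m2, map_m4, map_mul, map_add]
lemma map_del1 : (d.map φ).del1 = φ d.del1 := by simp [del1, map]
lemma map_del2 : (d.map φ).del2 = φ d.del2 := by simp [del2, map]
lemma map_nmin (a b c e f g h i j : R) :
    (d.map φ).nmin (φ a) (φ b) (φ c) (φ e) (φ f) (φ g) (φ h) (φ i) (φ j) =
      φ (d.nmin a b c e f g h i j) := by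
  have h2 : φ 2 = 2 := map_ofNat φ 2
  simp [nmin, hmin, h00, h11, h01, hab, h0, h1, map, h2]
lemma map_alC (a b : R) : (d.map φ).alC (φ a) (φ b) = φ (d.alC a b) := by
  have h2 : φ 2 = 2 := map_ofNat φ 2
  have h4 : φ 4 = 4 := map_ofNat φ 4
  simp [alC, sq0, sq1, map, h2, h4]
lemma map_beC (a b : R) : (d.map φ).beC (φ a) (φ b) = φ (d.beC a b) := by
  have h2 : φ 2 = 2 := map_ofNat φ 2
  have h4 : φ 4 = 4 := map_ofNat φ 4
  simp [beC, sq0, sq1, map, h2, h4]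

lemma Gen.map {d : Par R} (h : d.Gen) (hφ : Function.Injective φ) : (d.map φ).Gen := by
  have key : ∀ t : R, t ≠ 0 → φ t ≠ 0 := fun t ht => (map_ne_zero_iff φ hφ).mpr ht
  refine ⟨?_, ?_, ?_, ?_, ?_, ?_, ?_, ?_, ?_, ?_, ?_, ?_⟩
  · have := congrArg φ h.rel
    simpa [Par.rel, Par.map] using this
  · rw [map_del1]; exact key _ h.d1
  · rw [map_del2]; exact key _ h.d2
  · simpa [Par.map] using key _ h.i13
  · simpa [Par.map] using key _ h.i14
  · simpa [Par.map] using key _ h.i23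
  · simpa [Par.map] using key _ h.i24
  · exact key _ h.p0
  · exact key _ h.q0
  · exact key _ h.r0
  · exact key _ h.s0
  · simpa [Par.map] using key _ h.ps

lemma NGen.map {d : Par R} {U V : R} (h : d.NGen U V) (hφ : Function.Injective φ) :
    (d.map φ).NGen (φ U) (φ V) := by
  have key : ∀ t : R, t ≠ 0 → φ t ≠ 0 := fun t ht => (map_ne_zero_iff φ hφ).mpr ht
  refine ⟨?_, ?_, ?_, ?_, ?_, ?_, ?_⟩
  · rw [map_quar, h.quar, map_zero]
  · rw [map_m1]; exact key _ h.m1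
  · rw [map_m2]; exact key _ h.m2
  · rw [map_m3]; exact key _ h.m3
  · rw [map_m4]; exact key _ h.m4
  · rw [map_nL]; exact key _ h.nL
  · rw [map_dl]; exact key _ h.dl

end maps

/-- real version of integral parameters -/
abbrev re (d : Par ℤ) : Par ℝ := d.map (Int.castRingHom ℝ)

/-- complex version of integral parameters -/
abbrev co (d : Par ℤ) : Par ℂ := d.map (Int.castRingHom ℂ)

lemma re_toC (d : Par ℤ) : d.re.toC = d.co := by
  simp [map, toC]

/-- squares of the parameters -/
def rad {R : Type} [CommRing R] (d : Par R) (U V : Fin 4 → R) : Fin 5 → R :=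
  Fin.snoc (α := fun _ => R) (fun k => d.nr (U k) (V k)) (- (d.del1 * d.del2))

/-- base parts of the nodes -/
def bP {R : Type} [CommRing R] (d : Par R) (U V : Fin 4 → R) : Fin 5 → Fin 4 → R :=
  Fin.snoc (α := fun _ => Fin 4 → R) (fun k => d.node (U k) (V k) 0) (d.nodeC 0)

/-- directions of the nodes -/
def bD {R : Type} [CommRing R] (U V : Fin 4 → R) : Fin 5 → Fin 4 → R :=
  Fin.snoc (α := fun _ => Fin 4 → R) (fun k => ![0, 0, U k, V k]) ![0, 0, 1, 0]

/-- sign of the product of the extreme diagonal entries -/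
def bs {R : Type} [CommRing R] (d : Par R) (U V : Fin 4 → R) : Fin 5 → R :=
  Fin.snoc (α := fun _ => R) (fun k => d.nA (U k) (V k) * d.nB (U k) (V k)) (-1)

/-- nodes in the closure -/
def setS (d : Par ℤ) (U V : Fin 4 → ℤ) : Finset (Fin 5) :=
  Finset.univ.filter fun k => 0 < d.rad U V k ∧ 0 < d.bs U V k

/-- real nodes not in the closure -/
def setT (d : Par ℤ) (U V : Fin 4 → ℤ) : Finset (Fin 5) :=
  Finset.univ.filter fun k => 0 < d.rad U V k ∧ ¬ 0 < d.bs U V k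

/-- All the integral conditions. -/
structure Good (d : Par ℤ) (U V : Fin 4 → ℤ) (X0 X1 : ℤ) : Prop where
  gen : d.Gen
  n : ∀ k, d.NGen (U k) (V k)
  cross : ∀ k k', k ≠ k' → U k * V k' - V k * U k' ≠ 0
  minor : ∀ k, d.nmin (d.dl (U k) (V k)) (d.nA (U k) (V k)) (d.nB (U k) (V k)) (d.nL (U k) (V k))
    (d.nM (U k) (V k)) (d.m1 (U k) (V k)) (d.m2 (U k) (V k)) (d.m3 (U k) (V k))
    (d.m4 (U k) (V k)) ≠ 0
  minorC : d.alC d.del1 (- (d.del1 * d.del2)) ^ 2 -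
    d.beC d.del1 (- (d.del1 * d.del2)) ^ 2 * (- (d.del1 * d.del2)) ≠ 0
  x0 : 0 < X0
  x1 : 0 < X1
  y0 : 0 < d.l1 X0 X1
  y1 : 0 < d.l2 X0 X1

end Par


namespace Par

section real
variable (d : Par ℝ)

lemma quad_mat (x y : Fin 4 → ℝ) : y ⬝ᵥ (d.mat x *ᵥ y) =
    x 0 * y 0 ^ 2 + d.l1 (x 0) (x 1) * y 1 ^ 2 + d.l2 (x 0) (x 1) * y 2 ^ 2 + x 1 * y 3 ^ 2 +
    2 * (d.m1 (x 2) (x 3) * y 0 * y 1 + d.m2 (x 2) (x 3) * y 0 * y 2 +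
      d.m3 (x 2) (x 3) * y 1 * y 3 + d.m4 (x 2) (x 3) * y 2 * y 3) := by
  simp [mat, Matrix.mulVec, dotProduct, Fin.sum_univ_four]
  ring

lemma mat_herm (x : Fin 4 → ℝ) : (d.mat x).IsHermitian := by
  ext i j
  fin_cases i <;> fin_cases j <;> simp [mat]

lemma psd_node {U V c : ℝ} (hn : d.NGen U V) (hc : c ^ 2 = d.nr U V)
    (hs : 0 < d.nA U V * d.nB U V) :
    (d.mat (d.node U V c)).PosSemidef ∨ (- d.mat (d.node U V c)).PosSemidef := by
  obtain ⟨e1, e2, e3, e4, e5, e6⟩ := d.node_entries U V c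
  obtain ⟨τ, t1, t2⟩ := d.tau hn
  have hdl : d.dl U V = d.m1 U V * d.m4 U V - d.m2 U V * d.m3 U V := rfl
  have hA : d.node U V c 0 = d.dl U V * (d.m1 U V * d.m2 U V) := rfl
  have hB : d.node U V c 1 = d.dl U V * -(d.m3 U V * d.m4 U V) := rfl
  have hAB : 0 < d.node U V c 0 * d.node U V c 1 := by
    have h1 : d.node U V c 0 * d.node U V c 1 = d.dl U V ^ 2 * (d.nA U V * d.nB U V) := by
      rw [hA, hB]; simp only [nA, nB]; ring
    rw [h1]
    have := hn.dl
    positivity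
  simp only [nr, t1] at hc
  have hq := fun y => d.quad_mat (d.node U V c) y
  have hm := d.mat_herm (d.node U V c)
  simp only [e1, e2, e3, e4, e5, e6] at hq
  have E1 : d.node U V c 0 * (c * d.m3 U V) * (c * d.m4 U V) +
      d.node U V c 1 * (c * d.m1 U V) * (c * d.m2 U V) = 0 := by rw [hA, hB]; ring
  have E3 : d.node U V c 0 * d.node U V c 1 * (d.dl U V * d.nL U V)
      - d.node U V c 1 * (c * d.m1 U V) ^ 2 - d.node U V c 0 * (c * d.m3 U V) ^ 2 = 0 := by
    rw [hA, hB, t1]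
    simp only [mul_pow, hc]
    rw [hdl]; ring
  have E4 : d.node U V c 0 * d.node U V c 1 * (d.dl U V * d.nM U V)
      - d.node U V c 1 * (c * d.m2 U V) ^ 2 - d.node U V c 0 * (c * d.m4 U V) ^ 2 = 0 := by
    rw [hA, hB, t2]
    simp only [mul_pow, hc]
    rw [hdl]; ring
  generalize d.mat (d.node U V c) = W at *
  generalize d.node U V c 0 = A at *
  generalize d.node U V c 1 = B at *
  generalize d.dl U V * d.nL U V = L at *
  generalize d.dl U V * d.nM U V = M at *
  generalize c * d.m1 U V = n1 at *
  generalize c * d.m2 U V = n2 at *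
  generalize c * d.m3 U V = n3 at *
  generalize c * d.m4 U V = n4 at *
  have key : ∀ y : Fin 4 → ℝ, (A * B) * (y ⬝ᵥ (W *ᵥ y)) =
      B * (A * y 0 + n1 * y 1 + n2 * y 2) ^ 2 + A * (B * y 3 + n3 * y 1 + n4 * y 2) ^ 2 := by
    intro y
    rw [hq]
    linear_combination y 1 ^ 2 * E3 + y 2 ^ 2 * E4 - 2 * y 1 * y 2 * E1
  rcases lt_or_gt_of_ne (left_ne_zero_of_mul hAB.ne') with hA' | hA'
  · right
    have hB' : B < 0 := by
      by_contra h
      nlinarith [mul_nonneg (neg_nonneg.mpr hA'.le) (not_lt.mp h)]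
    refine Matrix.PosSemidef.of_dotProduct_mulVec_nonneg hm.neg fun y => ?_
    have hk := key y
    have h1 : 0 ≤ (-B) * (A * y 0 + n1 * y 1 + n2 * y 2) ^ 2 :=
      mul_nonneg (by linarith) (sq_nonneg _)
    have h2 : 0 ≤ (-A) * (B * y 3 + n3 * y 1 + n4 * y 2) ^ 2 :=
      mul_nonneg (by linarith) (sq_nonneg _)
    simp only [star_trivial, Matrix.neg_mulVec, dotProduct_neg]
    refine nonneg_of_mul_nonneg_right ?_ hAB
    linarith
  · left
    have hB' : 0 < B := by
      by_contra h
      nlinarith [mul_nonneg hA'.le (neg_nonneg.mpr (not_lt.mp h))]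
    refine Matrix.PosSemidef.of_dotProduct_mulVec_nonneg hm fun y => ?_
    have hk := key y
    simp only [star_trivial]
    refine nonneg_of_mul_nonneg_right ?_ hAB
    rw [hk]
    positivity

lemma pd_diag {X0 X1 : ℝ} (h0 : 0 < X0) (h1 : 0 < X1) (h2 : 0 < d.l1 X0 X1) (h3 : 0 < d.l2 X0 X1) :
    (d.mat ![X0, X1, 0, 0]).PosDef := by
  refine Matrix.PosDef.of_dotProduct_mulVec_pos (d.mat_herm _) fun y hy => ?_
  have hq := d.quad_mat ![X0, X1, 0, 0] y
  simp only [star_trivial]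
  rw [hq]
  have e1 : d.m1 0 0 = 0 := by simp [m1]
  have e2 : d.m2 0 0 = 0 := by simp [m2]
  have e3 : d.m3 0 0 = 0 := by simp [m3]
  have e4 : d.m4 0 0 = 0 := by simp [m4]
  simp [e1, e2, e3, e4]
  by_contra hneg
  have p0 := mul_nonneg h0.le (sq_nonneg (y 0))
  have p1 := mul_nonneg h2.le (sq_nonneg (y 1))
  have p2 := mul_nonneg h3.le (sq_nonneg (y 2))
  have p3 := mul_nonneg h1.le (sq_nonneg (y 3))
  have q0 : X0 * y 0 ^ 2 = 0 := by linarith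
  have q1 : d.l1 X0 X1 * y 1 ^ 2 = 0 := by linarith
  have q2 : d.l2 X0 X1 * y 2 ^ 2 = 0 := by linarith
  have q3 : X1 * y 3 ^ 2 = 0 := by linarith
  simp [h0.ne', h1.ne', h2.ne', h3.ne'] at q0 q1 q2 q3
  apply hy
  ext i; fin_cases i <;> simp [q0, q1, q2, q3]

lemma neg_node {U V c : ℝ} (hn : d.NGen U V) (hs : ¬ 0 < d.nA U V * d.nB U V) :
    d.mat (d.node U V c) 0 0 * d.mat (d.node U V c) 3 3
      - d.mat (d.node U V c) 0 3 * d.mat (d.node U V c) 0 3 < 0 := by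
  have h1 : d.mat (d.node U V c) 0 0 * d.mat (d.node U V c) 3 3
      - d.mat (d.node U V c) 0 3 * d.mat (d.node U V c) 0 3
      = - (d.dl U V ^ 2 * (-(d.nA U V * d.nB U V))) := by
    simp [mat, node]; ring
  have h2 : d.nA U V * d.nB U V ≠ 0 := by
    simp only [nA, nB]
    have := hn.m1
    have := hn.m2
    have := hn.m3
    have := hn.m4
    simp_all
  have h3 : 0 < -(d.nA U V * d.nB U V) := by
    rcases lt_or_gt_of_ne h2 with h | h
    · linarith
    · exact absurd h hs
  rw [h1]
  have := hn.dl
  have : 0 < d.dl U V ^ 2 * (-(d.nA U V * d.nB U V)) := by positivity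
  linarith

lemma neg_nodeC (hd : d.Gen) (c : ℝ) : ∃ i j, i ≠ j ∧
    d.mat (d.nodeC c) i i * d.mat (d.nodeC c) j j
      - d.mat (d.nodeC c) i j * d.mat (d.nodeC c) i j < 0 := by
  have el1 : d.l1 0 0 = 0 := by simp [l1]
  have el2 : d.l2 0 0 = 0 := by simp [l2]
  by_cases h : d.m1 c d.del1 = 0
  · refine ⟨1, 3, by decide, ?_⟩
    have h3 : d.m3 c d.del1 ≠ 0 := fun h3 => hd.d1 (lin2 hd.i13 h h3).2
    simp [mat, nodeC]
    positivity
  · refine ⟨0, 1, by decide, ?_⟩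
    simp [mat, nodeC]
    positivity

end real
end Par


namespace Par

section assemble
variable (d : Par ℤ) (U V : Fin 4 → ℤ)

/-- base points of the nodes, as real vectors -/
def nP : Fin 5 → Fin 4 → ℝ := fun k i => ((d.bP U V k i : ℤ) : ℝ)
/-- directions of the nodes, as real vectors -/
def nD : Fin 5 → Fin 4 → ℝ := fun k i => ((bD U V k i : ℤ) : ℝ)

lemma nd_cast (k : Fin 4) (c : ℂ) : nd (d.nP U V) (nD U V) k.castSucc c =
    d.co.node (Int.castRingHom ℂ (U k)) (Int.castRingHom ℂ (V k)) c := by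
  have e1 := map_dl (Int.castRingHom ℂ) d (U k) (V k)
  have e2 := map_nA (Int.castRingHom ℂ) d (U k) (V k)
  have e3 := map_nB (Int.castRingHom ℂ) d (U k) (V k)
  ext i
  simp only [nd, nP, nD, bP, bD, Fin.snoc_castSucc, node, e1, e2, e3]
  fin_cases i <;> simp

lemma nd_last (c : ℂ) : nd (d.nP U V) (nD U V) (Fin.last 4) c = d.co.nodeC c := by
  have e1 := map_del1 (Int.castRingHom ℂ) d
  ext i
  simp only [nd, nP, nD, bP, bD, Fin.snoc_last, nodeC, e1]
  fin_cases i <;> simp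

lemma re_cast (k : Fin 4) (c : ℝ) : d.nP U V k.castSucc + c • nD U V k.castSucc =
    d.re.node (Int.castRingHom ℝ (U k)) (Int.castRingHom ℝ (V k)) c := by
  have e1 := map_dl (Int.castRingHom ℝ) d (U k) (V k)
  have e2 := map_nA (Int.castRingHom ℝ) d (U k) (V k)
  have e3 := map_nB (Int.castRingHom ℝ) d (U k) (V k)
  ext i
  simp only [nP, nD, bP, bD, Fin.snoc_castSucc, node, e1, e2, e3, Pi.add_apply, Pi.smul_apply]
  fin_cases i <;> simp

lemma re_last (c : ℝ) : d.nP U V (Fin.last 4) + c • nD U V (Fin.last 4) = d.re.nodeC c := by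
  have e1 := map_del1 (Int.castRingHom ℝ) d
  ext i
  simp only [nP, nD, bP, bD, Fin.snoc_last, nodeC, e1, Pi.add_apply, Pi.smul_apply]
  fin_cases i <;> simp

lemma base_mat (d : Par ℂ) (v : Fin 4 → ℂ)
    (h : ∀ l, v ⬝ᵥ (d.mat (Pi.single l 1) *ᵥ v) = 0) :
    (v 0 ^ 2 + d.p * v 1 ^ 2 + d.r * v 2 ^ 2 = 0) ∧
    (v 3 ^ 2 + d.q * v 1 ^ 2 + d.s * v 2 ^ 2 = 0) ∧
    (d.a1 * v 0 * v 1 + d.a2 * v 0 * v 2 + d.a3 * v 3 * v 1 + d.a4 * v 3 * v 2 = 0) ∧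
    (d.b1 * v 0 * v 1 + d.b2 * v 0 * v 2 + d.b3 * v 3 * v 1 + d.b4 * v 3 * v 2 = 0) := by
  have h0 := h 0
  have h1 := h 1
  have h2 := h 2
  have h3 := h 3
  simp [mat, Matrix.mulVec, dotProduct, Fin.sum_univ_four, m1, m2, m3, m4, l1, l2] at h0 h1 h2 h3
  refine ⟨?_, ?_, ?_, ?_⟩
  · linear_combination h0
  · linear_combination h1
  · linear_combination h2 / 2
  · linear_combination h3 / 2

lemma mat_symm (d : Par ℂ) (x : Fin 4 → ℂ) : (d.mat x).IsSymm := by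
  ext i j
  fin_cases i <;> fin_cases j <;> simp [mat]

lemma cof_zero (d : Par ℂ) (hb : ∀ v : Fin 4 → ℂ,
    (∀ l, v ⬝ᵥ (d.mat (Pi.single l 1) *ᵥ v) = 0) → v = 0) (x : Fin 4 → ℂ) (hg : d.g x = 0) :
    d.cof x = 0 := by
  have hdet : (d.mat x).det = 0 := by
    have := d.euler_f x
    rw [hg] at this
    rw [det_mat]
    simpa using this.symm
  have h := adj_zero (d.mat x) (d.mat_symm x) (fun l => d.mat (Pi.single l 1)) hdet
    (fun l => by rw [trace_adj, hg]; rfl) hb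
  rw [adj_eq] at h
  have e := fun i j => congrFun (congrFun h i) j
  have e00 := e 0 0
  have e01 := e 0 1
  have e02 := e 0 2
  have e03 := e 0 3
  have e11 := e 1 1
  have e12 := e 1 2
  have e13 := e 1 3
  have e22 := e 2 2
  have e23 := e 2 3
  have e33 := e 3 3
  simp at e00 e01 e02 e03 e11 e12 e13 e22 e23 e33
  ext i
  fin_cases i <;> simpa

variable {d U V}

lemma Good.nodeData {X0 X1 : ℤ} (hG : d.Good U V X0 X1) (K : ℂ) (hK : K ≠ 0)
    (hF : ∀ u v : ℂ, d.co.quar u v = K * ((V 0 * u - U 0 * v) * (V 1 * u - U 1 * v) *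
      (V 2 * u - U 2 * v) * (V 3 * u - U 3 * v)))
    (hb : ∀ v : Fin 4 → ℂ, (∀ l, v ⬝ᵥ (d.co.mat (Pi.single l 1) *ᵥ v) = 0) → v = 0) :
    NodeData d.re.Q (d.nP U V) (nD U V) (fun k => (d.rad U V k : ℝ)) (d.setS U V)
      (d.setT U V) := by
  have ic : Function.Injective (Int.castRingHom ℂ) := Int.cast_injective
  have ir : Function.Injective (Int.castRingHom ℝ) := Int.cast_injective
  have gC := hG.gen.map (Int.castRingHom ℂ) ic
  have gR := hG.gen.map (Int.castRingHom ℝ) ir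
  have nC := fun k => (hG.n k).map (Int.castRingHom ℂ) ic
  have nR := fun k => (hG.n k).map (Int.castRingHom ℝ) ir
  have der := fun x => d.re.derivs x
  rw [re_toC] at der
  have rcast : ∀ k : Fin 4, ((d.rad U V k.castSucc : ℝ) : ℂ) =
      d.co.nr (Int.castRingHom ℂ (U k)) (Int.castRingHom ℂ (V k)) := by
    intro k; rw [map_nr]; simp [rad]
  have rlast : ((d.rad U V (Fin.last 4) : ℝ) : ℂ) = - (d.co.del1 * d.co.del2) := by
    rw [map_del1, map_del2]; simp only [rad, Fin.snoc_last]; simp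
  have rcastR : ∀ k : Fin 4, (d.rad U V k.castSucc : ℝ) =
      d.re.nr (Int.castRingHom ℝ (U k)) (Int.castRingHom ℝ (V k)) := by
    intro k; rw [map_nr]; simp [rad]
  have pdE : (d.re.mat ![(X0 : ℝ), (X1 : ℝ), 0, 0]).PosDef := by
    apply pd_diag
    · exact_mod_cast hG.x0
    · exact_mod_cast hG.x1
    · have := map_l1 (Int.castRingHom ℝ) d X0 X1
      simp only [Int.coe_castRingHom] at this
      change 0 < (d.map (Int.castRingHom ℝ)).l1 (X0 : ℝ) (X1 : ℝ)
      simp only [Int.coe_castRingHom]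
      rw [this]
      exact_mod_cast hG.y0
    · have := map_l2 (Int.castRingHom ℝ) d X0 X1
      simp only [Int.coe_castRingHom] at this
      change 0 < (d.map (Int.castRingHom ℝ)).l2 (X0 : ℝ) (X1 : ℝ)
      simp only [Int.coe_castRingHom]
      rw [this]
      exact_mod_cast hG.y1
  have sgn : ∀ k : Fin 4, (0 < d.bs U V k.castSucc ↔
      0 < d.re.nA (Int.castRingHom ℝ (U k)) (Int.castRingHom ℝ (V k)) *
        d.re.nB (Int.castRingHom ℝ (U k)) (Int.castRingHom ℝ (V k))) := by
    intro k
    rw [map_nA, map_nB]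
    simp only [bs, Fin.snoc_castSucc, Int.coe_castRingHom]
    exact_mod_cast Iff.rfl
  have rne : ∀ k, d.rad U V k ≠ 0 := by
    intro k
    induction k using Fin.lastCases with
    | last => simp only [rad, Fin.snoc_last]; simp [hG.gen.d1, hG.gen.d2]
    | cast k =>
      have := hG.n k
      simp [rad, nr, this.dl, this.m2, this.m4, this.nL]
  have ndne : ∀ (k : Fin 4) (c : ℂ),
      d.co.node (Int.castRingHom ℂ (U k)) (Int.castRingHom ℂ (V k)) c 0 ≠ 0 := by
    intro k c
    have := nC k
    have h1 := this.dl
    have h2 := this.m1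
    have h3 := this.m2
    exact mul_ne_zero h1 (mul_ne_zero h2 h3)
  have ndCne : ∀ (c : ℂ), d.co.nodeC c 3 ≠ 0 := by
    intro c
    exact gC.d1
  constructor
  case sing =>
    intro x hx hg
    have hg' := (der x).1.mp hg
    have hc := cof_zero d.co hb x hg'
    rcases sing_alg d.co gC (fun k => Int.castRingHom ℂ (U k)) (fun k => Int.castRingHom ℂ (V k))
      nC K hK hF x hx hc with ⟨k, c, a, h1, h2⟩ | ⟨c, a, h1, h2⟩
    · refine ⟨k.castSucc, c, a, ?_, ?_⟩
      · rw [h1, rcast]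
      · rw [h2, nd_cast]
    · refine ⟨Fin.last 4, c, a, ?_, ?_⟩
      · rw [h1, rlast]
      · rw [h2, nd_last]
  case scaleg =>
    intro a x h
    rw [(der _).1] at h ⊢
    rw [g_smul, h, smul_zero]
  case scale =>
    intro a x
    rw [(der _).2, (der _).2, h_smul]
  case grad =>
    intro k c hc
    rw [(der _).1]
    induction k using Fin.lastCases with
    | last => rw [nd_last]; rw [rlast] at hc; exact g_nodeC _ gC.rel hc
    | cast k => rw [nd_cast]; rw [rcast] at hc; exact g_node _ (nC k) hc
  case rank =>
    intro k c hc
    rw [(der _).2]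
    induction k using Fin.lastCases with
    | last =>
      rw [nd_last]; rw [rlast] at hc
      refine rank_eq_three _ (d.co.nodeC c) (fun h => ndCne c (congrFun h 3)) ?_ ![0, 1, 2] ?_
      · rw [euler_h, g_nodeC _ gC.rel hc, smul_zero]
      · rw [det_nodeC _ gC.rel hc, hc]
        have h1 := gC.d1
        have h2 := gC.d2
        refine mul_ne_zero (mul_ne_zero (mul_ne_zero (by norm_num) (pow_ne_zero 2 h1))
          (neg_ne_zero.mpr (mul_ne_zero h1 h2))) ?_
        intro h0
        have hm := hG.minorC
        apply hm
        apply ic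
        have e : (-(d.co.del1 * d.co.del2)) = Int.castRingHom ℂ (-(d.del1 * d.del2)) := by
          rw [map_del1, map_del2]; simp
        rw [e] at h0 hc
        rw [map_del1, map_alC, map_beC] at h0
        rw [map_sub, map_mul, map_pow, map_pow, ← hc, map_zero]
        linear_combination (Int.castRingHom ℂ (d.alC d.del1 (-(d.del1 * d.del2))) -
          Int.castRingHom ℂ (d.beC d.del1 (-(d.del1 * d.del2))) * c) * h0
    | cast k =>
      rw [nd_cast]; rw [rcast] at hc
      refine rank_eq_three _ _ (fun h => ndne k c (congrFun h 0)) ?_ ![0, 1, 2] ?_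
      · rw [euler_h, g_node _ (nC k) hc, smul_zero]
      · rw [det_node _ hc, map_dl, map_nA, map_nB, map_nL, map_nM, map_m1, map_m2, map_m3, map_m4,
          map_nmin]
        exact (map_ne_zero_iff _ ic).mpr (hG.minor k)
  case inj =>
    intro k k' c c' a hc hc' h
    induction k using Fin.lastCases with
    | last =>
      induction k' using Fin.lastCases with
      | last =>
        refine ⟨rfl, ?_⟩
        rw [nd_last, nd_last] at h
        have h3 := congrFun h 3
        have h2 := congrFun h 2
        simp [nodeC] at h2 h3
        have h1 : d.co.del1 ≠ 0 := gC.d1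
        have ha : a = 1 := by
          apply mul_right_cancel₀ h1
          linear_combination - h3
        rw [h2, ha, one_mul]
      | cast k' =>
        exfalso
        rw [nd_last, nd_cast] at h
        have h0 := congrFun h 0
        have h3 := congrFun h 3
        have ha : a = 0 := by
          have : a * d.co.node (Int.castRingHom ℂ (U k')) (Int.castRingHom ℂ (V k')) c' 0 = 0 := by
            rw [Pi.smul_apply, smul_eq_mul] at h0
            rw [← h0]; simp [nodeC]
          exact (mul_eq_zero.mp this).resolve_right (ndne k' c')
        rw [ha, zero_smul] at h3
        exact ndCne c h3
    | cast k =>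
      induction k' using Fin.lastCases with
      | last =>
        exfalso
        rw [nd_last, nd_cast] at h
        have h0 := congrFun h 0
        apply ndne k c
        rw [h0]; simp [nodeC]
      | cast k' =>
        have hcne : c ≠ 0 := by
          rintro rfl
          apply rne k.castSucc
          have : ((d.rad U V k.castSucc : ℝ) : ℂ) = 0 := by rw [← hc]; simp
          exact_mod_cast this
        rw [nd_cast, nd_cast] at h
        have h2 := congrFun h 2
        have h3 := congrFun h 3
        have h0 := congrFun h 0
        have kk : k = k' := by
          by_contra hne
          apply hG.cross k k' hne
          apply ic
          simp [node] at h2 h3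
          rw [map_zero]
          apply mul_left_cancel₀ hcne
          simp only [map_sub, map_mul, Int.coe_castRingHom, mul_zero]
          linear_combination (V k' : ℂ) * h2 - (U k' : ℂ) * h3
        subst kk
        refine ⟨rfl, ?_⟩
        have hn0 := ndne k c
        have e0 : d.co.node (Int.castRingHom ℂ (U k)) (Int.castRingHom ℂ (V k)) c 0 =
          d.co.node (Int.castRingHom ℂ (U k)) (Int.castRingHom ℂ (V k)) c' 0 := rfl
        rw [Pi.smul_apply, smul_eq_mul, ← e0] at h0
        have ha : a = 1 := by
          apply mul_right_cancel₀ hn0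
          linear_combination - h0
        rw [ha] at h2 h3
        simp [node] at h2 h3
        rcases h2 with h2 | h2
        · exact h2
        · rcases h3 with h3 | h3
          · exact h3
          · exfalso
            apply (hG.n k).m1
            simp [m1, h2, h3]
  case rne =>
    intro k
    exact_mod_cast rne k
  case pos =>
    intro k
    simp only [setS, setT, Finset.mem_union, Finset.mem_filter, Finset.mem_univ, true_and,
      Int.cast_pos]
    tauto
  case disj =>
    rw [Finset.disjoint_left]
    intro k h1 h2
    simp only [setS, setT, Finset.mem_filter, Finset.mem_univ, true_and] at h1 h2
    exact h2.2 h1.2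
  case inS =>
    intro k hk c hc h
    simp only [setS, Finset.mem_filter, Finset.mem_univ, true_and] at hk
    induction k using Fin.lastCases with
    | last =>
      exfalso
      have := hk.2
      simp only [bs, Fin.snoc_last] at this
      omega
    | cast k =>
      refine mem_closure_of_psd _ ![(X0 : ℝ), (X1 : ℝ), 0, 0] _ (by rw [Qr_Q]; exact pdE) h ?_
      rw [Qr_Q, re_cast]
      rw [rcastR] at hc
      exact psd_node _ (nR k) hc ((sgn k).mp hk.2)
  case inT =>
    intro k hk c hc h
    simp only [setT, Finset.mem_filter, Finset.mem_univ, true_and] at hk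
    induction k using Fin.lastCases with
    | last =>
      obtain ⟨i, j, hij, hl⟩ := neg_nodeC d.re gR c
      refine not_mem_closure _ _ _ i j hij ?_
      rw [Qr_Q, re_last]
      exact hl
    | cast k =>
      refine not_mem_closure _ _ _ 0 3 (by decide) ?_
      rw [Qr_Q, re_cast]
      exact neg_node _ (nR k) (fun hh => hk.2 ((sgn k).mpr hh))

end assemble
end Par


/-- The conclusion of the main theorem. -/
def Target (m n : ℕ) : Prop :=
    ∃ Q : Fin 4 → Matrix (Fin 4) (Fin 4) ℝ,
      (∀ i, (Q i).IsSymm) ∧ Transversal Q ∧ (spectra Q).Nonempty ∧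
      (realNodes Q).ncard = m + n ∧
      (realNodes Q ∩ closure (spectra Q)).ncard = m ∧
      (realNodes Q \ closure (spectra Q)).ncard = n

namespace Par

/-- The decidable form of the conditions. -/
abbrev chk (d : Par ℤ) (U V : Fin 4 → ℤ) (X0 X1 : ℤ) : Prop :=
  (d.a1 * d.b4 + d.b1 * d.a4 = d.a2 * d.b3 + d.b2 * d.a3 ∧ d.del1 ≠ 0 ∧ d.del2 ≠ 0 ∧
    d.a1 * d.b3 - d.a3 * d.b1 ≠ 0 ∧ d.a1 * d.b4 - d.a4 * d.b1 ≠ 0 ∧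
    d.a2 * d.b3 - d.a3 * d.b2 ≠ 0 ∧ d.a2 * d.b4 - d.a4 * d.b2 ≠ 0 ∧
    d.p ≠ 0 ∧ d.q ≠ 0 ∧ d.r ≠ 0 ∧ d.s ≠ 0 ∧ d.p * d.s - d.q * d.r ≠ 0) ∧
  (∀ k, d.quar (U k) (V k) = 0 ∧ d.m1 (U k) (V k) ≠ 0 ∧ d.m2 (U k) (V k) ≠ 0 ∧
    d.m3 (U k) (V k) ≠ 0 ∧ d.m4 (U k) (V k) ≠ 0 ∧ d.nL (U k) (V k) ≠ 0 ∧ d.dl (U k) (V k) ≠ 0) ∧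
  (∀ k k', k ≠ k' → U k * V k' - V k * U k' ≠ 0) ∧
  (∀ k, d.nmin (d.dl (U k) (V k)) (d.nA (U k) (V k)) (d.nB (U k) (V k)) (d.nL (U k) (V k))
    (d.nM (U k) (V k)) (d.m1 (U k) (V k)) (d.m2 (U k) (V k)) (d.m3 (U k) (V k))
    (d.m4 (U k) (V k)) ≠ 0) ∧
  (d.alC d.del1 (- (d.del1 * d.del2)) ^ 2 -
    d.beC d.del1 (- (d.del1 * d.del2)) ^ 2 * (- (d.del1 * d.del2)) ≠ 0) ∧
  0 < X0 ∧ 0 < X1 ∧ 0 < d.l1 X0 X1 ∧ 0 < d.l2 X0 X1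

lemma Good.of_chk {d : Par ℤ} {U V : Fin 4 → ℤ} {X0 X1 : ℤ} (h : d.chk U V X0 X1) :
    d.Good U V X0 X1 := by
  obtain ⟨⟨a1, a2, a3, a4, a5, a6, a7, a8, a9, a10, a11, a12⟩, hn, h1, h2, h3, h4, h5, h6, h7⟩ := h
  exact ⟨⟨a1, a2, a3, a4, a5, a6, a7, a8, a9, a10, a11, a12⟩,
    fun k => ⟨(hn k).1, (hn k).2.1, (hn k).2.2.1, (hn k).2.2.2.1, (hn k).2.2.2.2.1,
      (hn k).2.2.2.2.2.1, (hn k).2.2.2.2.2.2⟩, h1, h2, h3, h4, h5, h6, h7⟩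

lemma Good.pd {d : Par ℤ} {U V : Fin 4 → ℤ} {X0 X1 : ℤ} (hG : d.Good U V X0 X1) :
    (Qr d.re.Q ![(X0 : ℝ), (X1 : ℝ), 0, 0]).PosDef := by
  rw [Qr_Q]
  apply pd_diag
  · exact_mod_cast hG.x0
  · exact_mod_cast hG.x1
  · have := map_l1 (Int.castRingHom ℝ) d X0 X1
    simp only [Int.coe_castRingHom] at this
    change 0 < (d.map (Int.castRingHom ℝ)).l1 (X0 : ℝ) (X1 : ℝ)
    simp only [Int.coe_castRingHom]
    rw [this]
    exact_mod_cast hG.y0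
  · have := map_l2 (Int.castRingHom ℝ) d X0 X1
    simp only [Int.coe_castRingHom] at this
    change 0 < (d.map (Int.castRingHom ℝ)).l2 (X0 : ℝ) (X1 : ℝ)
    simp only [Int.coe_castRingHom]
    rw [this]
    exact_mod_cast hG.y1

lemma Good.target {d : Par ℤ} {U V : Fin 4 → ℤ} {X0 X1 : ℤ} (hG : d.Good U V X0 X1)
    (K : ℂ) (hK : K ≠ 0)
    (hF : ∀ u v : ℂ, d.co.quar u v = K * ((V 0 * u - U 0 * v) * (V 1 * u - U 1 * v) *
      (V 2 * u - U 2 * v) * (V 3 * u - U 3 * v)))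
    (S0 S1 S2 S3 T0 T1 R : ℂ) (hR : R ≠ 0)
    (hB : ∀ w1 w2 : ℂ,
      (S0 * w2 ^ 3 + S1 * w1 * w2 ^ 2 + S2 * w1 ^ 2 * w2 + S3 * w1 ^ 3) *
        ((d.co.a1 * w1 + d.co.a2 * w2) * (d.co.b3 * w1 + d.co.b4 * w2)
          - (d.co.a3 * w1 + d.co.a4 * w2) * (d.co.b1 * w1 + d.co.b2 * w2)) +
      (T0 * w2 + T1 * w1) * ((d.co.p * w1 ^ 2 + d.co.r * w2 ^ 2) *
        (d.co.a1 * w1 + d.co.a2 * w2) ^ 2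
        - (d.co.q * w1 ^ 2 + d.co.s * w2 ^ 2) * (d.co.a3 * w1 + d.co.a4 * w2) ^ 2) = R * w2 ^ 5)
    {m n : ℕ} (hm : 2 * (d.setS U V).card = m) (hn : 2 * (d.setT U V).card = n) :
    Target m n := by
  have gC := hG.gen.map (Int.castRingHom ℂ) Int.cast_injective
  refine (hG.nodeData K hK hF ?_).final d.re.Q_symm ![(X0 : ℝ), (X1 : ℝ), 0, 0] hG.pd ?_ m n hm hn
  · intro v hv
    obtain ⟨h0, h1, h2, h3⟩ := base_mat d.co v hv
    exact base d.co gC.ps S0 S1 S2 S3 T0 T1 R hR gC.i13 gC.p0 hB v h0 h1 h2 h3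
  · intro h
    have := congrFun h 0
    simp at this
    have h0 := hG.x0
    omega

end Par

lemma case_0_1 : Target 0 2 := by
  refine Par.Good.target (d := ⟨9, -5, -2, 18, 3, 3, -1, 0, 2, 0, 2, 2⟩)
    (U := ![-2, -1, -4, 2]) (V := ![1, 1, 1, 3]) (X0 := 1) (X1 := 1)
    (Par.Good.of_chk (by decide +kernel)) (18) (by norm_num) (fun u v => ?_) (-477) (-3462) 7152 6536
    (-432) (-608) 4914 (by norm_num) (fun u v => ?_) (by decide +kernel) (by decide +kernel)
  · simp [Par.co, Par.map, Par.quar, Par.nL, Par.nM, Par.nA, Par.nB, Par.l1, Par.l2, Par.m1,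
      Par.m2, Par.m3, Par.m4]
    ring
  · simp [Par.co, Par.map]
    ring

lemma case_0_2 : Target 0 4 := by
  refine Par.Good.target (d := ⟨-240, 110, 132, -1, -1, 1, 3, 2, 3, 3, -2, -1⟩)
    (U := ![0, -2, -1, -7]) (V := ![1, 1, 1, 6]) (X0 := 1) (X1 := 3)
    (Par.Good.of_chk (by decide +kernel)) (-77) (by norm_num) (fun u v => ?_) 43130955 (-226382156) (-40986750) (-548191320)
    5233615 3119788 409854955 (by norm_num) (fun u v => ?_) (by decide +kernel) (by decide +kernel)
  · simp [Par.co, Par.map, Par.quar, Par.nL, Par.nM, Par.nA, Par.nB, Par.l1, Par.l2, Par.m1,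
      Par.m2, Par.m3, Par.m4]
    ring
  · simp [Par.co, Par.map]
    ring

lemma case_0_3 : Target 0 6 := by
  refine Par.Good.target (d := ⟨54, 15, 39, 152, -2, -2, -1, -2, 3, 0, 2, -1⟩)
    (U := ![1, -3, -1, 19]) (V := ![1, 1, 1, 14]) (X0 := 1) (X1 := 1)
    (Par.Good.of_chk (by decide +kernel)) (32) (by norm_num) (fun u v => ?_) (-69332) 14242 82182 58089
    (-1282) 289 440800 (by norm_num) (fun u v => ?_) (by decide +kernel) (by decide +kernel)
  · simp [Par.co, Par.map, Par.quar, Par.nL, Par.nM, Par.nA, Par.nB, Par.l1, Par.l2, Par.m1,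
      Par.m2, Par.m3, Par.m4]
    ring
  · simp [Par.co, Par.map]
    ring

lemma case_0_4 : Target 0 8 := by
  refine Par.Good.target (d := ⟨112, 11, 91, 48, 2, 1, 3, 2, 3, -1, 3, -3⟩)
    (U := ![-3, 3, -2, -1]) (V := ![1, 1, 1, 8]) (X0 := 1) (X1 := 1)
    (Par.Good.of_chk (by decide +kernel)) (-40) (by norm_num) (fun u v => ?_) 94523 11589 (-95523) (-141345)
    (-2151) (-1215) 122728 (by norm_num) (fun u v => ?_) (by decide +kernel) (by decide +kernel)
  · simp [Par.co, Par.map, Par.quar, Par.nL, Par.nM, Par.nA, Par.nB, Par.l1, Par.l2, Par.m1,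
      Par.m2, Par.m3, Par.m4]
    ring
  · simp [Par.co, Par.map]
    ring

lemma case_0_5 : Target 0 10 := by
  refine Par.Good.target (d := ⟨-3, 54, 10, -15, 2, 3, 2, 1, -1, -2, 1, 0⟩)
    (U := ![-4, 1, -1, 5]) (V := ![1, 1, 1, 18]) (X0 := 2) (X1 := 1)
    (Par.Good.of_chk (by decide +kernel)) (-1) (by norm_num) (fun u v => ?_) (-231343) (-68108) 205932 286368
    8108 5024 388654 (by norm_num) (fun u v => ?_) (by decide +kernel) (by decide +kernel)
  · simp [Par.co, Par.map, Par.quar, Par.nL, Par.nM, Par.nA, Par.nB, Par.l1, Par.l2, Par.m1,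
      Par.m2, Par.m3, Par.m4]
    ring
  · simp [Par.co, Par.map]
    ring

lemma case_1_0 : Target 2 0 := by
  refine Par.Good.target (d := ⟨6, -7, 21, -22, 2, 3, -2, 3, -2, 2, -2, -2⟩)
    (U := ![3, 0, 2, -4]) (V := ![1, 1, 1, 3]) (X0 := 2) (X1 := 1)
    (Par.Good.of_chk (by decide +kernel)) (-10) (by norm_num) (fun u v => ?_) 9893 (-1408) 2492 (-208)
    376 (-32) 26796 (by norm_num) (fun u v => ?_) (by decide +kernel) (by decide +kernel)
  · simp [Par.co, Par.map, Par.quar, Par.nL, Par.nM, Par.nA, Par.nB, Par.l1, Par.l2, Par.m1,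
      Par.m2, Par.m3, Par.m4]
    ring
  · simp [Par.co, Par.map]
    ring

lemma case_1_1 : Target 2 2 := by
  refine Par.Good.target (d := ⟨8, 9, -5, 5, 0, 1, 1, -1, 3, -3, 0, -1⟩)
    (U := ![4, -3, -2, 1]) (V := ![1, 1, 1, 1]) (X0 := 1) (X1 := 2)
    (Par.Good.of_chk (by decide +kernel)) (-9) (by norm_num) (fun u v => ?_) (-164) (-66) (-117) 99
    39 (-33) 266 (by norm_num) (fun u v => ?_) (by decide +kernel) (by decide +kernel)
  · simp [Par.co, Par.map, Par.quar, Par.nL, Par.nM, Par.nA, Par.nB, Par.l1, Par.l2, Par.m1,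
      Par.m2, Par.m3, Par.m4]
    ring
  · simp [Par.co, Par.map]
    ring

lemma case_1_2 : Target 2 4 := by
  refine Par.Good.target (d := ⟨16, 60, 22, -15, -1, -2, 0, 1, 1, 3, -2, -3⟩)
    (U := ![4, -3, 2, 13]) (V := ![1, 1, 1, 8]) (X0 := 1) (X1 := 1)
    (Par.Good.of_chk (by decide +kernel)) (-8) (by norm_num) (fun u v => ?_) (-5210) 587 (-2544) (-808)
    217 101 6721 (by norm_num) (fun u v => ?_) (by decide +kernel) (by decide +kernel)
  · simp [Par.co, Par.map, Par.quar, Par.nL, Par.nM, Par.nA, Par.nB, Par.l1, Par.l2, Par.m1,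
      Par.m2, Par.m3, Par.m4]
    ring
  · simp [Par.co, Par.map]
    ring

lemma case_1_3 : Target 2 6 := by
  refine Par.Good.target (d := ⟨-15, 3, 35, 1, -1, 2, 1, -1, -1, 0, 2, -3⟩)
    (U := ![1, 2, 3, -2]) (V := ![1, 1, 1, 3]) (X0 := 1) (X1 := 6)
    (Par.Good.of_chk (by decide +kernel)) (1) (by norm_num) (fun u v => ?_) 8935 (-2142) (-3618) 1512
    397 (-84) 1573 (by norm_num) (fun u v => ?_) (by decide +kernel) (by decide +kernel)
  · simp [Par.co, Par.map, Par.quar, Par.nL, Par.nM, Par.nA, Par.nB, Par.l1, Par.l2, Par.m1,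
      Par.m2, Par.m3, Par.m4]
    ring
  · simp [Par.co, Par.map]
    ring

lemma case_1_4 : Target 2 8 := by
  refine Par.Good.target (d := ⟨9, -5, 25, 11, 2, 0, 3, -1, 3, 1, 3, 3⟩)
    (U := ![0, -2, 1, -12]) (V := ![1, 1, 1, 11]) (X0 := 1) (X1 := 1)
    (Par.Good.of_chk (by decide +kernel)) (18) (by norm_num) (fun u v => ?_) 583 132 (-321) 648
    (-51) 24 1144 (by norm_num) (fun u v => ?_) (by decide +kernel) (by decide +kernel)
  · simp [Par.co, Par.map, Par.quar, Par.nL, Par.nM, Par.nA, Par.nB, Par.l1, Par.l2, Par.m1,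
      Par.m2, Par.m3, Par.m4]
    ring
  · simp [Par.co, Par.map]
    ring

lemma case_2_1 : Target 4 2 := by
  refine Par.Good.target (d := ⟨2, 7, 10, 5, 2, 2, 1, -1, 1, -1, -2, -2⟩)
    (U := ![3, 1, 0, -1]) (V := ![1, 1, 1, 1]) (X0 := 1) (X1 := 1)
    (Par.Good.of_chk (by decide +kernel)) (60) (by norm_num) (fun u v => ?_) (-4815) (-1469) (-2325) (-79)
    (-249) (-395) 15360 (by norm_num) (fun u v => ?_) (by decide +kernel) (by decide +kernel)
  · simp [Par.co, Par.map, Par.quar, Par.nL, Par.nM, Par.nA, Par.nB, Par.l1, Par.l2, Par.m1,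
      Par.m2, Par.m3, Par.m4]
    ring
  · simp [Par.co, Par.map]
    ring

lemma case_2_2 : Target 4 4 := by
  refine Par.Good.target (d := ⟨35, -8, -1, 1, 1, 0, -1, 1, -2, 1, 3, 1⟩)
    (U := ![-4, 1, -2, 5]) (V := ![1, 1, 1, 1]) (X0 := 1) (X1 := 2)
    (Par.Good.of_chk (by decide +kernel)) (-1) (by norm_num) (fun u v => ?_) 1026 1571 (-1984) 14577
    (-1436) (-339) 410 (by norm_num) (fun u v => ?_) (by decide +kernel) (by decide +kernel)
  · simp [Par.co, Par.map, Par.quar, Par.nL, Par.nM, Par.nA, Par.nB, Par.l1, Par.l2, Par.m1,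
      Par.m2, Par.m3, Par.m4]
    ring
  · simp [Par.co, Par.map]
    ring

lemma case_2_3 : Target 4 6 := by
  refine Par.Good.target (d := ⟨2, 5, 4, 21, 1, -1, 0, -2, -2, 3, -2, -2⟩)
    (U := ![1, -4, -3, 5]) (V := ![1, 1, 1, 1]) (X0 := 1) (X1 := 1)
    (Par.Good.of_chk (by decide +kernel)) (-4) (by norm_num) (fun u v => ?_) 70 1 8 (-3)
    (-4) (-3) 880 (by norm_num) (fun u v => ?_) (by decide +kernel) (by decide +kernel)
  · simp [Par.co, Par.map, Par.quar, Par.nL, Par.nM, Par.nA, Par.nB, Par.l1, Par.l2, Par.m1,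
      Par.m2, Par.m3, Par.m4]
    ring
  · simp [Par.co, Par.map]
    ring

lemma case_3_0 : Target 6 0 := by
  refine Par.Good.target (d := ⟨-6, 7, -21, 22, 2, 3, -2, 3, -2, 2, -2, -2⟩)
    (U := ![3, 0, 2, -4]) (V := ![1, 1, 1, 3]) (X0 := 1) (X1 := 1)
    (Par.Good.of_chk (by decide +kernel)) (10) (by norm_num) (fun u v => ?_) 9893 (-1408) 2492 (-208)
    (-376) 32 26796 (by norm_num) (fun u v => ?_) (by decide +kernel) (by decide +kernel)
  · simp [Par.co, Par.map, Par.quar, Par.nL, Par.nM, Par.nA, Par.nB, Par.l1, Par.l2, Par.m1,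
      Par.m2, Par.m3, Par.m4]
    ring
  · simp [Par.co, Par.map]
    ring

lemma case_3_1 : Target 6 2 := by
  refine Par.Good.target (d := ⟨4, -1, 7, 5, 0, -1, 1, -1, -1, -1, -2, 3⟩)
    (U := ![-4, 1, 4, 5]) (V := ![1, 1, 1, 1]) (X0 := 1) (X1 := 1)
    (Par.Good.of_chk (by decide +kernel)) (-1) (by norm_num) (fun u v => ?_) (-42) 8 1 (-3)
    11 3 190 (by norm_num) (fun u v => ?_) (by decide +kernel) (by decide +kernel)
  · simp [Par.co, Par.map, Par.quar, Par.nL, Par.nM, Par.nA, Par.nB, Par.l1, Par.l2, Par.m1,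
      Par.m2, Par.m3, Par.m4]
    ring
  · simp [Par.co, Par.map]
    ring

lemma case_3_2 : Target 6 4 := by
  refine Par.Good.target (d := ⟨-3, 15, 5, 7, -1, 3, -2, 0, -1, -1, -1, 1⟩)
    (U := ![-2, 2, 0, -1]) (V := ![1, 1, 1, 3]) (X0 := 1) (X1 := 1)
    (Par.Good.of_chk (by decide +kernel)) (-10) (by norm_num) (fun u v => ?_) (-2843) (-3006) (-603) (-3402)
    349 54 7176 (by norm_num) (fun u v => ?_) (by decide +kernel) (by decide +kernel)
  · simp [Par.co, Par.map, Par.quar, Par.nL, Par.nM, Par.nA, Par.nB, Par.l1, Par.l2, Par.m1,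
      Par.m2, Par.m3, Par.m4]
    ring
  · simp [Par.co, Par.map]
    ring

lemma case_4_1 : Target 8 2 := by
  refine Par.Good.target (d := ⟨4, -1, -5, 35, -1, 3, 1, 2, 1, 1, 0, 1⟩)
    (U := ![-1, 2, -2, -1]) (V := ![1, 1, 1, 5]) (X0 := 1) (X1 := 1)
    (Par.Good.of_chk (by decide +kernel)) (-1) (by norm_num) (fun u v => ?_) 12480 (-485) 1630 (-405)
    (-322) (-81) 72050 (by norm_num) (fun u v => ?_) (by decide +kernel) (by decide +kernel)
  · simp [Par.co, Par.map, Par.quar, Par.nL, Par.nM, Par.nA, Par.nB, Par.l1, Par.l2, Par.m1,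
      Par.m2, Par.m3, Par.m4]
    ring
  · simp [Par.co, Par.map]
    ring


/-! ### The second family -/

/-- Parameters of the second family. -/
structure Sec (R : Type) where
  (al be ga la : Fin 3 → R)

namespace Sec

/-- Change of coefficients. -/
def map {R S : Type} (φ : R → S) (d : Sec R) : Sec S :=
  ⟨fun i => φ (d.al i), fun i => φ (d.be i), fun i => φ (d.ga i), fun i => φ (d.la i)⟩

section defs
variable {R : Type} [CommRing R] (d : Sec R)

/-- linear form -/
def a (w : Fin 3 → R) : R := d.al 0 * w 0 + d.al 1 * w 1 + d.al 2 * w 2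
/-- linear form -/
def b (w : Fin 3 → R) : R := d.be 0 * w 0 + d.be 1 * w 1 + d.be 2 * w 2
/-- linear form -/
def c (w : Fin 3 → R) : R := d.ga 0 * w 0 + d.ga 1 * w 1 + d.ga 2 * w 2
/-- twisted vector -/
def tw (w : Fin 3 → R) : Fin 3 → R := fun i => d.la i * w i
/-- first quadratic form -/
def G (w : Fin 3 → R) : R := d.a w * d.c w - d.b w ^ 2
/-- second quadratic form -/
def G' (w : Fin 3 → R) : R := d.G (d.tw w)
/-- mixed quadratic form -/
def H (w : Fin 3 → R) : R :=
  d.a w * d.c (d.tw w) - 2 * d.b w * d.b (d.tw w) + d.c w * d.a (d.tw w)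
/-- partial derivative of the first quadratic form -/
def pG (i : Fin 3) (w : Fin 3 → R) : R := d.al i * d.c w + d.ga i * d.a w - 2 * d.be i * d.b w
/-- partial derivative of the second quadratic form -/
def pG' (i : Fin 3) (w : Fin 3 → R) : R := d.la i * d.pG i (d.tw w)
/-- partial derivative of the mixed quadratic form -/
def pH (i : Fin 3) (w : Fin 3 → R) : R := d.pG i (d.tw w) + d.la i * d.pG i w
/-- polar coefficients -/
def pp (i j : Fin 3) : R := d.al i * d.ga j + d.ga i * d.al j - 2 * d.be i * d.be j
/-- a coordinate of the cross product of the gradients -/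
def w0 (w : Fin 3 → R) : R := d.pG 1 w * d.pG' 2 w - d.pG 2 w * d.pG' 1 w

def sp (x : Fin 4 → R) : Fin 3 → R := ![x 0, x 1, x 2]

/-- the determinant -/
def f (x : Fin 4 → R) : R := x 3 ^ 4 - x 3 ^ 2 * d.H (sp x) + d.G (sp x) * d.G' (sp x)

def mat (x : Fin 4 → R) : Matrix (Fin 4) (Fin 4) R :=
  !![d.a (sp x), d.b (sp x), x 3, 0;
     d.b (sp x), d.c (sp x), 0, x 3;
     x 3, 0, d.c (d.tw (sp x)), - d.b (d.tw (sp x));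
     0, x 3, - d.b (d.tw (sp x)), d.a (d.tw (sp x))]

/-- the gradient -/
def gi (i : Fin 3) (w : Fin 3 → R) (T : R) : R :=
  - T * d.pH i w + d.pG i w * d.G' w + d.G w * d.pG' i w

def hij (i j : Fin 3) (w : Fin 3 → R) (T : R) : R :=
  - T * (d.la i + d.la j) * d.pp i j + d.pp i j * d.G' w + d.pG i w * d.pG' j w
    + d.pG j w * d.pG' i w + d.la i * d.la j * d.pp i j * d.G w

/-- the gradient at a point -/
def g (x : Fin 4 → R) : Fin 4 → R :=
  ![d.gi 0 (sp x) (x 3 ^ 2), d.gi 1 (sp x) (x 3 ^ 2), d.gi 2 (sp x) (x 3 ^ 2),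
    4 * x 3 ^ 3 - 2 * x 3 * d.H (sp x)]

/-- the Hessian at a point -/
def h (x : Fin 4 → R) : Matrix (Fin 4) (Fin 4) R :=
  let k := fun i j => d.hij i j (sp x) (x 3 ^ 2)
  let l := fun i => - 2 * x 3 * d.pH i (sp x)
  !![k 0 0, k 0 1, k 0 2, l 0;
     k 1 0, k 1 1, k 1 2, l 1;
     k 2 0, k 2 1, k 2 2, l 2;
     l 0, l 1, l 2, 12 * x 3 ^ 2 - 2 * d.H (sp x)]

lemma det_mat (x : Fin 4 → R) : (d.mat x).det = d.f x := by
  simp [mat, Matrix.det_succ_row_zero, Fin.sum_univ_succ, Fin.succAbove, f, G, G', H]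
  ring

lemma euler_f (x : Fin 4 → R) : ∑ i, d.g x i * x i = 4 * d.f x := by
  simp [Fin.sum_univ_succ, g, gi, f, G, G', H, pG, pG', pH, a, b, c, tw, sp]
  ring

lemma euler_h (x : Fin 4 → R) : d.h x *ᵥ x = 3 • d.g x := by
  ext i
  fin_cases i <;>
  simp [Matrix.mulVec, dotProduct, Fin.sum_univ_succ, h, hij, g, gi, G, G', H, pG, pG', pH, pp,
    a, b, c, tw, sp] <;> ring

lemma a_smul (t : R) (w : Fin 3 → R) : d.a (t • w) = t * d.a w := by simp [a]; ring
lemma b_smul (t : R) (w : Fin 3 → R) : d.b (t • w) = t * d.b w := by simp [b]; ring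
lemma c_smul (t : R) (w : Fin 3 → R) : d.c (t • w) = t * d.c w := by simp [c]; ring
lemma tw_smul (t : R) (w : Fin 3 → R) : d.tw (t • w) = t • d.tw w := by
  ext i; simp [tw]; ring
lemma sp_smul (t : R) (x : Fin 4 → R) : sp (t • x) = t • sp x := by
  ext i; fin_cases i <;> simp [sp]
lemma G_smul (t : R) (w : Fin 3 → R) : d.G (t • w) = t ^ 2 * d.G w := by
  simp only [G, a_smul, b_smul, c_smul]; ring
lemma G'_smul (t : R) (w : Fin 3 → R) : d.G' (t • w) = t ^ 2 * d.G' w := by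
  simp only [G', tw_smul, G_smul]
lemma H_smul (t : R) (w : Fin 3 → R) : d.H (t • w) = t ^ 2 * d.H w := by
  simp only [H, a_smul, b_smul, c_smul, tw_smul]; ring
lemma pG_smul (i : Fin 3) (t : R) (w : Fin 3 → R) : d.pG i (t • w) = t * d.pG i w := by
  simp only [pG, a_smul, b_smul, c_smul]; ring
lemma pG'_smul (i : Fin 3) (t : R) (w : Fin 3 → R) : d.pG' i (t • w) = t * d.pG' i w := by
  simp only [pG', pG_smul, tw_smul]; ring
lemma pH_smul (i : Fin 3) (t : R) (w : Fin 3 → R) : d.pH i (t • w) = t * d.pH i w := by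
  simp only [pH, pG_smul, tw_smul]; ring

lemma h_smul (t : R) (x : Fin 4 → R) : d.h (t • x) = t ^ 2 • d.h x := by
  ext i j
  simp only [h, hij, sp_smul, G_smul, G'_smul, H_smul, pG_smul, pG'_smul, pH_smul,
    Pi.smul_apply, smul_eq_mul]
  fin_cases i <;> fin_cases j <;> simp <;> ring

lemma g_smul (t : R) (x : Fin 4 → R) : d.g (t • x) = t ^ 3 • d.g x := by
  ext i
  simp only [g, gi, sp_smul, G_smul, G'_smul, H_smul, pG_smul, pG'_smul, pH_smul,
    Pi.smul_apply, smul_eq_mul]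
  fin_cases i <;> simp <;> ring

end defs

section polys
open MvPolynomial

lemma pd_two (i : Fin 4) : pderiv i (2 : MvPolynomial (Fin 4) ℂ) = 0 := by
  have : (2 : MvPolynomial (Fin 4) ℂ) = C 2 := (map_ofNat C 2).symm
  rw [this, pderiv_C]

lemma pd_four (i : Fin 4) : pderiv i (4 : MvPolynomial (Fin 4) ℂ) = 0 := by
  have : (4 : MvPolynomial (Fin 4) ℂ) = C 4 := (map_ofNat C 4).symm
  rw [this, pderiv_C]

variable (d : Sec ℂ)

/-- coefficient of the derivative of the spatial part -/
def ext3 (v : Fin 3 → MvPolynomial (Fin 4) ℂ) : Fin 4 → MvPolynomial (Fin 4) ℂ :=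
  ![v 0, v 1, v 2, 0]

lemma pd_a (i : Fin 4) : pderiv i ((d.map C).a (sp X)) = ext3 (d.map C).al i := by
  fin_cases i <;> simp [a, sp, map, ext3, pderiv_X]
lemma pd_b (i : Fin 4) : pderiv i ((d.map C).b (sp X)) = ext3 (d.map C).be i := by
  fin_cases i <;> simp [b, sp, map, ext3, pderiv_X]
lemma pd_c (i : Fin 4) : pderiv i ((d.map C).c (sp X)) = ext3 (d.map C).ga i := by
  fin_cases i <;> simp [c, sp, map, ext3, pderiv_X]
lemma pd_a' (i : Fin 4) : pderiv i ((d.map C).a ((d.map C).tw (sp X))) =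
    ext3 (fun j => (d.map C).la j * (d.map C).al j) i := by
  fin_cases i <;> simp [a, tw, sp, map, ext3, pderiv_X, mul_comm]
lemma pd_b' (i : Fin 4) : pderiv i ((d.map C).b ((d.map C).tw (sp X))) =
    ext3 (fun j => (d.map C).la j * (d.map C).be j) i := by
  fin_cases i <;> simp [b, tw, sp, map, ext3, pderiv_X, mul_comm]
lemma pd_c' (i : Fin 4) : pderiv i ((d.map C).c ((d.map C).tw (sp X))) =
    ext3 (fun j => (d.map C).la j * (d.map C).ga j) i := by
  fin_cases i <;> simp [c, tw, sp, map, ext3, pderiv_X, mul_comm]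
lemma pd_al (i : Fin 4) (j : Fin 3) : pderiv i ((d.map C).al j) = 0 := by simp [map]
lemma pd_be (i : Fin 4) (j : Fin 3) : pderiv i ((d.map C).be j) = 0 := by simp [map]
lemma pd_ga (i : Fin 4) (j : Fin 3) : pderiv i ((d.map C).ga j) = 0 := by simp [map]
lemma pd_la (i : Fin 4) (j : Fin 3) : pderiv i ((d.map C).la j) = 0 := by simp [map]

lemma pderiv_f (i : Fin 4) : pderiv i ((d.map C).f X) = (d.map C).g X i := by
  have e : ∀ j : Fin 4, pderiv i (X j : MvPolynomial (Fin 4) ℂ) =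
      (Pi.single i 1 : Fin 4 → MvPolynomial (Fin 4) ℂ) j := by
    intro j; simp [pderiv_X]
  simp only [f, G, G', H, map_sub, map_add, Derivation.leibniz, Derivation.leibniz_pow, pd_a, pd_b,
    pd_c, pd_a', pd_b', pd_c', pd_two, e, smul_eq_mul]
  fin_cases i <;>
  simp [g, gi, pG, pG', pH, G, G', H, ext3] <;>
  ring

set_option maxHeartbeats 2000000 in
lemma pderiv_g (i j : Fin 4) : pderiv i ((d.map C).g X j) = (d.map C).h X i j := by
  have e : ∀ j : Fin 4, pderiv i (X j : MvPolynomial (Fin 4) ℂ) =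
      (Pi.single i 1 : Fin 4 → MvPolynomial (Fin 4) ℂ) j := by
    intro j; simp [pderiv_X]
  fin_cases j <;>
  simp [g, gi, G, G', H, pG, pG', pH, Derivation.leibniz_pow, pd_a, pd_b, pd_four,
    pd_c, pd_a', pd_b', pd_c', pd_two, pd_al, pd_be, pd_ga, pd_la, e, smul_eq_mul] <;>
  fin_cases i <;>
  simp [h, hij, pp, pG, pG', pH, G, G', H, ext3] <;>
  ring

end polys

end Sec


namespace Sec

/-- The pencil of the second family. -/
def Q (d : Sec ℝ) : Fin 4 → Matrix (Fin 4) (Fin 4) ℝ := fun l => d.mat (Pi.single l 1)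

lemma mat_symm {R : Type} [CommRing R] (d : Sec R) (x : Fin 4 → R) : (d.mat x).IsSymm := by
  ext i j
  fin_cases i <;> fin_cases j <;> simp [mat]

lemma Q_symm (d : Sec ℝ) (l : Fin 4) : (d.Q l).IsSymm := d.mat_symm _

lemma Qr_Q (d : Sec ℝ) (x : Fin 4 → ℝ) : Qr d.Q x = d.mat x := by
  ext i j
  simp only [Qr, Q, Fin.sum_univ_four, Matrix.add_apply, Matrix.smul_apply, smul_eq_mul]
  fin_cases i <;> fin_cases j <;> simp [mat, a, b, c, tw, sp] <;> ring

/-- complexified parameters -/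
abbrev toC (d : Sec ℝ) : Sec ℂ := d.map (fun t : ℝ => (t : ℂ))

lemma Qc_Q (d : Sec ℝ) (x : Fin 4 → ℂ) : Qc d.Q x = d.toC.mat x := by
  ext i j
  simp only [Qc, Q, Fin.sum_univ_four, Matrix.add_apply, Matrix.smul_apply, smul_eq_mul,
    Matrix.map_apply]
  fin_cases i <;> fin_cases j <;> simp [mat, a, b, c, tw, sp, map, toC] <;> ring

section maps
variable {R S : Type} [CommRing R] [CommRing S] (φ : R →+* S) (d : Sec R)

lemma map_sp (x : Fin 4 → R) : sp (fun i => φ (x i)) = fun i => φ (sp x i) := by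
  ext i; fin_cases i <;> simp [sp]
lemma map_tw (w : Fin 3 → R) : (d.map φ).tw (fun i => φ (w i)) = fun i => φ (d.tw w i) := by
  ext i; simp [tw, map]
lemma map_a (w : Fin 3 → R) : (d.map φ).a (fun i => φ (w i)) = φ (d.a w) := by simp [a, map]
lemma map_b (w : Fin 3 → R) : (d.map φ).b (fun i => φ (w i)) = φ (d.b w) := by simp [b, map]
lemma map_c (w : Fin 3 → R) : (d.map φ).c (fun i => φ (w i)) = φ (d.c w) := by simp [c, map]
lemma map_G (w : Fin 3 → R) : (d.map φ).G (fun i => φ (w i)) = φ (d.G w) := by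
  simp only [G, map_a, map_b, map_c, map_sub, map_mul, map_pow]
lemma map_G' (w : Fin 3 → R) : (d.map φ).G' (fun i => φ (w i)) = φ (d.G' w) := by
  simp only [G', map_tw, map_G]
lemma map_H (w : Fin 3 → R) : (d.map φ).H (fun i => φ (w i)) = φ (d.H w) := by
  have h2 : φ 2 = 2 := map_ofNat φ 2
  simp only [H, map_a, map_b, map_c, map_tw, map_sub, map_add, map_mul, h2]
lemma map_pG (i : Fin 3) (w : Fin 3 → R) :
    (d.map φ).pG i (fun i => φ (w i)) = φ (d.pG i w) := by
  have h2 : φ 2 = 2 := map_ofNat φ 2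
  simp only [pG, map_a, map_b, map_c, map_sub, map_add, map_mul, h2]
  rfl
lemma map_pG' (i : Fin 3) (w : Fin 3 → R) :
    (d.map φ).pG' i (fun i => φ (w i)) = φ (d.pG' i w) := by
  simp only [pG', map_pG, map_tw, map_mul]
  rfl
lemma map_pH (i : Fin 3) (w : Fin 3 → R) :
    (d.map φ).pH i (fun i => φ (w i)) = φ (d.pH i w) := by
  simp only [pH, map_pG, map_tw, map_mul, map_add]
  rfl
lemma map_w0 (w : Fin 3 → R) : (d.map φ).w0 (fun i => φ (w i)) = φ (d.w0 w) := by
  simp only [w0, map_pG, map_pG', map_mul, map_sub]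
lemma map_pp (i j : Fin 3) : (d.map φ).pp i j = φ (d.pp i j) := by
  have h2 : φ 2 = 2 := map_ofNat φ 2
  simp [pp, map, h2]
lemma map_gi (i : Fin 3) (w : Fin 3 → R) (T : R) :
    (d.map φ).gi i (fun i => φ (w i)) (φ T) = φ (d.gi i w T) := by
  simp only [gi, map_pG, map_pG', map_pH, map_G, map_G', map_mul, map_add, map_neg]
lemma map_hij (i j : Fin 3) (w : Fin 3 → R) (T : R) :
    (d.map φ).hij i j (fun i => φ (w i)) (φ T) = φ (d.hij i j w T) := by
  have e : ∀ i, (d.map φ).la i = φ (d.la i) := fun _ => rfl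
  simp only [hij, map_pG, map_pG', map_pp, map_G, map_G', map_mul, map_add, map_neg, e]
lemma map_f (x : Fin 4 → R) : (d.map φ).f (fun i => φ (x i)) = φ (d.f x) := by
  simp only [f, map_sp, map_H, map_G, map_G', map_mul, map_add, map_sub, map_pow]
lemma map_g (x : Fin 4 → R) (i : Fin 4) : (d.map φ).g (fun i => φ (x i)) i = φ (d.g x i) := by
  have h2 : φ 2 = 2 := map_ofNat φ 2
  have h4 : φ 4 = 4 := map_ofNat φ 4
  simp only [g, map_sp, map_H, ← map_pow, map_gi]
  fin_cases i <;> simp [h2, h4]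
lemma map_h (x : Fin 4 → R) (i j : Fin 4) :
    (d.map φ).h (fun i => φ (x i)) i j = φ (d.h x i j) := by
  have h2 : φ 2 = 2 := map_ofNat φ 2
  have h12 : φ 12 = 12 := map_ofNat φ 12
  simp only [h, map_sp, map_H, map_pH, ← map_pow, map_hij]
  fin_cases i <;> fin_cases j <;> simp [h2, h12]

end maps

lemma eval_aux (d : Sec ℂ) (x : Fin 4 → ℂ) :
    ((d.map MvPolynomial.C).map (MvPolynomial.eval x) = d) ∧
    (fun i => MvPolynomial.eval x (MvPolynomial.X i)) = x := by
  constructor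
  · simp [map]
  · ext i; simp

lemma eval_f (d : Sec ℂ) (x : Fin 4 → ℂ) :
    MvPolynomial.eval x ((d.map MvPolynomial.C).f MvPolynomial.X) = d.f x := by
  have := map_f (MvPolynomial.eval x) (d.map MvPolynomial.C) MvPolynomial.X
  rw [(eval_aux d x).1, (eval_aux d x).2] at this
  exact this.symm

lemma eval_g (d : Sec ℂ) (x : Fin 4 → ℂ) (i : Fin 4) :
    MvPolynomial.eval x ((d.map MvPolynomial.C).g MvPolynomial.X i) = d.g x i := by
  have := map_g (MvPolynomial.eval x) (d.map MvPolynomial.C) MvPolynomial.X i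
  rw [(eval_aux d x).1, (eval_aux d x).2] at this
  exact this.symm

lemma eval_h (d : Sec ℂ) (x : Fin 4 → ℂ) (i j : Fin 4) :
    MvPolynomial.eval x ((d.map MvPolynomial.C).h MvPolynomial.X i j) = d.h x i j := by
  have := map_h (MvPolynomial.eval x) (d.map MvPolynomial.C) MvPolynomial.X i j
  rw [(eval_aux d x).1, (eval_aux d x).2] at this
  exact this.symm

lemma derivs (d : Sec ℝ) (x : Fin 4 → ℂ) :
    (gradVanishes d.Q x ↔ d.toC.g x = 0) ∧ hessian d.Q x = d.toC.h x := by
  obtain ⟨h1, h2⟩ := calc_derivs d.Q ((d.toC.map MvPolynomial.C).f MvPolynomial.X)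
    (fun y => by rw [eval_f, ← det_mat, ← Qc_Q]; rfl) _ (pderiv_f d.toC) _ (pderiv_g d.toC) x
  constructor
  · rw [h1]
    simp only [eval_g]
    exact ⟨fun h => funext h, fun h i => congrFun h i⟩
  · rw [h2]
    ext i j
    simp only [Matrix.of_apply, eval_h]

section alg
variable {F : Type} [Field F] (d : Sec F)

lemma adj_eq (x : Fin 4 → F) (A B C A' B' C' t n11 n12 n21 n22 : F)
    (hA : A = d.a (sp x)) (hB : B = d.b (sp x)) (hC : C = d.c (sp x))
    (hA' : A' = d.a (d.tw (sp x))) (hB' : B' = d.b (d.tw (sp x))) (hC' : C' = d.c (d.tw (sp x)))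
    (ht : t = x 3) (h11 : n11 = A * C' - B * B' - t ^ 2) (h12 : n12 = B * A' - A * B')
    (h21 : n21 = B * C' - C * B') (h22 : n22 = C * A' - B * B' - t ^ 2) :
    (d.mat x).adjugate =
    !![C' * n22 + B' * n21, - C' * n12 - B' * n11, - t * n22, t * n21;
       - B' * n22 - A' * n21, B' * n12 + A' * n11, t * n12, - t * n11;
       - t * n22, t * n12, A * n22 - B * n12, B * n11 - A * n21;
       t * n21, - t * n11, B * n22 - C * n12, C * n11 - B * n21] := by
  subst h11 h12 h21 h22
  ext i j
  rw [Matrix.adjugate_fin_succ_eq_det_submatrix, Matrix.det_fin_three]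
  fin_cases i <;> fin_cases j <;>
    simp [mat, Fin.succAbove, ← hA, ← hB, ← hC, ← hA', ← hB', ← hC', ← ht] <;> ring

lemma trace_adj (x : Fin 4 → F) (l : Fin 4) :
    ((d.mat x).adjugate * d.mat (Pi.single l 1)).trace = d.g x l := by
  rw [d.adj_eq x _ _ _ _ _ _ _ _ _ _ _ rfl rfl rfl rfl rfl rfl rfl rfl rfl rfl rfl]
  simp only [Matrix.trace, Matrix.diag, Matrix.mul_apply, Fin.sum_univ_four]
  fin_cases l <;> simp [mat, g, gi, pG, pG', pH, G, G', H]
  all_goals generalize d.a (sp x) = A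
  all_goals generalize d.b (sp x) = B
  all_goals generalize d.c (sp x) = C
  all_goals generalize d.a (d.tw (sp x)) = A'
  all_goals generalize d.b (d.tw (sp x)) = B'
  all_goals generalize d.c (d.tw (sp x)) = C'
  all_goals simp [a, b, c, tw, sp]
  all_goals ring

end alg
end Sec


namespace Sec

/-- Determinant of a 3 by 3 array. -/
def det3 {R : Type} [CommRing R] (m : Fin 3 → Fin 3 → R) : R :=
  m 0 0 * m 1 1 * m 2 2 - m 0 0 * m 1 2 * m 2 1 - m 0 1 * m 1 0 * m 2 2
    + m 0 1 * m 1 2 * m 2 0 + m 0 2 * m 1 0 * m 2 1 - m 0 2 * m 1 1 * m 2 0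

section alg
variable {F : Type} [Field F]

lemma lin3 (m : Fin 3 → Fin 3 → F) (hm : det3 m ≠ 0) (u : Fin 3 → F)
    (h : ∀ i, m i 0 * u 0 + m i 1 * u 1 + m i 2 * u 2 = 0) : u = 0 := by
  have h0 := h 0
  have h1 := h 1
  have h2 := h 2
  ext i
  apply mul_left_cancel₀ hm
  fin_cases i
  · change det3 m * u 0 = det3 m * 0
    simp only [det3]
    linear_combination (m 1 1 * m 2 2 - m 1 2 * m 2 1) * h0 - (m 0 1 * m 2 2 - m 0 2 * m 2 1) * h1
      + (m 0 1 * m 1 2 - m 0 2 * m 1 1) * h2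
  · change det3 m * u 1 = det3 m * 0
    simp only [det3]
    linear_combination -(m 1 0 * m 2 2 - m 1 2 * m 2 0) * h0 + (m 0 0 * m 2 2 - m 0 2 * m 2 0) * h1
      - (m 0 0 * m 1 2 - m 0 2 * m 1 0) * h2
  · change det3 m * u 2 = det3 m * 0
    simp only [det3]
    linear_combination (m 1 0 * m 2 1 - m 1 1 * m 2 0) * h0 - (m 0 0 * m 2 1 - m 0 1 * m 2 0) * h1
      + (m 0 0 * m 1 1 - m 0 1 * m 1 0) * h2

end alg

section ring
variable {R : Type} [CommRing R] (d : Sec R)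

/-- the value of the first quadratic form at a basis vector -/
def gk (k : Fin 3) : R := d.al k * d.ga k - d.be k ^ 2

/-- the resultant of two of the binary forms -/
def res (i j : Fin 3) : R :=
  (d.ga i * d.al j - d.ga j * d.al i) ^ 2
    - 4 * (d.be i * d.ga j - d.be j * d.ga i) * (d.al i * d.be j - d.al j * d.be i)

/-- Genericity conditions. -/
structure Gen (d : Sec R) : Prop where
  det : det3 ![d.al, d.be, d.ga] ≠ 0
  la : ∀ i, d.la i ≠ 0
  lne : ∀ i j, i ≠ j → d.la i ≠ d.la j
  res : ∀ i j, i ≠ j → d.res i j ≠ 0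

/-- an eigenvector node -/
def en (k : Fin 3) (c : R) : Fin 4 → R := Pi.single k.castSucc 1 + c • Pi.single 3 1

/-- a node in the plane at infinity -/
def fn (w : Fin 3 → R) : Fin 4 → R := ![w 0, w 1, w 2, 0]

lemma sp_en (k : Fin 3) (c : R) : sp (en k c) = Pi.single k 1 := by
  ext i
  fin_cases k <;> fin_cases i <;> simp [sp, en]

lemma en_three (k : Fin 3) (c : R) : en k c 3 = c := by
  fin_cases k <;> simp [en]

lemma sp_fn (w : Fin 3 → R) : sp (fn w) = w := by
  ext i
  fin_cases i <;> simp [sp, fn]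

lemma fn_three (w : Fin 3 → R) : fn w 3 = 0 := rfl

lemma ext_sp {x y : Fin 4 → R} (h : sp x = sp y) (h3 : x 3 = y 3) : x = y := by
  have h0 := congrFun h 0
  have h1 := congrFun h 1
  have h2 := congrFun h 2
  simp [sp] at h0 h1 h2
  ext i; fin_cases i <;> simpa

/-- cross product -/
def cr (p q : Fin 3 → R) : Fin 3 → R :=
  ![p 1 * q 2 - p 2 * q 1, p 2 * q 0 - p 0 * q 2, p 0 * q 1 - p 1 * q 0]

/-- dot product -/
def dt (p q : Fin 3 → R) : R := p 0 * q 0 + p 1 * q 1 + p 2 * q 2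

lemma a_single (k : Fin 3) (t : R) : d.a (Pi.single k t) = d.al k * t := by
  fin_cases k <;> simp [a]
lemma b_single (k : Fin 3) (t : R) : d.b (Pi.single k t) = d.be k * t := by
  fin_cases k <;> simp [b]
lemma c_single (k : Fin 3) (t : R) : d.c (Pi.single k t) = d.ga k * t := by
  fin_cases k <;> simp [c]
lemma tw_single (k : Fin 3) (t : R) : d.tw (Pi.single k t) = Pi.single k (d.la k * t) := by
  ext i
  simp only [tw]
  by_cases h : i = k
  · subst h; simp
  · simp [h]

lemma G_line (p q : Fin 3 → R) (c : R) :
    d.G (p + c • q) = d.G p + c * (d.G (p + q) - d.G p - d.G q) + c ^ 2 * d.G q := by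
  simp [G, Sec.a, Sec.b, Sec.c]; ring
lemma tw_add (p q : Fin 3 → R) : d.tw (p + q) = d.tw p + d.tw q := by
  ext i; simp [tw]; ring
lemma G'_line (p q : Fin 3 → R) (c : R) :
    d.G' (p + c • q) = d.G' p + c * (d.G' (p + q) - d.G' p - d.G' q) + c ^ 2 * d.G' q := by
  simp only [G', tw_add, tw_smul, G_line]
lemma H_line (p q : Fin 3 → R) (c : R) :
    d.H (p + c • q) = d.H p + c * (d.H (p + q) - d.H p - d.H q) + c ^ 2 * d.H q := by
  simp [H, Sec.a, Sec.b, Sec.c, tw]; ring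
lemma pG_add (i : Fin 3) (p q : Fin 3 → R) : d.pG i (p + q) = d.pG i p + d.pG i q := by
  simp [pG, Sec.a, Sec.b, Sec.c]; ring
lemma pG'_add (i : Fin 3) (p q : Fin 3 → R) : d.pG' i (p + q) = d.pG' i p + d.pG' i q := by
  simp only [pG', tw_add, pG_add]; ring
lemma w0_line (p q : Fin 3 → R) (c : R) :
    d.w0 (p + c • q) = d.w0 p + c * (d.w0 (p + q) - d.w0 p - d.w0 q) + c ^ 2 * d.w0 q := by
  simp only [w0, pG_add, pG'_add, pG_smul, pG'_smul]; ring

/-- gradient vanishes at an eigenvector node -/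
lemma g_en (k : Fin 3) (c : R) (hc : c ^ 2 = d.la k * d.gk k) : d.g (en k c) = 0 := by
  have h3 : 4 * c ^ 3 - 2 * c * (2 * (d.la k * d.gk k)) = 0 := by
    rw [← hc]; ring
  simp only [g, sp_en, en_three, gi, pH, pG', pG, G', G, H, tw_single, a_single, b_single,
    c_single, hc]
  simp only [gk] at h3
  ext i
  fin_cases i
  · simp [gk]; ring
  · simp [gk]; ring
  · simp [gk]; ring
  · simp; linear_combination h3

lemma g_fn (w : Fin 3 → R) (h : d.G w = 0) (h' : d.G' w = 0) : d.g (fn w) = 0 := by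
  simp only [g, sp_fn, fn_three, gi, h, h']
  ext i
  fin_cases i <;> simp

lemma det_en (k : Fin 3) (c : R) (hc : c ^ 2 = d.la k * d.gk k) :
    ((d.h (en k c)).submatrix ![0, 1, 2] ![0, 1, 2]).det =
      det3 (fun i j => d.hij i j (Pi.single k 1) (d.la k * d.gk k)) := by
  rw [Matrix.det_fin_three]
  simp only [h, sp_en, en_three, hc, det3, Matrix.submatrix_apply]
  simp

lemma det_fn (w : Fin 3 → R) (h : d.G w = 0) (h' : d.G' w = 0) :
    ((d.h (fn w)).submatrix ![1, 2, 3] ![1, 2, 3]).det = 2 * d.H w * d.w0 w ^ 2 := by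
  rw [Matrix.det_fin_three]
  simp only [Sec.h, sp_fn, fn_three, hij, h, h', Matrix.submatrix_apply, w0]
  simp
  ring

end ring

end Sec


namespace Sec

section alg
variable {F : Type} [Field F] (d : Sec F)

lemma res_zero {a b c a' b' c' s t : F}
    (hr : (c * a' - c' * a) ^ 2 - 4 * (b * c' - b' * c) * (a * b' - a' * b) ≠ 0)
    (h : a * s ^ 2 + 2 * b * s * t + c * t ^ 2 = 0)
    (h' : a' * s ^ 2 + 2 * b' * s * t + c' * t ^ 2 = 0) : s = 0 ∧ t = 0 := by
  obtain ⟨X, hX⟩ : ∃ X, X = b * c' - b' * c := ⟨_, rfl⟩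
  obtain ⟨Y, hY⟩ : ∃ Y, Y = c * a' - c' * a := ⟨_, rfl⟩
  obtain ⟨Z, hZ⟩ : ∃ Z, Z = a * b' - a' * b := ⟨_, rfl⟩
  rw [← hX, ← hY, ← hZ] at hr
  have e1 : s ^ 2 * Y - 2 * s * t * X = 0 := by
    rw [hX, hY]; linear_combination c * h' - c' * h
  have e2 : t ^ 2 * Y - 2 * s * t * Z = 0 := by
    rw [hZ, hY]; linear_combination a' * h - a * h'
  have e3 : s ^ 2 * Z - t ^ 2 * X = 0 := by
    rw [hZ, hX]; linear_combination b' * h - b * h'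
  constructor
  · have : (Y ^ 2 - 4 * X * Z) * s ^ 4 = 0 := by
      linear_combination (s ^ 2 * Y + 2 * s * t * X) * e1 - 4 * X * s ^ 2 * e3
    simpa [hr] using this
  · have : (Y ^ 2 - 4 * X * Z) * t ^ 4 = 0 := by
      linear_combination (t ^ 2 * Y + 2 * s * t * Z) * e2 + 4 * Z * t ^ 2 * e3
    simpa [hr] using this

lemma base_aux (hd : d.Gen) (s t μ ν : F) (hμ : ¬ (μ = 0 ∧ ν = 0))
    (h : ∀ i, (d.al i * s ^ 2 + 2 * d.be i * s * t + d.ga i * t ^ 2) * (μ ^ 2 + d.la i * ν ^ 2) = 0) :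
    s = 0 ∧ t = 0 := by
  have two : ∀ i j, i ≠ j → μ ^ 2 + d.la i * ν ^ 2 = 0 → μ ^ 2 + d.la j * ν ^ 2 = 0 → False := by
    intro i j hij h1 h2
    have h3 : (d.la i - d.la j) * ν ^ 2 = 0 := by linear_combination h1 - h2
    have h4 : ν = 0 := by
      simpa [sub_ne_zero.mpr (hd.lne i j hij)] using h3
    apply hμ
    rw [h4] at h1
    exact ⟨by simpa using h1, h4⟩
  have fin : ∀ i j, i ≠ j → d.al i * s ^ 2 + 2 * d.be i * s * t + d.ga i * t ^ 2 = 0 →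
      d.al j * s ^ 2 + 2 * d.be j * s * t + d.ga j * t ^ 2 = 0 → s = 0 ∧ t = 0 :=
    fun i j hij h1 h2 => res_zero (hd.res i j hij) h1 h2
  rcases mul_eq_zero.mp (h 0) with h0 | h0 <;> rcases mul_eq_zero.mp (h 1) with h1 | h1
  · exact fin 0 1 (by decide) h0 h1
  · rcases mul_eq_zero.mp (h 2) with h2 | h2
    · exact fin 0 2 (by decide) h0 h2
    · exact (two 1 2 (by decide) h1 h2).elim
  · rcases mul_eq_zero.mp (h 2) with h2 | h2
    · exact fin 1 2 (by decide) h1 h2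
    · exact (two 0 2 (by decide) h0 h2).elim
  · exact (two 0 1 (by decide) h0 h1).elim

lemma base (hd : d.Gen) (h2' : (2 : F) ≠ 0) (v : Fin 4 → F)
    (h : ∀ l, v ⬝ᵥ (d.mat (Pi.single l 1) *ᵥ v) = 0) : v = 0 := by
  have hi : ∀ i : Fin 3, (d.al i * v 0 ^ 2 + 2 * d.be i * v 0 * v 1 + d.ga i * v 1 ^ 2) +
      d.la i * (d.al i * v 3 ^ 2 - 2 * d.be i * v 3 * v 2 + d.ga i * v 2 ^ 2) = 0 := by
    intro i
    have := h i.castSucc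
    fin_cases i <;>
    · simp [mat, Matrix.mulVec, dotProduct, Fin.sum_univ_four, a, b, c, tw, sp] at this
      simp
      linear_combination this
  have h3 : v 0 * v 2 + v 1 * v 3 = 0 := by
    have := h 3
    simp [mat, Matrix.mulVec, dotProduct, Fin.sum_univ_four, a, b, c, tw, sp] at this
    apply mul_left_cancel₀ h2'
    linear_combination this
  have key : (v 0 = 0 ∧ v 1 = 0) ∧ (v 3 = 0 ∧ v 2 = 0) := by
    by_cases h0 : v 0 = 0
    · by_cases h1 : v 1 = 0
      · refine ⟨⟨h0, h1⟩, ?_⟩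
        have := base_aux d hd (v 3) (- v 2) 0 1 (by simp) (fun i => by
          have := hi i
          rw [h0, h1] at this
          linear_combination this)
        exact ⟨this.1, neg_eq_zero.mp this.2⟩
      · exfalso
        apply h1
        have e3 : v 3 = 0 := by simpa [h0, h1] using h3
        refine (base_aux d hd (v 0) (v 1) (v 1) (- v 2) (fun hh => h1 hh.1) (fun i => ?_)).2
        have := hi i
        rw [h0, e3] at this
        rw [h0]
        linear_combination v 1 ^ 2 * this
    · exfalso
      apply h0
      refine (base_aux d hd (v 0) (v 1) (v 0) (v 3) (fun hh => h0 hh.1) (fun i => ?_)).1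
      linear_combination v 0 ^ 2 * hi i + d.la i * (2 * d.be i * v 0 * v 3 +
        d.ga i * (v 1 * v 3 - v 0 * v 2)) * h3
  obtain ⟨⟨h0, h1⟩, h3, h2⟩ := key
  ext i
  fin_cases i <;> simpa

lemma abc_zero (hd : d.Gen) (w : Fin 3 → F) (ha : d.a w = 0) (hb : d.b w = 0) (hc : d.c w = 0) :
    w = 0 := by
  apply lin3 _ hd.det w
  intro i
  fin_cases i
  · simpa [a] using ha
  · simpa [b] using hb
  · simpa [c] using hc

/-- Singular points off the plane at infinity. -/
lemma sing_en (hd : d.Gen) (x : Fin 4 → F) (ht : x 3 ≠ 0)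
    (h : (d.mat x).adjugate = 0) : ∃ (k : Fin 3) (c a : F), c ^ 2 = d.la k * d.gk k ∧ x = a • en k c := by
  rw [d.adj_eq x _ _ _ _ _ _ _ _ _ _ _ rfl rfl rfl rfl rfl rfl rfl rfl rfl rfl rfl] at h
  have e := fun i j => congrFun (congrFun h i) j
  have e02 := e 0 2
  have e03 := e 0 3
  have e12 := e 1 2
  have e13 := e 1 3
  simp [ht] at e02 e03 e12 e13
  have E1 : d.G (sp x) * d.a (d.tw (sp x)) - x 3 ^ 2 * d.a (sp x) = 0 := by
    simp only [G]
    linear_combination d.a (sp x) * e02 - d.b (sp x) * e12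
  have E2 : d.G (sp x) * d.b (d.tw (sp x)) - x 3 ^ 2 * d.b (sp x) = 0 := by
    simp only [G]
    linear_combination d.b (sp x) * e13 - d.a (sp x) * e03
  have E3 : d.G (sp x) * d.c (d.tw (sp x)) - x 3 ^ 2 * d.c (sp x) = 0 := by
    simp only [G]
    linear_combination d.c (sp x) * e13 - d.b (sp x) * e03
  have hu : (fun i => (d.G (sp x) * d.la i - x 3 ^ 2) * sp x i) = 0 := by
    apply d.abc_zero hd
    · rw [← E1]; simp only [a, tw]; ring
    · rw [← E2]; simp only [b, tw]; ring
    · rw [← E3]; simp only [c, tw]; ring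
  have hne : sp x ≠ 0 := by
    intro h0
    have z : d.tw 0 = 0 := by ext i; simp [tw]
    rw [h0, z] at e13
    simp [a, b, c, ht] at e13
  obtain ⟨k, hk⟩ : ∃ k, sp x k ≠ 0 := by
    by_contra hcon
    push Not at hcon
    exact hne (funext hcon)
  have hGk : d.G (sp x) * d.la k = x 3 ^ 2 := by
    have := congrFun hu k
    simp [hk] at this
    linear_combination this
  have hG : d.G (sp x) ≠ 0 := by
    intro h0
    rw [h0] at hGk
    apply ht
    simpa using hGk.symm
  have ho : ∀ j, j ≠ k → sp x j = 0 := by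
    intro j hj
    have := congrFun hu j
    simp at this
    rcases this with h1 | h1
    · exfalso
      apply hd.lne j k hj
      apply mul_left_cancel₀ hG
      linear_combination h1 - hGk
    · exact h1
  have hs : sp x = Pi.single k (sp x k) := by
    ext j
    by_cases hj : j = k
    · subst hj; simp
    · simp [hj, ho j hj]
  obtain ⟨s, hs0⟩ : ∃ s, s = sp x k := ⟨_, rfl⟩
  rw [← hs0] at hs hk
  refine ⟨k, x 3 / s, s, ?_, ?_⟩
  · rw [hs] at hGk
    simp only [G, a_single, b_single, c_single] at hGk
    simp only [gk]
    field_simp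
    linear_combination -hGk
  · apply ext_sp
    · rw [sp_smul, sp_en, hs]
      ext j
      by_cases hj : j = k
      · subst hj; simp
      · simp [hj]
    · simp only [Pi.smul_apply, en_three, smul_eq_mul]
      field_simp

/-- Singular points in the plane at infinity: both quadratic forms vanish. -/
lemma sing_inf (hd : d.Gen) (x : Fin 4 → F) (hx : sp x ≠ 0) (ht : x 3 = 0)
    (h : (d.mat x).adjugate = 0) : d.G (sp x) = 0 ∧ d.G' (sp x) = 0 := by
  rw [d.adj_eq x _ _ _ _ _ _ _ _ _ _ _ rfl rfl rfl rfl rfl rfl rfl rfl rfl rfl rfl] at h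
  have e := fun i j => congrFun (congrFun h i) j
  have e00 := e 0 0
  have e01 := e 0 1
  have e11 := e 1 1
  have e22 := e 2 2
  have e23 := e 2 3
  have e33 := e 3 3
  simp [ht] at e00 e01 e11 e22 e23 e33
  constructor
  · by_contra hG
    have : d.tw (sp x) = 0 := by
      apply d.abc_zero hd <;> apply mul_left_cancel₀ hG <;> simp only [G]
      · linear_combination e22
      · linear_combination e23
      · linear_combination e33
    apply hx
    ext i
    have := congrFun this i
    simpa [tw, hd.la i] using this
  · by_contra hG
    apply hx
    apply d.abc_zero hd <;> apply mul_left_cancel₀ hG <;> simp only [G', G]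
    · linear_combination e11
    · linear_combination -e01
    · linear_combination e00

lemma line_mem (p q w : Fin 3 → F) (h2 : cr p q 2 ≠ 0) (h : dt (cr p q) w = 0) :
    ∃ u v : F, w = u • p + v • q := by
  obtain ⟨l, hl⟩ : ∃ l, l = cr p q 2 := ⟨_, rfl⟩
  rw [← hl] at h2
  refine ⟨(w 0 * q 1 - w 1 * q 0) / l, (p 0 * w 1 - p 1 * w 0) / l, ?_⟩
  simp [cr, dt] at hl h
  ext i
  fin_cases i
  · simp; field_simp; rw [hl]; ring
  · simp; field_simp; rw [hl]; ring
  · simp; field_simp; rw [hl]; linear_combination h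

lemma line_sing (p q w : Fin 3 → F) (r : F) (hw : w ≠ 0) (h2 : cr p q 2 ≠ 0)
    (h : dt (cr p q) w = 0) (hG : d.G w = 0) (hp : d.G p = - r * d.G q)
    (hpq : d.G (p + q) = d.G p + d.G q) (hq : d.G q ≠ 0) :
    ∃ c s : F, c ^ 2 = r ∧ w = s • (p + c • q) := by
  obtain ⟨u, v, rfl⟩ := line_mem p q w h2 h
  have e : d.G (u • p + v • q) = (v ^ 2 - r * u ^ 2) * d.G q := by
    have : d.G (u • p + v • q) = u ^ 2 * d.G p + u * v * (d.G (p + q) - d.G p - d.G q)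
        + v ^ 2 * d.G q := by
      simp [G, Sec.a, Sec.b, Sec.c]; ring
    rw [this, hpq, hp]; ring
  have e' : v ^ 2 - r * u ^ 2 = 0 := by
    rw [e] at hG
    simpa [hq] using hG
  have hu : u ≠ 0 := by
    rintro rfl
    apply hw
    have : v = 0 := by simpa using e'
    simp [this]
  refine ⟨v / u, u, ?_, ?_⟩
  · field_simp; linear_combination e'
  · rw [smul_add, smul_smul]
    congr 2
    field_simp

end alg
end Sec


namespace Sec

section real
variable (d : Sec ℝ)

lemma quad_mat (x y : Fin 4 → ℝ) : y ⬝ᵥ (d.mat x *ᵥ y) =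
    d.a (sp x) * y 0 ^ 2 + 2 * d.b (sp x) * y 0 * y 1 + d.c (sp x) * y 1 ^ 2 +
    2 * x 3 * (y 0 * y 2 + y 1 * y 3) +
    (d.c (d.tw (sp x)) * y 2 ^ 2 - 2 * d.b (d.tw (sp x)) * y 2 * y 3 +
      d.a (d.tw (sp x)) * y 3 ^ 2) := by
  simp [mat, Matrix.mulVec, dotProduct, Fin.sum_univ_four]
  ring

lemma mat_herm (x : Fin 4 → ℝ) : (d.mat x).IsHermitian := by
  ext i j
  fin_cases i <;> fin_cases j <;> simp [mat]

lemma psd_en (k : Fin 3) (c : ℝ) (hc : c ^ 2 = d.la k * d.gk k) (hg : 0 < d.gk k)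
    (ha : 0 < d.al k) : (d.mat (en k c)).PosSemidef := by
  refine Matrix.PosSemidef.of_dotProduct_mulVec_nonneg (d.mat_herm _) fun y => ?_
  simp only [star_trivial]
  rw [quad_mat]
  simp only [sp_en, en_three, tw_single, a_single, b_single, c_single]
  have hgk : d.gk k = d.al k * d.ga k - d.be k ^ 2 := rfl
  generalize d.gk k = g at *
  generalize d.al k = A at *
  generalize d.be k = B at *
  generalize d.ga k = C at *
  generalize d.la k = L at *
  have hp : 0 < A * g ^ 2 := by positivity
  refine nonneg_of_mul_nonneg_right ?_ hp
  have e : A * g ^ 2 * (A * 1 * y 0 ^ 2 + 2 * (B * 1) * y 0 * y 1 + C * 1 * y 1 ^ 2 +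
      2 * c * (y 0 * y 2 + y 1 * y 3) + (C * (L * 1) * y 2 ^ 2 - 2 * (B * (L * 1)) * y 2 * y 3 +
      A * (L * 1) * y 3 ^ 2)) =
      (A * (g * y 0 + c * (C * y 2 - B * y 3)) + B * (g * y 1 + c * (A * y 3 - B * y 2))) ^ 2
      + g * (g * y 1 + c * (A * y 3 - B * y 2)) ^ 2 := by
    have e2 : (A * (g * y 0 + c * (C * y 2 - B * y 3)) + B * (g * y 1 + c * (A * y 3 - B * y 2))) =
      g * (A * y 0 + B * y 1 + c * y 2) := by rw [hgk]; ring
    rw [e2]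
    have e3 : c ^ 2 * (A * y 3 - B * y 2) ^ 2 = L * g * (A * y 3 - B * y 2) ^ 2 := by rw [hc]
    have e4 : c ^ 2 * y 2 ^ 2 = L * g * y 2 ^ 2 := by rw [hc]
    linear_combination (-g) * e3 - g ^ 2 * e4 - (g ^ 2 * (y 1 ^ 2 + L * y 2 ^ 2)) * hgk
  rw [e]
  positivity

lemma psd_fn (w : Fin 3 → ℝ) (h : d.G w = 0) (h' : d.G' w = 0) (hs : 0 < d.a w + d.c w)
    (hs' : 0 < d.a (d.tw w) + d.c (d.tw w)) : (d.mat (fn w)).PosSemidef := by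
  refine Matrix.PosSemidef.of_dotProduct_mulVec_nonneg (d.mat_herm _) fun y => ?_
  simp only [star_trivial]
  rw [quad_mat]
  simp only [sp_fn, fn_three]
  simp only [G', G] at h h'
  generalize d.a w = A at *
  generalize d.b w = B at *
  generalize d.c w = C at *
  generalize d.a (d.tw w) = A' at *
  generalize d.b (d.tw w) = B' at *
  generalize d.c (d.tw w) = C' at *
  have h1 : 0 ≤ A * y 0 ^ 2 + 2 * B * y 0 * y 1 + C * y 1 ^ 2 := by
    refine nonneg_of_mul_nonneg_right ?_ hs
    have : (A + C) * (A * y 0 ^ 2 + 2 * B * y 0 * y 1 + C * y 1 ^ 2) =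
      (A * y 0 + B * y 1) ^ 2 + (B * y 0 + C * y 1) ^ 2 := by
      linear_combination (y 0 ^ 2 + y 1 ^ 2) * h
    rw [this]; positivity
  have h2 : 0 ≤ C' * y 2 ^ 2 - 2 * B' * y 2 * y 3 + A' * y 3 ^ 2 := by
    refine nonneg_of_mul_nonneg_right ?_ hs'
    have : (A' + C') * (C' * y 2 ^ 2 - 2 * B' * y 2 * y 3 + A' * y 3 ^ 2) =
      (C' * y 2 - B' * y 3) ^ 2 + (B' * y 2 - A' * y 3) ^ 2 := by
      linear_combination (y 2 ^ 2 + y 3 ^ 2) * h'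
    rw [this]; positivity
  linarith

lemma pos_line {p q r c : ℝ} (hc : c ^ 2 = r) (hp : 0 < p) (h : r * q ^ 2 < p ^ 2) :
    0 < p + c * q := by
  by_contra hn
  push Not at hn
  have : p ^ 2 ≤ (c * q) ^ 2 := by nlinarith
  rw [mul_pow, hc] at this
  linarith

lemma pd_fn (w : Fin 3 → ℝ) (ha : 0 < d.a w) (h : 0 < d.G w) (ha' : 0 < d.a (d.tw w))
    (h' : 0 < d.G' w) : (d.mat (fn w)).PosDef := by
  refine Matrix.PosDef.of_dotProduct_mulVec_pos (d.mat_herm _) fun y hy => ?_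
  simp only [star_trivial]
  rw [quad_mat]
  simp only [sp_fn, fn_three]
  simp only [G', G] at h h'
  generalize d.a w = A at *
  generalize d.b w = B at *
  generalize d.c w = C at *
  generalize d.a (d.tw w) = A' at *
  generalize d.b (d.tw w) = B' at *
  generalize d.c (d.tw w) = C' at *
  have e1 : A * (A * y 0 ^ 2 + 2 * B * y 0 * y 1 + C * y 1 ^ 2) =
    (A * y 0 + B * y 1) ^ 2 + (A * C - B ^ 2) * y 1 ^ 2 := by ring
  have e2 : A' * (C' * y 2 ^ 2 - 2 * B' * y 2 * y 3 + A' * y 3 ^ 2) =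
    (A' * y 3 - B' * y 2) ^ 2 + (A' * C' - B' ^ 2) * y 2 ^ 2 := by ring
  have p1 : 0 ≤ A * y 0 ^ 2 + 2 * B * y 0 * y 1 + C * y 1 ^ 2 := by
    refine nonneg_of_mul_nonneg_right ?_ ha
    rw [e1]; positivity
  have p2 : 0 ≤ C' * y 2 ^ 2 - 2 * B' * y 2 * y 3 + A' * y 3 ^ 2 := by
    refine nonneg_of_mul_nonneg_right ?_ ha'
    rw [e2]; positivity
  by_contra hneg
  have q1 : A * y 0 ^ 2 + 2 * B * y 0 * y 1 + C * y 1 ^ 2 = 0 := by linarith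
  have q2 : C' * y 2 ^ 2 - 2 * B' * y 2 * y 3 + A' * y 3 ^ 2 = 0 := by linarith
  rw [q1, mul_zero] at e1
  rw [q2, mul_zero] at e2
  have s1 := mul_nonneg h.le (sq_nonneg (y 1))
  have s2 := mul_nonneg h'.le (sq_nonneg (y 2))
  have t1 : (A * C - B ^ 2) * y 1 ^ 2 = 0 := by nlinarith [sq_nonneg (A * y 0 + B * y 1)]
  have t2 : (A' * C' - B' ^ 2) * y 2 ^ 2 = 0 := by nlinarith [sq_nonneg (A' * y 3 - B' * y 2)]
  have y1 : y 1 = 0 := by simpa [h.ne'] using t1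
  have y2 : y 2 = 0 := by simpa [h'.ne'] using t2
  have y0 : y 0 = 0 := by simpa [y1, ha.ne'] using e1.symm
  have y3 : y 3 = 0 := by simpa [y2, ha'.ne'] using e2.symm
  apply hy
  ext i; fin_cases i <;> simpa

end real
end Sec


namespace Sec

/-- All the integral conditions for the second family. -/
structure Good (d : Sec ℤ) (P D : Fin 2 → Fin 3 → ℤ) (r : Fin 2 → ℤ) (ac bc ka : ℤ)
    (e : Fin 3 → ℤ) : Prop where
  gen : d.Gen
  iden : ∀ i j, (ac + bc * d.la i * d.la j) * d.pp i j =
    ka * (cr (P 0) (D 0) i * cr (P 1) (D 1) j + cr (P 0) (D 0) j * cr (P 1) (D 1) i)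
  ka : ka ≠ 0
  cr2 : ∀ j, cr (P j) (D j) 2 ≠ 0
  hP : ∀ j, d.G (P j) = - r j * d.G (D j)
  hPD : ∀ j, d.G (P j + D j) = d.G (P j) + d.G (D j)
  hP' : ∀ j, d.G' (P j) = - r j * d.G' (D j)
  hPD' : ∀ j, d.G' (P j + D j) = d.G' (P j) + d.G' (D j)
  hD : ∀ j, d.G (D j) ≠ 0
  nH : ∀ j, (d.H (P j) + r j * d.H (D j)) ^ 2
    - (d.H (P j + D j) - d.H (P j) - d.H (D j)) ^ 2 * r j ≠ 0
  nw : ∀ j, (d.w0 (P j) + r j * d.w0 (D j)) ^ 2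
    - (d.w0 (P j + D j) - d.w0 (P j) - d.w0 (D j)) ^ 2 * r j ≠ 0
  gk : ∀ k, d.gk k ≠ 0
  hes : ∀ k, det3 (fun i j => d.hij i j (Pi.single k 1) (d.la k * d.gk k)) ≠ 0
  cross : ∀ j j', j ≠ j' → dt (cr (P j) (D j)) (P j') ^ 2 -
    dt (cr (P j) (D j)) (D j') ^ 2 * r j' ≠ 0
  rne : ∀ j, r j ≠ 0
  posE : ∀ k, 0 < d.la k * d.gk k → 0 < d.gk k ∧ 0 < d.al k
  posF : ∀ j, 0 < r j → (0 < d.a (P j) + d.c (P j) ∧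
    r j * (d.a (D j) + d.c (D j)) ^ 2 < (d.a (P j) + d.c (P j)) ^ 2) ∧
    (0 < d.a (d.tw (P j)) + d.c (d.tw (P j)) ∧
    r j * (d.a (d.tw (D j)) + d.c (d.tw (D j))) ^ 2 <
      (d.a (d.tw (P j)) + d.c (d.tw (P j))) ^ 2)
  e1 : 0 < d.a e
  e2 : 0 < d.G e
  e3 : 0 < d.a (d.tw e)
  e4 : 0 < d.G' e

section maps
variable {R S : Type} [CommRing R] [CommRing S] (φ : R →+* S)

/-- image of a vector -/
abbrev im (w : Fin 3 → R) : Fin 3 → S := fun i => φ (w i)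

lemma im_add (v w : Fin 3 → R) : im φ (v + w) = im φ v + im φ w := by
  ext i; simp [im]

lemma cr_im (v w : Fin 3 → R) : cr (im φ v) (im φ w) = im φ (cr v w) := by
  ext i; fin_cases i <;> simp [cr, im]

lemma dt_im (v w : Fin 3 → R) : dt (im φ v) (im φ w) = φ (dt v w) := by
  simp [dt, im]

lemma im_single (k : Fin 3) : (Pi.single k 1 : Fin 3 → S) = im φ (Pi.single k 1) := by
  ext i
  by_cases h : i = k
  · subst h; simp [im]
  · simp [im, h]

lemma map_gk (d : Sec R) (k : Fin 3) : (d.map φ).gk k = φ (d.gk k) := by simp [gk, map]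

lemma map_det3 (m : Fin 3 → Fin 3 → R) : det3 (fun i j => φ (m i j)) = φ (det3 m) := by
  simp [det3]

lemma Gen.map {d : Sec R} (h : d.Gen) (hφ : Function.Injective φ) : (d.map φ).Gen := by
  have key : ∀ t : R, t ≠ 0 → φ t ≠ 0 := fun t ht => (map_ne_zero_iff φ hφ).mpr ht
  refine ⟨?_, fun i => key _ (h.la i), fun i j hij hh => h.lne i j hij (hφ hh), fun i j hij => ?_⟩
  · have := key _ h.det
    rw [← map_det3] at this
    convert this using 2
    ext i j
    fin_cases i <;> simp [Sec.map]
  · have h4 : φ 4 = 4 := map_ofNat φ 4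
    have := key _ (h.res i j hij)
    simpa [Sec.res, Sec.map, h4] using this

lemma norm_ne (hφ : Function.Injective φ) {u v r : R} {c : S} (h : u ^ 2 - v ^ 2 * r ≠ 0)
    (hc : c ^ 2 = φ r) : φ u + c * φ v ≠ 0 := by
  intro h0
  apply h
  apply hφ
  simp only [map_sub, map_pow, map_mul, map_zero, ← hc]
  linear_combination (φ u - c * φ v) * h0

end maps

section good
variable {d : Sec ℤ} {P D : Fin 2 → Fin 3 → ℤ} {r : Fin 2 → ℤ} {ac bc ka : ℤ} {e : Fin 3 → ℤ}
variable {F : Type} [Field F] (φ : ℤ →+* F)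

lemma Good.G_zero (h : d.Good P D r ac bc ka e) (j : Fin 2) (c : F) (hc : c ^ 2 = φ (r j)) :
    (d.map φ).G (im φ (P j) + c • im φ (D j)) = 0 := by
  rw [G_line, ← im_add, map_G, map_G, map_G, h.hPD, h.hP, hc]
  simp

lemma Good.G'_zero (h : d.Good P D r ac bc ka e) (j : Fin 2) (c : F) (hc : c ^ 2 = φ (r j)) :
    (d.map φ).G' (im φ (P j) + c • im φ (D j)) = 0 := by
  rw [G'_line, ← im_add, map_G', map_G', map_G', h.hPD', h.hP', hc]
  simp

lemma Good.H_ne (h : d.Good P D r ac bc ka e) (hφ : Function.Injective φ) (j : Fin 2) (c : F)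
    (hc : c ^ 2 = φ (r j)) : (d.map φ).H (im φ (P j) + c • im φ (D j)) ≠ 0 := by
  rw [H_line, ← im_add, map_H, map_H, map_H, hc]
  have := norm_ne φ hφ (h.nH j) hc
  simp only [map_add, map_sub, map_mul] at this
  convert this using 1
  ring

lemma Good.w0_ne (h : d.Good P D r ac bc ka e) (hφ : Function.Injective φ) (j : Fin 2) (c : F)
    (hc : c ^ 2 = φ (r j)) : (d.map φ).w0 (im φ (P j) + c • im φ (D j)) ≠ 0 := by
  rw [w0_line, ← im_add, map_w0, map_w0, map_w0, hc]
  have := norm_ne φ hφ (h.nw j) hc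
  simp only [map_add, map_sub, map_mul] at this
  convert this using 1
  ring

lemma Good.w_ne (h : d.Good P D r ac bc ka e) (hφ : Function.Injective φ) (j : Fin 2) (c : F)
    (hc : c ^ 2 = φ (r j)) : im φ (P j) + c • im φ (D j) ≠ 0 := by
  intro h0
  apply h.w0_ne φ hφ j c hc
  rw [h0]
  simp [w0, pG, a, b, Sec.c]

lemma dt_line (l p q : Fin 3 → F) (c : F) : dt l (p + c • q) = dt l p + c * dt l q := by
  simp [dt]; ring

lemma dt_cr (p q : Fin 3 → F) (c : F) : dt (cr p q) (p + c • q) = 0 := by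
  simp [dt, cr]; ring

lemma Good.cross_ne (h : d.Good P D r ac bc ka e) (hφ : Function.Injective φ) (j j' : Fin 2)
    (hj : j ≠ j') (c : F) (hc : c ^ 2 = φ (r j')) :
    dt (cr (im φ (P j)) (im φ (D j))) (im φ (P j') + c • im φ (D j')) ≠ 0 := by
  rw [dt_line, cr_im, dt_im, dt_im]
  exact norm_ne φ hφ (h.cross j j' hj) hc

lemma Good.split (h : d.Good P D r ac bc ka e) (hφ : Function.Injective φ) (w : Fin 3 → F)
    (h2 : (2 : F) ≠ 0)
    (hG : (d.map φ).G w = 0) (hG' : (d.map φ).G' w = 0) :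
    ∃ j, dt (cr (im φ (P j)) (im φ (D j))) w = 0 := by
  have key : 2 * (φ ac * (d.map φ).G w + φ bc * (d.map φ).G' w) =
      2 * (φ ka * (dt (cr (im φ (P 0)) (im φ (D 0))) w * dt (cr (im φ (P 1)) (im φ (D 1))) w)) := by
    have id : ∀ i j, (φ ac + φ bc * (d.map φ).la i * (d.map φ).la j) * (d.map φ).pp i j =
        φ ka * (cr (im φ (P 0)) (im φ (D 0)) i * cr (im φ (P 1)) (im φ (D 1)) j
          + cr (im φ (P 0)) (im φ (D 0)) j * cr (im φ (P 1)) (im φ (D 1)) i) := by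
      intro i j
      have := congrArg φ (h.iden i j)
      rw [map_pp, cr_im, cr_im]
      simpa [map] using this
    have e1 : 2 * (d.map φ).G w = ∑ i, ∑ j, (d.map φ).pp i j * w i * w j := by
      simp [Fin.sum_univ_three, G, a, b, c, pp]; ring
    have e2 : 2 * (d.map φ).G' w =
        ∑ i, ∑ j, (d.map φ).la i * (d.map φ).la j * (d.map φ).pp i j * w i * w j := by
      simp [Fin.sum_univ_three, G', G, a, b, c, pp, tw]; ring
    have e3 : 2 * (dt (cr (im φ (P 0)) (im φ (D 0))) w * dt (cr (im φ (P 1)) (im φ (D 1))) w) =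
        ∑ i, ∑ j, (cr (im φ (P 0)) (im φ (D 0)) i * cr (im φ (P 1)) (im φ (D 1)) j
          + cr (im φ (P 0)) (im φ (D 0)) j * cr (im φ (P 1)) (im φ (D 1)) i) * w i * w j := by
      simp only [Fin.sum_univ_three, dt]; ring
    have : φ ac * (2 * (d.map φ).G w) + φ bc * (2 * (d.map φ).G' w) =
        φ ka * (2 * (dt (cr (im φ (P 0)) (im φ (D 0))) w *
          dt (cr (im φ (P 1)) (im φ (D 1))) w)) := by
      rw [e1, e2, e3]
      simp only [Finset.mul_sum, ← Finset.sum_add_distrib]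
      refine Finset.sum_congr rfl fun i _ => Finset.sum_congr rfl fun j _ => ?_
      linear_combination (w i * w j) * id i j
    linear_combination this
  rw [hG, hG'] at key
  have hk : φ ka ≠ 0 := (map_ne_zero_iff φ hφ).mpr h.ka
  rw [mul_zero, mul_zero, add_zero, mul_zero] at key
  have key := mul_eq_zero.mp
    ((mul_eq_zero.mp ((mul_eq_zero.mp key.symm).resolve_left h2)).resolve_left hk)
  rcases key with k | k
  · exact ⟨0, k⟩
  · exact ⟨1, k⟩

end good

end Sec


namespace Sec

/-- first three indices -/
abbrev i3 (k : Fin 3) : Fin 5 := Fin.castAdd 2 k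
/-- last two indices -/
abbrev i2 (j : Fin 2) : Fin 5 := Fin.natAdd 3 j

lemma fin5 {p : Fin 5 → Prop} (h3 : ∀ k, p (i3 k)) (h2 : ∀ j, p (i2 j)) (k : Fin 5) : p k := by
  fin_cases k
  · exact h3 0
  · exact h3 1
  · exact h3 2
  · exact h2 0
  · exact h2 1

/-- real version of integral parameters -/
abbrev re (d : Sec ℤ) : Sec ℝ := d.map (Int.castRingHom ℝ)

/-- complex version of integral parameters -/
abbrev co (d : Sec ℤ) : Sec ℂ := d.map (Int.castRingHom ℂ)

lemma re_toC (d : Sec ℤ) : d.re.toC = d.co := by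
  simp [map, toC]

/-- squares of the parameters -/
def rad (d : Sec ℤ) (r : Fin 2 → ℤ) : Fin 5 → ℤ :=
  ![d.la 0 * d.gk 0, d.la 1 * d.gk 1, d.la 2 * d.gk 2, r 0, r 1]

/-- base points of the nodes, as real vectors -/
def nP (P : Fin 2 → Fin 3 → ℤ) : Fin 5 → Fin 4 → ℝ :=
  ![en 0 0, en 1 0, en 2 0, fn (im (Int.castRingHom ℝ) (P 0)), fn (im (Int.castRingHom ℝ) (P 1))]
/-- directions of the nodes, as real vectors -/
def nD (D : Fin 2 → Fin 3 → ℤ) : Fin 5 → Fin 4 → ℝ :=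
  ![Pi.single 3 1, Pi.single 3 1, Pi.single 3 1, fn (im (Int.castRingHom ℝ) (D 0)),
    fn (im (Int.castRingHom ℝ) (D 1))]

/-- real nodes -/
def setS (d : Sec ℤ) (r : Fin 2 → ℤ) : Finset (Fin 5) :=
  Finset.univ.filter fun k => 0 < d.rad r k

lemma rad_i3 (d : Sec ℤ) (r : Fin 2 → ℤ) (k : Fin 3) : d.rad r (i3 k) = d.la k * d.gk k := by
  fin_cases k <;> rfl
lemma rad_i2 (d : Sec ℤ) (r : Fin 2 → ℤ) (j : Fin 2) : d.rad r (i2 j) = r j := by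
  fin_cases j <;> rfl
lemma nP_i3 (P : Fin 2 → Fin 3 → ℤ) (k : Fin 3) : nP P (i3 k) = en k 0 := by
  fin_cases k <;> rfl
lemma nP_i2 (P : Fin 2 → Fin 3 → ℤ) (j : Fin 2) :
    nP P (i2 j) = fn (im (Int.castRingHom ℝ) (P j)) := by
  fin_cases j <;> rfl
lemma nD_i3 (D : Fin 2 → Fin 3 → ℤ) (k : Fin 3) : nD D (i3 k) = Pi.single 3 1 := by
  fin_cases k <;> rfl
lemma nD_i2 (D : Fin 2 → Fin 3 → ℤ) (j : Fin 2) :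
    nD D (i2 j) = fn (im (Int.castRingHom ℝ) (D j)) := by
  fin_cases j <;> rfl

variable (P D : Fin 2 → Fin 3 → ℤ)

lemma nd_i3 (k : Fin 3) (c : ℂ) : nd (nP P) (nD D) (i3 k) c = en k c := by
  ext i
  simp only [nd, nP_i3, nD_i3]
  fin_cases k <;> fin_cases i <;> simp [en]

lemma nd_i2 (j : Fin 2) (c : ℂ) : nd (nP P) (nD D) (i2 j) c =
    fn (im (Int.castRingHom ℂ) (P j) + c • im (Int.castRingHom ℂ) (D j)) := by
  ext i
  simp only [nd, nP_i2, nD_i2]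
  fin_cases i <;> simp [fn, im]

lemma re_i3 (k : Fin 3) (c : ℝ) : nP P (i3 k) + c • nD D (i3 k) = en k c := by
  ext i
  simp only [nP_i3, nD_i3]
  fin_cases k <;> fin_cases i <;> simp [en]

lemma re_i2 (j : Fin 2) (c : ℝ) : nP P (i2 j) + c • nD D (i2 j) =
    fn (im (Int.castRingHom ℝ) (P j) + c • im (Int.castRingHom ℝ) (D j)) := by
  ext i
  simp only [nP_i2, nD_i2]
  fin_cases i <;> simp [fn, im]

lemma adj_zero' (d : Sec ℂ) (hd : d.Gen) (x : Fin 4 → ℂ) (hg : d.g x = 0) :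
    (d.mat x).adjugate = 0 := by
  have hdet : (d.mat x).det = 0 := by
    have := d.euler_f x
    rw [hg] at this
    rw [det_mat]
    simpa using this.symm
  exact adj_zero (d.mat x) (d.mat_symm x) (fun l => d.mat (Pi.single l 1)) hdet
    (fun l => by rw [trace_adj, hg]; rfl) (fun v hv => d.base hd two_ne_zero v hv)

variable {P D} {d : Sec ℤ} {r : Fin 2 → ℤ} {ac bc ka : ℤ} {e : Fin 3 → ℤ}

lemma Good.pd (h : d.Good P D r ac bc ka e) :
    (Qr d.re.Q (fn (im (Int.castRingHom ℝ) e))).PosDef := by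
  rw [Qr_Q]
  apply pd_fn
  · rw [map_a]; exact Int.cast_pos.mpr h.e1
  · rw [map_G]; exact Int.cast_pos.mpr h.e2
  · rw [map_tw, map_a]; exact Int.cast_pos.mpr h.e3
  · rw [map_G']; exact Int.cast_pos.mpr h.e4

lemma fn_inj {F : Type} [Field F] {v w : Fin 3 → F} (h : fn v = fn w) : v = w := by
  rw [← sp_fn v, h, sp_fn]

lemma fn_smul {F : Type} [Field F] (t : F) (w : Fin 3 → F) : t • fn w = fn (t • w) := by
  ext i; fin_cases i <;> simp [fn]

lemma Good.nodeData (h : d.Good P D r ac bc ka e) :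
    NodeData d.re.Q (nP P) (nD D) (fun k => (d.rad r k : ℝ)) (d.setS r) ∅ := by
  have ic : Function.Injective (Int.castRingHom ℂ) := Int.cast_injective
  have ir : Function.Injective (Int.castRingHom ℝ) := Int.cast_injective
  have gC := h.gen.map (Int.castRingHom ℂ) ic
  have der := fun x => d.re.derivs x
  rw [re_toC] at der
  have r3 : ∀ k : Fin 3, ((d.rad r (i3 k) : ℝ) : ℂ) = d.co.la k * d.co.gk k := by
    intro k; rw [rad_i3, map_gk]; simp [map]
  have r2 : ∀ j : Fin 2, ((d.rad r (i2 j) : ℝ) : ℂ) = Int.castRingHom ℂ (r j) := by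
    intro j; rw [rad_i2]; simp
  have rne : ∀ k, d.rad r k ≠ 0 := by
    apply fin5
    · intro k; rw [rad_i3]; exact mul_ne_zero (h.gen.la k) (h.gk k)
    · intro j; rw [rad_i2]; exact h.rne j
  have cne : ∀ k (c : ℂ), c ^ 2 = ((d.rad r k : ℝ) : ℂ) → c ≠ 0 := by
    rintro k c hc rfl
    apply rne k
    have : ((d.rad r k : ℝ) : ℂ) = 0 := by rw [← hc]; simp
    exact_mod_cast this
  have fne : ∀ j (c : ℂ), c ^ 2 = Int.castRingHom ℂ (r j) →
      fn (im (Int.castRingHom ℂ) (P j) + c • im (Int.castRingHom ℂ) (D j)) ≠ 0 := by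
    intro j c hc h0
    apply h.w_ne _ ic j c hc
    rw [← sp_fn (im (Int.castRingHom ℂ) (P j) + c • im (Int.castRingHom ℂ) (D j)), h0]
    ext i; fin_cases i <;> simp [sp]
  have gr : ∀ k c, c ^ 2 = ((d.rad r k : ℝ) : ℂ) → d.co.g (nd (nP P) (nD D) k c) = 0 := by
    apply fin5
    · intro k c hc
      rw [nd_i3]; rw [r3] at hc
      exact g_en _ k c hc
    · intro j c hc
      rw [nd_i2]; rw [r2] at hc
      exact g_fn _ _ (h.G_zero _ j c hc) (h.G'_zero _ j c hc)
  constructor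
  case sing =>
    intro x hx hg
    have hadj := adj_zero' d.co gC x ((der x).1.mp hg)
    by_cases ht : x 3 = 0
    · have hs : sp x ≠ 0 := by
        intro h0
        apply hx
        apply ext_sp
        · rw [h0]; ext i; fin_cases i <;> simp [sp]
        · simpa using ht
      obtain ⟨hG, hG'⟩ := d.co.sing_inf gC x hs ht hadj
      obtain ⟨j, hj⟩ := h.split _ ic (sp x) two_ne_zero hG hG'
      obtain ⟨c, s, hc, hw⟩ := d.co.line_sing (im (Int.castRingHom ℂ) (P j))
        (im (Int.castRingHom ℂ) (D j)) (sp x) (Int.castRingHom ℂ (r j)) hs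
        (by rw [cr_im]; exact (map_ne_zero_iff _ ic).mpr (h.cr2 j)) hj hG
        (by rw [map_G, map_G, h.hP]; simp) (by rw [← im_add, map_G, map_G, map_G, h.hPD, map_add])
        (by rw [map_G]; exact (map_ne_zero_iff _ ic).mpr (h.hD j))
      refine ⟨i2 j, c, s, ?_, ?_⟩
      · rw [r2, hc]
      · rw [nd_i2]
        apply ext_sp
        · rw [sp_smul, sp_fn, hw]
        · rw [ht, Pi.smul_apply, fn_three, smul_zero]
    · obtain ⟨k, c, s, hc, hw⟩ := d.co.sing_en gC x ht hadj
      refine ⟨i3 k, c, s, ?_, ?_⟩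
      · rw [r3, hc]
      · rw [nd_i3, hw]
  case scaleg =>
    intro s x hs
    rw [(der _).1] at hs ⊢
    rw [g_smul, hs, smul_zero]
  case scale =>
    intro s x
    rw [(der _).2, (der _).2, h_smul]
  case grad =>
    intro k c hc
    rw [(der _).1]
    exact gr k c hc
  case rank =>
    intro k c hc
    rw [(der _).2]
    have h0 : d.co.h (nd (nP P) (nD D) k c) *ᵥ (nd (nP P) (nD D) k c) = 0 := by
      rw [euler_h, gr k c hc, smul_zero]
    revert k c
    apply fin5
    · intro k c hc h0
      rw [nd_i3] at h0 ⊢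
      refine rank_eq_three _ _ ?_ h0 ![0, 1, 2] ?_
      · intro hz
        apply cne _ c hc
        rw [← en_three k c, hz]
        rfl
      · rw [r3] at hc
        rw [det_en _ k c hc]
        have e1 : d.co.la k * d.co.gk k = Int.castRingHom ℂ (d.la k * d.gk k) := by
          rw [map_gk, map_mul]; rfl
        rw [e1, im_single (Int.castRingHom ℂ) k]
        simp only [map_hij]
        rw [map_det3]
        exact (map_ne_zero_iff _ ic).mpr (h.hes k)
    · intro j c hc h0
      rw [r2] at hc
      rw [nd_i2] at h0 ⊢
      refine rank_eq_three _ _ (fne j c hc) h0 ![1, 2, 3] ?_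
      rw [det_fn _ _ (h.G_zero _ j c hc) (h.G'_zero _ j c hc)]
      exact mul_ne_zero (mul_ne_zero two_ne_zero (h.H_ne _ ic j c hc))
        (pow_ne_zero 2 (h.w0_ne _ ic j c hc))
  case inj =>
    apply fin5
    · intro k
      apply fin5
      · intro k' c c' s hc hc' heq
        rw [nd_i3, nd_i3] at heq
        have hs := congrArg sp heq
        rw [sp_smul, sp_en, sp_en] at hs
        have h1 := congrFun hs k
        by_cases hk : k = k'
        · subst hk
          refine ⟨rfl, ?_⟩
          simp at h1
          have h3 := congrFun heq 3
          rw [Pi.smul_apply, en_three, en_three, ← h1] at h3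
          simpa using h3
        · simp [hk] at h1
      · intro j' c c' s hc hc' heq
        exfalso
        rw [nd_i3, nd_i2] at heq
        have h3 := congrFun heq 3
        rw [Pi.smul_apply, en_three, fn_three, smul_zero] at h3
        exact cne _ c hc h3
    · intro j
      apply fin5
      · intro k' c c' s hc hc' heq
        exfalso
        rw [nd_i3, nd_i2] at heq
        have h3 := congrFun heq 3
        rw [Pi.smul_apply, en_three, fn_three, smul_eq_mul] at h3
        have hs : s = 0 := (mul_eq_zero.mp h3.symm).resolve_right (cne _ c' hc')
        rw [r2] at hc
        apply fne j c hc
        rw [heq, hs, zero_smul]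
      · intro j' c c' s hc hc' heq
        rw [r2] at hc hc'
        rw [nd_i2, nd_i2] at heq
        by_cases hj : j = j'
        · subst hj
          refine ⟨rfl, ?_⟩
          rw [fn_smul] at heq
          have hw := fn_inj heq
          have w0 := congrFun hw 0
          have w1 := congrFun hw 1
          simp only [Pi.add_apply, Pi.smul_apply, smul_eq_mul] at w0 w1
          have hcr : cr (im (Int.castRingHom ℂ) (P j)) (im (Int.castRingHom ℂ) (D j)) 2 ≠ 0 := by
            rw [cr_im]; exact (map_ne_zero_iff _ ic).mpr (h.cr2 j)
          have hcr' : im (Int.castRingHom ℂ) (P j) 0 * im (Int.castRingHom ℂ) (D j) 1 -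
            im (Int.castRingHom ℂ) (P j) 1 * im (Int.castRingHom ℂ) (D j) 0 ≠ 0 := hcr
          have l2 := Par.lin2 (u := 1 - s) (v := c - s * c') hcr'
            (by linear_combination w0) (by linear_combination w1)
          have hs : s = 1 := by linear_combination - l2.1
          have := l2.2
          rw [hs] at this
          linear_combination this
        · exfalso
          have hw := heq
          rw [fn_smul] at hw
          have hw := congrArg (dt (cr (im (Int.castRingHom ℂ) (P j)) (im (Int.castRingHom ℂ) (D j))))
            (fn_inj hw)
          rw [dt_cr] at hw
          have e1 : ∀ (l v : Fin 3 → ℂ), dt l (s • v) = s * dt l v := by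
            intro l v; simp [dt]; ring
          rw [e1] at hw
          have hs : s = 0 := (mul_eq_zero.mp hw.symm).resolve_right (h.cross_ne _ ic j j' hj c' hc')
          apply fne j c hc
          rw [heq, hs, zero_smul]
  case rne =>
    intro k
    exact_mod_cast rne k
  case pos =>
    intro k
    simp only [setS, Finset.union_empty, Finset.mem_filter, Finset.mem_univ, true_and,
      Int.cast_pos]
  case disj => exact Finset.disjoint_empty_right _
  case inT =>
    intro k hk
    simp at hk
  case inS =>
    intro k hk c hc hne
    simp only [setS, Finset.mem_filter, Finset.mem_univ, true_and] at hk
    refine mem_closure_of_psd _ _ _ h.pd hne (Or.inl ?_)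
    rw [Qr_Q]
    clear hne
    revert k c
    apply fin5
    · intro k c hc hk
      rw [re_i3]
      rw [rad_i3] at hk hc
      obtain ⟨p1, p2⟩ := h.posE k hk
      apply psd_en
      · rw [hc, map_gk]; simp [map]
      · rw [map_gk]; exact Int.cast_pos.mpr p1
      · change 0 < Int.castRingHom ℝ (d.al k)
        exact Int.cast_pos.mpr p2
    · intro j c hc hk
      rw [re_i2]
      rw [rad_i2] at hk hc
      have hc' : c ^ 2 = Int.castRingHom ℝ (r j) := by rw [hc]; simp
      obtain ⟨⟨p1, p2⟩, p3, p4⟩ := h.posF j hk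
      have alin : ∀ p q : Fin 3 → ℝ, d.re.a (p + c • q) = d.re.a p + c * d.re.a q := by
        intro p q; simp [a]; ring
      have clin : ∀ p q : Fin 3 → ℝ, d.re.c (p + c • q) = d.re.c p + c * d.re.c q := by
        intro p q; simp [Sec.c]; ring
      apply psd_fn _ _ (h.G_zero _ j c hc') (h.G'_zero _ j c hc')
      · rw [alin, clin, map_a, map_a, map_c, map_c]
        have := pos_line (p := (d.a (P j) + d.c (P j) : ℤ)) (q := (d.a (D j) + d.c (D j) : ℤ)) hc
          (by exact_mod_cast p1) (by exact_mod_cast p2)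
        push_cast at this
        simp only [Int.coe_castRingHom]
        linarith
      · rw [tw_add, tw_smul, map_tw, map_tw, alin, clin, map_a, map_a, map_c, map_c]
        have := pos_line (p := (d.a (d.tw (P j)) + d.c (d.tw (P j)) : ℤ))
          (q := (d.a (d.tw (D j)) + d.c (d.tw (D j)) : ℤ)) hc
          (by exact_mod_cast p3) (by exact_mod_cast p4)
        push_cast at this
        simp only [Int.coe_castRingHom]
        linarith

lemma Good.target (h : d.Good P D r ac bc ka e) {m : ℕ} (hm : 2 * (d.setS r).card = m) :
    Target m 0 := by
  refine h.nodeData.final d.re.Q_symm _ h.pd ?_ m 0 hm (by simp)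
  intro h0
  have h1 := h.e1
  have : e = 0 := by
    ext i
    have := congrFun (congrArg sp h0) i
    rw [sp_fn] at this
    fin_cases i <;> simpa [sp, im] using this
  rw [this] at h1
  simp [a] at h1

end Sec


namespace Sec

/-- The decidable form of the conditions. -/
abbrev chk (d : Sec ℤ) (P D : Fin 2 → Fin 3 → ℤ) (r : Fin 2 → ℤ) (ac bc ka : ℤ)
    (e : Fin 3 → ℤ) : Prop :=
  (det3 ![d.al, d.be, d.ga] ≠ 0 ∧ (∀ i, d.la i ≠ 0) ∧ (∀ i j, i ≠ j → d.la i ≠ d.la j) ∧ (∀ i j, i ≠ j → d.res i j ≠ 0)) ∧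
  (∀ i j, (ac + bc * d.la i * d.la j) * d.pp i j =
    ka * (cr (P 0) (D 0) i * cr (P 1) (D 1) j + cr (P 0) (D 0) j * cr (P 1) (D 1) i)) ∧
  (ka ≠ 0) ∧
  (∀ j, cr (P j) (D j) 2 ≠ 0) ∧
  (∀ j, d.G (P j) = - r j * d.G (D j)) ∧
  (∀ j, d.G (P j + D j) = d.G (P j) + d.G (D j)) ∧
  (∀ j, d.G' (P j) = - r j * d.G' (D j)) ∧
  (∀ j, d.G' (P j + D j) = d.G' (P j) + d.G' (D j)) ∧
  (∀ j, d.G (D j) ≠ 0) ∧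
  (∀ j, (d.H (P j) + r j * d.H (D j)) ^ 2
    - (d.H (P j + D j) - d.H (P j) - d.H (D j)) ^ 2 * r j ≠ 0) ∧
  (∀ j, (d.w0 (P j) + r j * d.w0 (D j)) ^ 2
    - (d.w0 (P j + D j) - d.w0 (P j) - d.w0 (D j)) ^ 2 * r j ≠ 0) ∧
  (∀ k, d.gk k ≠ 0) ∧
  (∀ k, det3 (fun i j => d.hij i j (Pi.single k 1) (d.la k * d.gk k)) ≠ 0) ∧
  (∀ j j', j ≠ j' → dt (cr (P j) (D j)) (P j') ^ 2 -
    dt (cr (P j) (D j)) (D j') ^ 2 * r j' ≠ 0) ∧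
  (∀ j, r j ≠ 0) ∧
  (∀ k, 0 < d.la k * d.gk k → 0 < d.gk k ∧ 0 < d.al k) ∧
  (∀ j, 0 < r j → (0 < d.a (P j) + d.c (P j) ∧
    r j * (d.a (D j) + d.c (D j)) ^ 2 < (d.a (P j) + d.c (P j)) ^ 2) ∧
    (0 < d.a (d.tw (P j)) + d.c (d.tw (P j)) ∧
    r j * (d.a (d.tw (D j)) + d.c (d.tw (D j))) ^ 2 <
      (d.a (d.tw (P j)) + d.c (d.tw (P j))) ^ 2)) ∧
  (0 < d.a e) ∧
  (0 < d.G e) ∧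
  (0 < d.a (d.tw e)) ∧
  (0 < d.G' e)

lemma Good.of_chk {d : Sec ℤ} {P D : Fin 2 → Fin 3 → ℤ} {r : Fin 2 → ℤ} {ac bc ka : ℤ}
    {e : Fin 3 → ℤ} (h : d.chk P D r ac bc ka e) : d.Good P D r ac bc ka e := by
  obtain ⟨⟨g1, g2, g3, g4⟩, h0, h1, h2, h3, h4, h5, h6, h7, h8, h9, h10, h11, h12, h13, h14, h15, h16, h17, h18, h19⟩ := h
  exact ⟨⟨g1, g2, g3, g4⟩, h0, h1, h2, h3, h4, h5, h6, h7, h8, h9, h10, h11, h12, h13, h14, h15, h16, h17, h18, h19⟩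

end Sec

lemma case_2_0 : Target 4 0 := by
  refine Sec.Good.target (d := ⟨![-1, -1, 1], ![-2, -2, -4], ![2, 8, 4], ![2, 1, 4]⟩)
    (P := ![![-3, 1, 1], ![-9, 4, 2]]) (D := ![![-1, -1, 1], ![-5, 0, 0]]) (r := ![1, 1])
    (ac := 20) (bc := -5) (ka := 9) (e := ![-2, 1, 1])
    (Sec.Good.of_chk (by decide +kernel)) (by decide +kernel)

lemma case_4_0 : Target 8 0 := by
  refine Sec.Good.target (d := ⟨![57, 12, 6], ![-24, -9, -6], ![28, 8, 7], ![5, 10, 16]⟩)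
    (P := ![![-2, 132, -25], ![1, -66, 95]]) (D := ![![8, -198, 100], ![12, -77, 40]]) (r := ![1, -1])
    (ac := -302500) (bc := 3025) (ka := -6) (e := ![0, 0, 1])
    (Sec.Good.of_chk (by decide +kernel)) (by decide +kernel)

lemma case_5_0 : Target 10 0 := by
  refine Sec.Good.target (d := ⟨![2, 1, 1], ![3, 0, 1], ![6, 6, 6], ![1, 5, 3]⟩)
    (P := ![![0, 1, 0], ![5, 3, -6]]) (D := ![![2, 3, -6], ![0, 2, -3]]) (r := ![1, 1])
    (ac := 25) (bc := -1) (ka := -4) (e := ![0, 0, 1])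
    (Sec.Good.of_chk (by decide +kernel)) (by decide +kernel)


/-- For every pair of even integers `m, n ≥ 0` with `2 ≤ m + n ≤ 10` there is a transversal
real determinantal quartic with nonempty spectrahedral region `R`, exactly `m + n` real
nodes, exactly `m` of which lie in the closure of `R` and exactly `n` of which do not. -/
theorem exists_quartic_with_prescribed_real_nodes
    (m n : ℕ) (hm : Even m) (hn : Even n) (h2 : 2 ≤ m + n) (h10 : m + n ≤ 10) :
    ∃ Q : Fin 4 → Matrix (Fin 4) (Fin 4) ℝ,
      (∀ i, (Q i).IsSymm) ∧ Transversal Q ∧ (spectra Q).Nonempty ∧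
      (realNodes Q).ncard = m + n ∧
      (realNodes Q ∩ closure (spectra Q)).ncard = m ∧
      (realNodes Q \ closure (spectra Q)).ncard = n := by
  obtain ⟨a, rfl⟩ := hm
  obtain ⟨b, rfl⟩ := hn
  change Target (a + a) (b + b)
  have ha : a ≤ 5 := by omega
  have hb : b ≤ 5 := by omega
  have hab : a + b ≤ 5 := by omega
  have hab' : 1 ≤ a + b := by omega
  clear h2 h10
  interval_cases a <;> interval_cases b <;> first | (exfalso; omega) | skip
  · exact case_0_1
  · exact case_0_2
  · exact case_0_3
  · exact case_0_4
  · exact case_0_5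
  · exact case_1_0
  · exact case_1_1
  · exact case_1_2
  · exact case_1_3
  · exact case_1_4
  · exact case_2_0
  · exact case_2_1
  · exact case_2_2
  · exact case_2_3
  · exact case_3_0
  · exact case_3_1
  · exact case_3_2
  · exact case_4_0
  · exact case_4_1
  · exact case_5_0

end DetQuartic
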